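/- arXiv:2205.01191 — 2 statements merged into one kernel-verified Lean document; each statement's English description precedes it below -/
import Mathlib

section
/- For every natural number k ≥ 1 the following holds. Let G be a finite simple graph on n vertices such that G is k-creature-free and G does not contain the k-skinny ladder as an induced minor. Then the number of minimal separators of G is at most n^{(8k²)^{k+2} · (4 + (k²+2)(k+2))}. In particular, the number of minimal separators of G is bounded by a polynomial in n of degree O(k³ · (8k²)^{k+2}). -/
open SimpleGraph

/-- `S` is a `u`-`v`-separator in `G`: `u, v ∉ S` and every walk from `u` to `v` meets `S`
(i.e. `u` and `v` lie in different components of `G − S`). -/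
def IsUVSeparator {V : Type*} (G : SimpleGraph V) (S : Set V) (u v : V) : Prop :=
  u ∉ S ∧ v ∉ S ∧ ∀ p : G.Walk u v, ∃ w ∈ p.support, w ∈ S

/-- `S` is an inclusion-minimal `u`-`v`-separator in `G`. -/
def IsMinimalUVSeparator {V : Type*} (G : SimpleGraph V) (S : Set V) (u v : V) : Prop :=
  IsUVSeparator G S u v ∧ ∀ S' ⊂ S, ¬ IsUVSeparator G S' u v

/-- `S` is a minimal separator of `G`. -/
def IsMinimalSeparator {V : Type*} (G : SimpleGraph V) (S : Set V) : Prop :=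
  ∃ u v, IsMinimalUVSeparator G S u v

/-- The (open) neighborhood of a set `A`: vertices outside `A` with a neighbor in `A`. -/
def nbhd {V : Type*} (G : SimpleGraph V) (A : Set V) : Set V :=
  {w | w ∉ A ∧ ∃ a ∈ A, G.Adj w a}

/-- `(A, B, X, Y)` is a `k`-creature in `G`. -/
def IsCreature {V : Type*} (G : SimpleGraph V) (k : ℕ) (A B X Y : Set V) : Prop :=
  A.Nonempty ∧ B.Nonempty ∧ X.Nonempty ∧ Y.Nonempty ∧
  Disjoint A B ∧ Disjoint A X ∧ Disjoint A Y ∧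
  Disjoint B X ∧ Disjoint B Y ∧ Disjoint X Y ∧
  (G.induce A).Connected ∧ (G.induce B).Connected ∧
  (∀ a ∈ A, ∀ w ∈ Y ∪ B, ¬ G.Adj a w) ∧
  (∀ b ∈ B, ∀ w ∈ A ∪ X, ¬ G.Adj b w) ∧
  (∀ x ∈ X, ∃ a ∈ A, G.Adj x a) ∧
  (∀ y ∈ Y, ∃ b ∈ B, G.Adj y b) ∧
  ∃ x y : Fin k → V, Function.Injective x ∧ Function.Injective y ∧
    Set.range x = X ∧ Set.range y = Y ∧
    ∀ i j, G.Adj (x i) (y j) ↔ i = j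

/-- `G` is `k`-creature-free. -/
def CreatureFree {V : Type*} (G : SimpleGraph V) (k : ℕ) : Prop :=
  ∀ A B X Y : Set V, ¬ IsCreature G k A B X Y

/-- The `k`-skinny ladder: vertices `(0, i) = pᵢ`, `(1, i) = qᵢ`, `(2, i) = rᵢ`;
edges `pᵢpᵢ₊₁`, `qᵢqᵢ₊₁`, `pᵢrᵢ`, `qᵢrᵢ`. -/
def skinnyLadder (k : ℕ) : SimpleGraph (Fin 3 × Fin k) :=
  SimpleGraph.fromRel (fun a b =>
    (a.1 = b.1 ∧ a.1 ≠ 2 ∧ (a.2 : ℕ) + 1 = (b.2 : ℕ)) ∨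
    (a.1 ≠ 2 ∧ b.1 = 2 ∧ a.2 = b.2))

/-- `H` is an induced minor of `G`: there are pairwise disjoint nonempty connected branch sets
realizing the adjacencies of `H` exactly. -/
def IsInducedMinor {W V : Type*} (H : SimpleGraph W) (G : SimpleGraph V) : Prop :=
  ∃ B : W → Set V,
    (∀ h, (B h).Nonempty) ∧
    (∀ h, (G.induce (B h)).Connected) ∧
    (Pairwise fun h h' => Disjoint (B h) (B h')) ∧
    ∀ h h', h ≠ h' → ((∃ a ∈ B h, ∃ b ∈ B h', G.Adj a b) ↔ H.Adj h h')

/-- `ζ_G(S)`: the maximum size of an independent set `I ⊆ S` such that no vertex outside `S`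
has more than one neighbor in `I`. -/
noncomputable def zeta {V : Type*} (G : SimpleGraph V) (S : Set V) : ℕ :=
  sSup {n | ∃ I : Set V, I ⊆ S ∧ (∀ a ∈ I, ∀ b ∈ I, ¬ G.Adj a b) ∧
    (∀ v, v ∉ S → (I ∩ G.neighborSet v).ncard ≤ 1) ∧ I.ncard = n}

/-- `D` is a connected component of `G[U]`. -/
def IsCompOf {V : Type*} (G : SimpleGraph V) (U D : Set V) : Prop :=
  D ⊆ U ∧ D.Nonempty ∧ (G.induce D).Connected ∧
  ∀ a ∈ D, ∀ b ∈ U, G.Adj a b → b ∈ D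

section Part1

section Basics
variable {V : Type*} {G : SimpleGraph V}

/-- Reachability closure of `a` along vertices of `W`. -/
def compOf (G : SimpleGraph V) (W : Set V) (a : V) : Set V :=
  {w | Relation.ReflTransGen (fun x y => G.Adj x y ∧ y ∈ W) a w}

theorem mem_compOf_self (W : Set V) (a : V) : a ∈ compOf G W a := Relation.ReflTransGen.refl

theorem compOf_closed {W : Set V} {a x y : V} (hx : x ∈ compOf G W a) (hy : y ∈ W)
    (h : G.Adj x y) : y ∈ compOf G W a := Relation.ReflTransGen.tail hx ⟨h, hy⟩

theorem compOf_subset {W : Set V} {a : V} (ha : a ∈ W) : compOf G W a ⊆ W := by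
  intro w hw
  induction hw with
  | refl => exact ha
  | tail _ h _ => exact h.2

/-- Set-theoretic connectivity. -/
def Conn (G : SimpleGraph V) (A : Set V) : Prop :=
  A.Nonempty ∧ ∀ a ∈ A, ∀ b ∈ A, b ∈ compOf G A a

theorem Conn.cross {A : Set V} (hA : Conn G A) {K : Set V} {u v : V} (hu : u ∈ A) (huK : u ∈ K)
    (hv : v ∈ A) (hvK : v ∉ K) : ∃ x ∈ A, ∃ y ∈ A, x ∈ K ∧ y ∉ K ∧ G.Adj x y := by
  by_contra hcon
  push Not at hcon
  apply hvK
  have := hA.2 u hu v hv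
  have key : v ∈ A ∧ v ∈ K := by
    induction this with
    | refl => exact ⟨hu, huK⟩
    | tail h1 h2 ih =>
      rename_i b c
      by_cases hb : b ∈ A
      · by_cases hbK : b ∈ K
        · refine ⟨h2.2, ?_⟩
          by_contra hc
          exact hcon b hb c h2.2 hbK hc h2.1
        · exact absurd (ih hb hbK).2 hbK
      · exact absurd (compOf_subset hu h1) hb
  exact key.2

theorem conn_of_cross {A : Set V} (hne : A.Nonempty)
    (h : ∀ K ⊆ A, K.Nonempty → K ≠ A → ∃ x ∈ K, ∃ y ∈ A, y ∉ K ∧ G.Adj x y) : Conn G A := by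
  refine ⟨hne, fun a ha b hb => ?_⟩
  by_contra hcon
  obtain ⟨x, hx, y, hy, hyK, hxy⟩ := h (compOf G A a) (compOf_subset ha)
    ⟨a, mem_compOf_self A a⟩ (fun h => hcon (by rw [h]; exact hb))
  exact hyK (compOf_closed hx hy hxy)

theorem conn_of_reach {A : Set V} {r : V} (hr : r ∈ A) (h : ∀ a ∈ A, a ∈ compOf G A r) :
    Conn G A := by
  have key : ∀ a ∈ A, r ∈ compOf G A a := by
    intro a ha
    have := h a ha
    induction this with
    | refl => exact mem_compOf_self _ _
    | tail h1 h2 ih =>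
      rename_i b c
      have hb : b ∈ A := compOf_subset hr h1
      exact Relation.ReflTransGen.head ⟨h2.1.symm, hb⟩ (ih hb)
  refine ⟨⟨r, hr⟩, fun a ha b hb => ?_⟩
  exact Relation.ReflTransGen.trans (key a ha) (h b hb)

theorem compOf_mono {W W' : Set V} (h : W ⊆ W') (a : V) : compOf G W a ⊆ compOf G W' a := by
  intro w hw
  induction hw with
  | refl => exact mem_compOf_self _ _
  | tail _ h2 ih => exact compOf_closed ih (h h2.2) h2.1

theorem conn_compOf (W : Set V) (a : V) : Conn G (compOf G W a) := by
  refine conn_of_reach (mem_compOf_self W a) ?_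
  intro w hw
  have : w ∈ compOf G W a := hw
  induction hw with
  | refl => exact mem_compOf_self _ _
  | tail h1 h2 ih =>
    exact Relation.ReflTransGen.tail (ih h1) ⟨h2.1, this⟩

theorem conn_singleton (a : V) : Conn G ({a} : Set V) :=
  conn_of_reach rfl (by rintro x rfl; exact mem_compOf_self _ _)

theorem Conn.eq_compOf {A W : Set V} (hA : Conn G A) (hAW : A ⊆ W)
    (hcl : ∀ x ∈ A, ∀ y ∈ W, G.Adj x y → y ∈ A) {a : V} (ha : a ∈ A) : compOf G W a = A := by
  apply Set.Subset.antisymm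
  · intro w hw
    induction hw with
    | refl => exact ha
    | tail _ h ih => exact hcl _ ih _ h.2 h.1
  · intro w hw
    exact compOf_mono hAW a (hA.2 a ha w hw)

theorem Conn.toInduce {A : Set V} (hA : Conn G A) : (G.induce A).Connected := by
  obtain ⟨⟨r, hr⟩, h⟩ := hA
  rw [connected_iff_exists_forall_reachable]
  refine ⟨⟨r, hr⟩, ?_⟩
  rintro ⟨w, hw⟩
  have := h r hr w hw
  induction this with
  | refl => exact Reachable.refl _
  | tail h1 h2 ih =>
    rename_i b c
    have hb : b ∈ A := compOf_subset hr h1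
    refine (ih hb).trans (Adj.reachable ?_)
    simpa using h2.1

theorem exists_min_cover {α β : Type*} (R : α → β → Prop) (T : Set β) (D₀ : Finset α)
    (h : ∀ t ∈ T, ∃ d ∈ D₀, R d t) :
    ∃ D ⊆ D₀, (∀ t ∈ T, ∃ d ∈ D, R d t) ∧
      ∀ d ∈ D, ∃ t ∈ T, R d t ∧ ∀ d' ∈ D, R d' t → d' = d := by
  classical
  induction hn : D₀.card using Nat.strong_induction_on generalizing D₀ with
  | _ n ih =>
    by_cases hp : ∀ d ∈ D₀, ∃ t ∈ T, R d t ∧ ∀ d' ∈ D₀, R d' t → d' = d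
    · exact ⟨D₀, Finset.Subset.refl _, h, hp⟩
    · push Not at hp
      obtain ⟨d, hd, hdp⟩ := hp
      obtain ⟨D, hD, h1, h2⟩ := ih (D₀.erase d).card
        (by rw [← hn]; exact Finset.card_erase_lt_of_mem hd) (D₀.erase d) (by
          intro t ht
          obtain ⟨e, he, het⟩ := h t ht
          by_cases hed : e = d
          · subst hed
            obtain ⟨d', hd', hR, hne⟩ := hdp t ht het
            exact ⟨d', Finset.mem_erase.2 ⟨hne, hd'⟩, hR⟩
          · exact ⟨e, Finset.mem_erase.2 ⟨hed, he⟩, het⟩) rfl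
      exact ⟨D, hD.trans (Finset.erase_subset _ _), h1, h2⟩

theorem creature_of {k : ℕ} (hk : 1 ≤ k) (hfree : CreatureFree G k) {ι : Type*} (D : Finset ι)
    (hD : k ≤ D.card) (A B : Set V) (x y : ι → V)
    (hA : Conn G A) (hB : Conn G B) (hdis : Disjoint A B)
    (hAB : ∀ a ∈ A, ∀ b ∈ B, ¬ G.Adj a b)
    (hAY : ∀ a ∈ A, ∀ i ∈ D, ¬ G.Adj a (y i)) (hBX : ∀ b ∈ B, ∀ i ∈ D, ¬ G.Adj b (x i))
    (hXA : ∀ i ∈ D, ∃ a ∈ A, G.Adj (x i) a) (hYB : ∀ i ∈ D, ∃ b ∈ B, G.Adj (y i) b)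
    (hXY : ∀ i ∈ D, ∀ j ∈ D, (G.Adj (x i) (y j) ↔ i = j)) : False := by
  classical
  obtain ⟨D', hD'D, hD'⟩ := Finset.exists_subset_card_eq hD
  let e : Fin k → ι := fun i => ((D'.equivFin.trans (finCongr hD')).symm i : D')
  have heD : ∀ i, e i ∈ D := fun i => hD'D (Subtype.mem _)
  have hinj : Function.Injective e := by
    intro i j hij
    exact (D'.equivFin.trans (finCongr hD')).symm.injective (Subtype.ext hij)
  have hxy : ∀ i j, G.Adj (x (e i)) (y (e j)) ↔ i = j := fun i j =>
    (hXY _ (heD i) _ (heD j)).trans hinj.eq_iff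
  refine hfree A B (Set.range (x ∘ e)) (Set.range (y ∘ e)) ⟨hA.1, hB.1, ⟨_, ⟨⟨0, hk⟩, rfl⟩⟩,
    ⟨_, ⟨⟨0, hk⟩, rfl⟩⟩, hdis, ?_, ?_, ?_, ?_, ?_, hA.toInduce, hB.toInduce, ?_, ?_, ?_, ?_,
    x ∘ e, y ∘ e, ?_, ?_, rfl, rfl, hxy⟩
  · rw [Set.disjoint_left]
    rintro _ ha ⟨i, rfl⟩
    exact hAY _ ha _ (heD i) ((hxy i i).2 rfl)
  · rw [Set.disjoint_left]
    rintro _ ha ⟨i, rfl⟩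
    obtain ⟨b, hb, h⟩ := hYB _ (heD i)
    exact hAB _ ha _ hb h
  · rw [Set.disjoint_left]
    rintro _ hb ⟨i, rfl⟩
    obtain ⟨a, ha, h⟩ := hXA _ (heD i)
    exact hAB _ ha _ hb h.symm
  · rw [Set.disjoint_left]
    rintro _ hb ⟨i, rfl⟩
    exact hBX _ hb _ (heD i) ((hxy i i).2 rfl).symm
  · rw [Set.disjoint_left]
    rintro _ ⟨i, rfl⟩ ⟨j, hj⟩
    obtain ⟨a, ha, h⟩ := hXA _ (heD i)
    exact hAY _ ha _ (heD j) (by simpa [Function.comp] using (hj ▸ h.symm : G.Adj a ((y ∘ e) j)))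
  · rintro a ha w (⟨i, rfl⟩ | hw)
    · exact hAY _ ha _ (heD i)
    · exact hAB _ ha _ hw
  · rintro b hb w (hw | ⟨i, rfl⟩)
    · exact fun h => hAB _ hw _ hb h.symm
    · exact hBX _ hb _ (heD i)
  · rintro _ ⟨i, rfl⟩
    exact hXA _ (heD i)
  · rintro _ ⟨i, rfl⟩
    exact hYB _ (heD i)
  · intro i j hij
    refine (hxy i j).1 ?_
    have : x (e i) = x (e j) := hij
    rw [this]; exact (hxy j j).2 rfl
  · intro i j hij
    refine (hxy i j).1 ?_
    have : y (e i) = y (e j) := hij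
    rw [← this]; exact (hxy i i).2 rfl

end Basics

end Part1

section Part2

section Trace
variable {V : Type*} {G : SimpleGraph V}

/-- The traces `N(C) ∩ N(B)` of connected sets `B ∋ b` anticomplete to `C`. -/
def traceFam (G : SimpleGraph V) (C : Set V) (b : V) : Set (Set V) :=
  {X | ∃ B, Conn G B ∧ b ∈ B ∧ (∀ x ∈ B, x ∉ C ∧ ∀ c ∈ C, ¬ G.Adj c x) ∧
    X = nbhd G C ∩ nbhd G B}

theorem trace_no_shatter {k : ℕ} (hk : 1 ≤ k) (hfree : CreatureFree G k) {C : Set V}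
    (hC : Conn G C) {b : V} (X : Finset V) (hX : k ≤ X.card)
    (hsh : ∀ Y ⊆ X, ∃ T ∈ traceFam G C b, ∀ x ∈ X, x ∈ T ↔ x ∈ Y) : False := by
  classical
  have hXN : ∀ x ∈ X, x ∈ nbhd G C := by
    intro x hx
    obtain ⟨T, ⟨B, _, _, _, rfl⟩, h⟩ := hsh X (Finset.Subset.refl _)
    exact ((h x hx).2 hx).1
  have h1 : ∀ x ∈ X, ∃ B, Conn G B ∧ b ∈ B ∧ (∀ z ∈ B, z ∉ C ∧ ∀ c ∈ C, ¬ G.Adj c z) ∧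
      (∃ z ∈ B, G.Adj z x) ∧ ∀ x' ∈ X, ∀ z ∈ B, G.Adj z x' → x' = x := by
    intro x hx
    obtain ⟨T, ⟨B, hB, hb, hBC, rfl⟩, h⟩ := hsh {x} (by simpa using hx)
    refine ⟨B, hB, hb, hBC, ?_, ?_⟩
    · obtain ⟨z, hz, hzx⟩ := ((h x hx).2 (by simp)).2.2
      exact ⟨z, hz, hzx.symm⟩
    · intro x' hx' z hz hzx
      have : x' ∉ B := by
        intro hx'B
        obtain ⟨_, c, hc, hcx⟩ := hXN x' hx'
        exact (hBC x' hx'B).2 c hc hcx.symm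
      simpa using (h x' hx').1 ⟨hXN x' hx', this, z, hz, hzx.symm⟩
  have hb0 : ∀ x ∈ X, ¬ G.Adj b x := by
    intro x hx hbx
    obtain ⟨T, ⟨B, hB, hb, hBC, rfl⟩, h⟩ := hsh ∅ (by simp)
    have : x ∉ B := by
      intro hx'B
      obtain ⟨_, c, hc, hcx⟩ := hXN x hx
      exact (hBC x hx'B).2 c hc hcx.symm
    simpa using (h x hx).1 ⟨hXN x hx, this, b, hb, hbx.symm⟩
  choose! Bf hBc hbB hBC hBx hBu using h1
  let W : Set V := {z | (∃ x ∈ X, z ∈ Bf x) ∧ ∀ x ∈ X, ¬ G.Adj z x}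
  obtain ⟨x0, hx0⟩ : X.Nonempty := Finset.card_pos.1 (by omega)
  have hbW : b ∈ W := ⟨⟨x0, hx0, hbB x0 hx0⟩, hb0⟩
  let K := compOf G W b
  have hKW : K ⊆ W := compOf_subset hbW
  have hy : ∀ x ∈ X, ∃ y ∈ Bf x, G.Adj y x ∧ ∃ u ∈ K, G.Adj y u := by
    intro x hx
    obtain ⟨z, hz, hzx⟩ := hBx x hx
    obtain ⟨u, hu, y, hy, huK, hyK, huy⟩ := (hBc x hx).cross (K := K) (hbB x hx)
      (mem_compOf_self _ _) hz (fun h => (hKW h).2 x hx hzx)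
    refine ⟨y, hy, ?_, u, huK, huy.symm⟩
    by_contra hyx
    apply hyK
    refine compOf_closed huK ⟨⟨x, hx, hy⟩, ?_⟩ huy
    intro x' hx' hyx'
    have := hBu x hx x' hx' y hy hyx'
    subst this
    exact hyx hyx'
  choose! y hyB hyx hyK using hy
  refine creature_of hk hfree X hX C K (fun x => x) y hC (conn_compOf W b) ?_ ?_ ?_ ?_ ?_ ?_ ?_
  · rw [Set.disjoint_left]
    intro c hc hcK
    obtain ⟨x, hx, hcx⟩ := (hKW hcK).1
    exact (hBC x hx c hcx).1 hc
  · intro c hc u hu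
    obtain ⟨x, hx, hcx⟩ := (hKW hu).1
    exact (hBC x hx u hcx).2 c hc
  · intro c hc x hx
    exact (hBC x hx _ (hyB x hx)).2 c hc
  · intro u hu x hx
    exact (hKW hu).2 x hx
  · intro x hx
    exact (hXN x hx).2
  · intro x hx
    exact hyK x hx
  · intro x hx x' hx'
    constructor
    · intro h
      exact hBu x' hx' x hx _ (hyB x' hx') h.symm
    · rintro rfl
      exact (hyx x hx).symm

theorem sum_choose_le {n k : ℕ} (hn : 2 ≤ n) (m : ℕ) (hm : m < k) :
    ∑ i ∈ Finset.Iic m, n.choose i ≤ n ^ k := by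
  have h1 : ∀ m, ∑ i ∈ Finset.range m, n ^ i ≤ n ^ m := by
    intro m
    induction m with
    | zero => simp
    | succ m ih =>
      rw [Finset.sum_range_succ, pow_succ]
      nlinarith [Nat.zero_le (n ^ m)]
  have h2 : Finset.Iic m = Finset.range (m + 1) := by ext; simp
  rw [h2]
  calc ∑ i ∈ Finset.range (m + 1), n.choose i ≤ ∑ i ∈ Finset.range (m + 1), n ^ i :=
        Finset.sum_le_sum fun i _ => Nat.choose_le_pow n i
    _ ≤ n ^ (m + 1) := h1 _
    _ ≤ n ^ k := Nat.pow_le_pow_right (by omega) hm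

theorem traceFam_ncard [Fintype V] {k : ℕ} (hk : 1 ≤ k) (hfree : CreatureFree G k) {C : Set V}
    (hC : Conn G C) (b : V) (hn : 2 ≤ Fintype.card V) :
    (traceFam G C b).ncard ≤ Fintype.card V ^ k := by
  classical
  let 𝒜 : Finset (Finset V) := (Set.toFinite (traceFam G C b)).toFinset.image
    (fun T => T.toFinset)
  have hcard : 𝒜.card = (traceFam G C b).ncard := by
    rw [Finset.card_image_of_injective, Set.ncard_eq_toFinset_card]
    intro S T h
    simpa using h
  rw [← hcard]
  refine 𝒜.card_le_card_shatterer.trans (Finset.card_shatterer_le_sum_vcDim.trans ?_)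
  refine sum_choose_le hn _ ?_
  unfold Finset.vcDim
  rw [Finset.sup_lt_iff (show (⊥ : ℕ) < k from hk)]
  intro X hX
  rw [Finset.mem_shatterer] at hX
  by_contra hcon
  refine trace_no_shatter hk hfree hC (b := b) X (by omega) ?_
  intro Y hY
  obtain ⟨U, hU, hXU⟩ := hX hY
  obtain ⟨T, hT, rfl⟩ := Finset.mem_image.1 hU
  refine ⟨T, by simpa using hT, ?_⟩
  intro x hx
  rw [← hXU]
  simp [hx]

end Trace

end Part2

section Part3

section PathExtract
variable {V : Type*} {G : SimpleGraph V}

theorem exists_bfs {A : Set V} (hA : Conn G A) {r : V} (hr : r ∈ A) :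
    ∃ (d : V → ℕ) (π : V → V), d r = 0 ∧
      (∀ v ∈ A, v ≠ r → π v ∈ A ∧ G.Adj v (π v) ∧ d (π v) + 1 = d v) ∧
      ∀ u ∈ A, ∀ v ∈ A, G.Adj u v → d u ≤ d v + 1 := by
  classical
  have hc := hA.toInduce
  let d : V → ℕ := fun v => if h : v ∈ A then (G.induce A).dist ⟨v, h⟩ ⟨r, hr⟩ else 0
  have hd : ∀ v (h : v ∈ A), d v = (G.induce A).dist ⟨v, h⟩ ⟨r, hr⟩ := fun v h => by
    simp [d, h]
  have hlip : ∀ u ∈ A, ∀ v ∈ A, G.Adj u v → d u ≤ d v + 1 := by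
    intro u hu v hv huv
    rw [hd u hu, hd v hv]
    have h1 : (G.induce A).Adj ⟨u, hu⟩ ⟨v, hv⟩ := by simpa using huv
    have h2 := hc.dist_triangle (u := ⟨u, hu⟩) (v := ⟨v, hv⟩) (w := ⟨r, hr⟩)
    rw [dist_eq_one_iff_adj.2 h1] at h2
    omega
  have hp : ∀ v ∈ A, v ≠ r → ∃ w ∈ A, G.Adj v w ∧ d w + 1 = d v := by
    intro v hv hvr
    obtain ⟨p, hp⟩ := hc.exists_walk_length_eq_dist ⟨v, hv⟩ ⟨r, hr⟩
    cases p with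
    | nil => exact absurd rfl hvr
    | cons h q =>
      rename_i w
      have hvw : G.Adj v w := by simpa using h
      refine ⟨w, w.2, hvw, ?_⟩
      have h1 := hlip v hv w w.2 hvw
      rw [hd v hv] at h1 ⊢
      rw [hd w w.2] at h1 ⊢
      have h2 : (G.induce A).dist ⟨w.1, w.2⟩ ⟨r, hr⟩ ≤ q.length := dist_le q
      rw [Walk.length_cons] at hp
      omega
  choose! π hπ using hp
  exact ⟨d, π, by rw [hd r hr]; simp, hπ, hlip⟩

/-- `p` restricted to `[lo, hi]` is an induced path. -/
def IndPath (G : SimpleGraph V) (p : ℕ → V) (lo hi : ℕ) : Prop :=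
  (∀ i j, lo ≤ i → i ≤ hi → lo ≤ j → j ≤ hi → p i = p j → i = j) ∧
  ∀ i j, lo ≤ i → i ≤ hi → lo ≤ j → j ≤ hi → (G.Adj (p i) (p j) ↔ (i + 1 = j ∨ j + 1 = i))

theorem conn_of_parent {C : Set V} {r : V} (hr : r ∈ C) (d : V → ℕ) (π : V → V)
    (h : ∀ v ∈ C, v ≠ r → π v ∈ C ∧ G.Adj v (π v) ∧ d (π v) + 1 = d v) : Conn G C := by
  refine conn_of_reach hr ?_
  intro a ha
  induction hn : d a using Nat.strong_induction_on generalizing a with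
  | _ n ih =>
    by_cases har : a = r
    · subst har; exact mem_compOf_self _ _
    · obtain ⟨h1, h2, h3⟩ := h a ha har
      exact compOf_closed (ih (d (π a)) (by omega) (π a) h1 rfl) ha h2.symm

theorem path_extract [Finite V] {k : ℕ} (hk : 1 ≤ k) (hfree : CreatureFree G k) {A B : Set V}
    (hA : Conn G A) (hB : Conn G B) (hdis : Disjoint A B)
    (hAB : ∀ a ∈ A, ∀ b ∈ B, ¬ G.Adj a b) (I : Finset V)
    (hIA : ∀ i ∈ I, ∃ a ∈ A, G.Adj i a) (hIB : ∀ i ∈ I, ∃ b ∈ B, G.Adj i b) :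
    ∃ I' ⊆ I, I.card ≤ k * I'.card ∧ ∃ (p : ℕ → V) (L : ℕ), (∀ j ≤ L, p j ∈ A) ∧
      IndPath G p 0 L ∧ ∀ i ∈ I', ∃ j ≤ L, G.Adj i (p j) := by
  classical
  obtain ⟨r, hr⟩ := hA.1
  obtain ⟨A', hA'⟩ := (Set.toFinite {A' : Set V | A' ⊆ A ∧ r ∈ A' ∧ Conn G A' ∧
    ∀ i ∈ I, ∃ a ∈ A', G.Adj i a}).exists_minimal ⟨A, subset_rfl, hr, hA, hIA⟩
  obtain ⟨⟨hA'A, hrA', hA'c, hIA'⟩, hmin⟩ := hA'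
  obtain ⟨d, π, hdr, hπ, hlip⟩ := exists_bfs hA'c hrA'
  have : Fintype V := Fintype.ofFinite V
  let Lf : Finset V := Finset.univ.filter fun x => x ∈ A' ∧ x ≠ r ∧ ∀ v ∈ A', v ≠ r → π v ≠ x
  have hLf : ∀ x, x ∈ Lf ↔ x ∈ A' ∧ x ≠ r ∧ ∀ v ∈ A', v ≠ r → π v ≠ x := by
    intro x; simp [Lf]
  have hconn : ∀ D ⊆ Lf, Conn G (A' \ (D : Set V)) := by
    intro D hD
    refine conn_of_parent (r := r) ⟨hrA', fun h => ((hLf r).1 (hD h)).2.1 rfl⟩ d π ?_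
    rintro v ⟨hv, _⟩ hvr
    obtain ⟨h1, h2, h3⟩ := hπ v hv hvr
    exact ⟨⟨h1, fun h => ((hLf _).1 (hD h)).2.2 v hv hvr rfl⟩, h2, h3⟩
  -- private colours of leaves
  have hpriv : ∀ x ∈ Lf, ∃ i ∈ I, G.Adj i x ∧ ∀ a ∈ A', G.Adj i a → a = x := by
    intro x hx
    by_contra hcon
    push Not at hcon
    have hx' := (hLf x).1 hx
    have := hmin (y := A' \ (({x} : Finset V) : Set V)) ⟨Set.sdiff_subset.trans hA'A,
      ⟨hrA', by simpa using hx'.2.1.symm⟩, hconn {x} (by simpa using hx), by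
        intro i hi
        obtain ⟨a, ha, hia⟩ := hIA' i hi
        by_cases hax : a = x
        · subst hax
          obtain ⟨a', ha', hia', hne⟩ := hcon i hi hia
          exact ⟨a', ⟨ha', by simpa using hne⟩, hia'⟩
        · exact ⟨a, ⟨ha, by simpa using hax⟩, hia⟩⟩ Set.sdiff_subset
    exact (this hx'.1).2 (by simp)
  choose! col hcolI hcol hcolu using hpriv
  have hcard : Lf.card < k := by
    by_contra hcon
    refine creature_of hk hfree Lf (by omega) (A' \ (Lf : Set V)) B (fun x => x) col
      (hconn Lf subset_rfl) hB (hdis.mono_left (Set.sdiff_subset.trans hA'A)) ?_ ?_ ?_ ?_ ?_ ?_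
    · intro a ha b hb
      exact hAB a (hA'A ha.1) b hb
    · intro a ha x hx hadj
      have := hcolu x hx a ha.1 hadj.symm
      exact ha.2 (by rw [this]; exact hx)
    · intro b hb x hx hadj
      exact hAB x (hA'A ((hLf x).1 hx).1) b hb hadj.symm
    · intro x hx
      obtain ⟨h1, h2, h3⟩ := (hLf x).1 hx
      obtain ⟨h4, h5, h6⟩ := hπ x h1 h2
      exact ⟨π x, ⟨h4, fun h => ((hLf _).1 h).2.2 x h1 h2 rfl⟩, h5⟩
    · intro x hx
      exact hIB _ (hcolI x hx)
    · intro x hx x' hx'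
      constructor
      · intro h
        exact hcolu x' hx' x ((hLf x).1 hx).1 h.symm
      · rintro rfl
        exact (hcol x hx).symm
  -- iterating the parent map
  have hiter : ∀ x ∈ A', ∀ n ≤ d x, π^[n] x ∈ A' ∧ d (π^[n] x) + n = d x := by
    intro x hx n
    induction n with
    | zero => intro _; exact ⟨hx, rfl⟩
    | succ n ih =>
      intro hn
      obtain ⟨h1, h2⟩ := ih (by omega)
      have hne : π^[n] x ≠ r := by
        intro h
        rw [h, hdr] at h2
        omega
      obtain ⟨h3, h4, h5⟩ := hπ _ h1 hne
      rw [Function.iterate_succ_apply']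
      exact ⟨h3, by omega⟩
  have hdesc : ∀ v ∈ A', ∃ x ∈ insert r Lf, x ∈ A' ∧ ∃ n ≤ d x, π^[n] x = v := by
    intro v hv
    obtain ⟨x, hx, hmax⟩ := (Set.toFinite {x | x ∈ A' ∧ ∃ n ≤ d x, π^[n] x = v}).exists_maximalFor
      d _ ⟨v, hv, 0, Nat.zero_le _, rfl⟩
    refine ⟨x, ?_, hx⟩
    rw [Finset.mem_insert]
    by_contra hcon
    push Not at hcon
    obtain ⟨hxr, hxL⟩ := hcon
    rw [hLf] at hxL
    push Not at hxL
    obtain ⟨w, hw, hwr, hwx⟩ := hxL hx.1 hxr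
    obtain ⟨h1, h2, h3⟩ := hπ w hw hwr
    obtain ⟨n, hn, hnv⟩ := hx.2
    rw [hwx] at h3
    have := hmax (j := w) ⟨hw, n + 1, by omega, by rw [Function.iterate_succ_apply, hwx, hnv]⟩
      (by omega)
    omega
  have hx : ∀ i ∈ I, ∃ x ∈ insert r Lf, x ∈ A' ∧ ∃ n ≤ d x, G.Adj i (π^[n] x) := by
    intro i hi
    obtain ⟨a, ha, hia⟩ := hIA' i hi
    obtain ⟨x, h1, h2, n, h3, h4⟩ := hdesc a ha
    exact ⟨x, h1, h2, n, h3, h4 ▸ hia⟩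
  choose! lf hlf1 hlf2 hlf3 using hx
  have hrL : r ∉ Lf := fun h => ((hLf r).1 h).2.1 rfl
  have hpig : ∃ x ∈ insert r Lf, I.card ≤ k * (I.filter fun i => lf i = x).card := by
    by_contra hcon
    push Not at hcon
    have h1 : I.card = ∑ x ∈ insert r Lf, (I.filter fun i => lf i = x).card :=
      Finset.card_eq_sum_card_fiberwise hlf1
    have h2 : k * I.card = ∑ x ∈ insert r Lf, k * (I.filter fun i => lf i = x).card := by
      rw [← Finset.mul_sum, ← h1]
    have h3 : ∑ x ∈ insert r Lf, k * (I.filter fun i => lf i = x).card <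
        ∑ x ∈ insert r Lf, I.card := Finset.sum_lt_sum_of_nonempty (by simp) hcon
    rw [Finset.sum_const, Finset.card_insert_of_notMem hrL, smul_eq_mul] at h3
    have : (Lf.card + 1) * I.card ≤ k * I.card := Nat.mul_le_mul_right _ (by omega)
    omega
  obtain ⟨x, hxL, hxc⟩ := hpig
  have hxA : x ∈ A' := by
    rcases Finset.mem_insert.1 hxL with rfl | h
    · exact hrA'
    · exact ((hLf x).1 h).1
  refine ⟨_, Finset.filter_subset _ _, hxc, fun n => π^[n] x, d x, ?_, ⟨?_, ?_⟩, ?_⟩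
  · intro j hj
    exact hA'A (hiter x hxA j hj).1
  · intro i j _ hi _ hj hij
    have h1 := (hiter x hxA i hi).2
    have h2 := (hiter x hxA j hj).2
    simp only at hij
    rw [hij] at h1
    omega
  · have hstep : ∀ i, i + 1 ≤ d x → G.Adj (π^[i] x) (π^[i + 1] x) := by
      intro i hi
      obtain ⟨h1, h2⟩ := hiter x hxA i (by omega)
      have hne : π^[i] x ≠ r := by
        intro h
        rw [h, hdr] at h2
        omega
      rw [Function.iterate_succ_apply']
      exact (hπ _ h1 hne).2.1
    intro i j _ hi _ hj
    constructor
    · intro hadj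
      obtain ⟨h1, h2⟩ := hiter x hxA i hi
      obtain ⟨h3, h4⟩ := hiter x hxA j hj
      have h5 := hlip _ h1 _ h3 hadj
      have h6 := hlip _ h3 _ h1 hadj.symm
      have h7 : i ≠ j := by rintro rfl; exact G.loopless.irrefl _ hadj
      omega
    · rintro (rfl | rfl)
      · exact hstep i hj
      · exact (hstep j hi).symm
  · intro i hi
    obtain ⟨hi1, rfl⟩ := Finset.mem_filter.1 hi
    exact hlf3 i hi1

end PathExtract

end Part3

section Part4

section Combi

theorem digraph_indep {α : Type*} [DecidableEq α] (R : α → α → Prop) [DecidableRel R] (D : ℕ)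
    (J : Finset α) (h : ∀ c ∈ J, (J.filter fun c' => c' ≠ c ∧ R c c').card ≤ D) :
    ∃ T ⊆ J, J.card ≤ (2 * D + 1) * T.card ∧ ∀ c ∈ T, ∀ c' ∈ T, c ≠ c' → ¬ R c c' := by
  induction hn : J.card using Nat.strong_induction_on generalizing J with
  | _ n ih =>
    rcases J.eq_empty_or_nonempty with rfl | hne
    · refine ⟨∅, subset_rfl, ?_, ?_⟩
      · simp at hn; omega
      · simp
    · have hin : ∃ c ∈ J, (J.filter fun c' => c ≠ c' ∧ R c' c).card ≤ D := by
        by_contra hcon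
        push Not at hcon
        have h1 : ∑ c ∈ J, (J.filter fun c' => c' ≠ c ∧ R c c').card
            = ∑ c ∈ J, (J.filter fun c' => c ≠ c' ∧ R c' c).card := by
          simp only [Finset.card_filter]
          rw [Finset.sum_comm]
        have h2 := Finset.sum_le_sum h
        have h3 := Finset.sum_lt_sum_of_nonempty hne hcon
        omega
      obtain ⟨c, hc, hcD⟩ := hin
      let N := insert c ((J.filter fun c' => c' ≠ c ∧ R c c') ∪
        (J.filter fun c' => c ≠ c' ∧ R c' c))
      have hNJ : N ⊆ J := by
        intro x hx
        simp only [N, Finset.mem_insert, Finset.mem_union, Finset.mem_filter] at hx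
        rcases hx with rfl | hx | hx
        · exact hc
        · exact hx.1
        · exact hx.1
      have hNc : N.card ≤ 2 * D + 1 := by
        have h1 := Finset.card_insert_le c ((J.filter fun c' => c' ≠ c ∧ R c c') ∪
          (J.filter fun c' => c ≠ c' ∧ R c' c))
        have h2 := Finset.card_union_le (J.filter fun c' => c' ≠ c ∧ R c c')
          (J.filter fun c' => c ≠ c' ∧ R c' c)
        have h3 := h c hc
        simp only [N]
        omega
      have hcN : c ∈ N := Finset.mem_insert_self _ _
      have hcard : (J \ N).card + N.card = J.card := Finset.card_sdiff_add_card_eq_card hNJ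
      have hpos : 0 < N.card := Finset.card_pos.2 ⟨c, hcN⟩
      obtain ⟨T, hTJ, hTc, hT⟩ := ih (J \ N).card (by omega) (J \ N) (by
        intro x hx
        refine le_trans (Finset.card_le_card ?_) (h x (Finset.mem_sdiff.1 hx).1)
        exact Finset.filter_subset_filter _ Finset.sdiff_subset) rfl
      have hcT : c ∉ T := fun hh => (Finset.mem_sdiff.1 (hTJ hh)).2 hcN
      have hTN : ∀ x ∈ T, ¬ R c x ∧ ¬ R x c := by
        intro x hx
        have hx' := Finset.mem_sdiff.1 (hTJ hx)
        have hne : x ≠ c := fun hh => hcT (hh ▸ hx)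
        have hxn := hx'.2
        simp only [N, Finset.mem_insert, Finset.mem_union, Finset.mem_filter] at hxn
        push Not at hxn
        exact ⟨hxn.2.1 hx'.1 hne, hxn.2.2 hx'.1 hne.symm⟩
      refine ⟨insert c T, ?_, ?_, ?_⟩
      · intro x hx
        rcases Finset.mem_insert.1 hx with rfl | hx
        · exact hc
        · exact (Finset.mem_sdiff.1 (hTJ hx)).1
      · rw [Finset.card_insert_of_notMem hcT]
        rw [Nat.mul_add]
        omega
      · intro x hx y hy hxy
        rcases Finset.mem_insert.1 hx with rfl | hx1 <;> rcases Finset.mem_insert.1 hy with rfl | hy1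
        · exact absurd rfl hxy
        · exact (hTN y hy1).1
        · exact (hTN x hx1).2
        · exact hT x hx1 y hy1 hxy

theorem enum_finset {α : Type*} (S : Finset α) (f : α → ℕ)
    (hf : ∀ a ∈ S, ∀ b ∈ S, f a = f b → a = b) (hne : S.Nonempty) :
    ∃ c : ℕ → α, (∀ i < S.card, c i ∈ S) ∧
      ∀ i j, i < j → j < S.card → f (c i) < f (c j) := by
  classical
  have hcard : (S.image f).card = S.card := Finset.card_image_of_injOn (fun a ha b hb => hf a ha b hb)
  have hex : ∀ i, ∃ a ∈ S, ∀ hi : i < S.card,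
      f a = (S.image f).orderEmbOfFin hcard ⟨i, hi⟩ := by
    intro i
    by_cases hi : i < S.card
    · have := (S.image f).orderEmbOfFin_mem hcard ⟨i, hi⟩
      obtain ⟨a, ha, hfa⟩ := Finset.mem_image.1 this
      exact ⟨a, ha, fun _ => hfa⟩
    · obtain ⟨a, ha⟩ := hne
      exact ⟨a, ha, fun h => absurd h hi⟩
  choose c hc1 hc2 using hex
  refine ⟨c, fun i _ => hc1 i, fun i j hij hj => ?_⟩
  rw [hc2 i (hij.trans hj), hc2 j hj]
  exact (OrderEmbedding.lt_iff_lt _).2 hij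

theorem erdos_szekeres {α : Type*} (f g : α → ℕ) (s r : ℕ) (T : Finset α)
    (hf : ∀ a ∈ T, ∀ b ∈ T, f a = f b → a = b) (hg : ∀ a ∈ T, ∀ b ∈ T, g a = g b → a = b)
    (hT : r * s < T.card) :
    (∃ S ⊆ T, r + 1 ≤ S.card ∧ ∀ a ∈ S, ∀ b ∈ S, f a < f b → g a < g b) ∨
    (∃ S ⊆ T, s + 1 ≤ S.card ∧ ∀ a ∈ S, ∀ b ∈ S, f a < f b → g b < g a) := by
  classical
  induction r generalizing T with
  | zero =>
    left
    have : 0 < T.card := by omega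
    obtain ⟨x, hx⟩ := Finset.card_pos.1 this
    refine ⟨{x}, by simpa using hx, by simp, ?_⟩
    intro a ha b hb hab
    rw [Finset.mem_singleton] at ha hb
    subst ha; subst hb; omega
  | succ r ih =>
    let M := T.filter fun c => ∀ c' ∈ T, ¬ (f c' < f c ∧ g c' < g c)
    by_cases hM : s + 1 ≤ M.card
    · right
      refine ⟨M, Finset.filter_subset _ _, hM, ?_⟩
      intro a ha b hb hab
      have ha' := Finset.mem_filter.1 ha
      have hb' := Finset.mem_filter.1 hb
      have h1 := hb'.2 a ha'.1
      have h2 : g a ≠ g b := fun h => by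
        have := hg a ha'.1 b hb'.1 h
        subst this; omega
      omega
    · have hcard : (T \ M).card + M.card = T.card :=
        Finset.card_sdiff_add_card_eq_card (Finset.filter_subset _ _)
      have h1 : r * s < (T \ M).card := by
        rw [Nat.add_mul] at hT; omega
      rcases ih (T \ M) (fun a ha b hb => hf a (Finset.sdiff_subset ha) b (Finset.sdiff_subset hb))
        (fun a ha b hb => hg a (Finset.sdiff_subset ha) b (Finset.sdiff_subset hb)) h1 with
        ⟨S, hS, hSc, hSp⟩ | ⟨S, hS, hSc, hSp⟩
      · left
        have hne : S.Nonempty := Finset.card_pos.1 (by omega)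
        obtain ⟨s0, hs0, hmin⟩ := S.exists_min_image f hne
        have hs0' := Finset.mem_sdiff.1 (hS hs0)
        have : ∃ x ∈ T, f x < f s0 ∧ g x < g s0 := by
          by_contra hcon
          push Not at hcon
          apply hs0'.2
          refine Finset.mem_filter.2 ⟨hs0'.1, fun c' hc' h => ?_⟩
          have := hcon c' hc' h.1
          omega
        obtain ⟨x, hxT, hxf, hxg⟩ := this
        have hlt : ∀ b ∈ S, f x < f b ∧ g x < g b := by
          intro b hb
          have h2 := hmin b hb
          refine ⟨by omega, ?_⟩
          rcases h2.lt_or_eq with h3 | h3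
          · have := hSp s0 hs0 b hb h3; omega
          · rw [← hf s0 hs0'.1 b (Finset.sdiff_subset (hS hb)) h3]; exact hxg
        have hxS : x ∉ S := fun h => by have := (hlt x h).1; omega
        refine ⟨insert x S, ?_, ?_, ?_⟩
        · intro y hy
          rcases Finset.mem_insert.1 hy with rfl | hy
          · exact hxT
          · exact Finset.sdiff_subset (hS hy)
        · rw [Finset.card_insert_of_notMem hxS]; omega
        · intro a ha b hb hab
          rcases Finset.mem_insert.1 ha with rfl | ha1 <;> rcases Finset.mem_insert.1 hb with rfl | hb1
          · omega
          · exact (hlt b hb1).2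
          · have := (hlt a ha1).1; omega
          · exact hSp a ha1 b hb1 hab
      · right
        exact ⟨S, hS.trans Finset.sdiff_subset, hSc, hSp⟩

end Combi

section Ladder
variable {V : Type*} {G : SimpleGraph V}

theorem reach_interval {p : ℕ → V} {lo hi : ℕ} {A : Set V} {r : V}
    (hadj : ∀ i, lo ≤ i → i < hi → G.Adj (p i) (p (i + 1)))
    (hA : ∀ i, lo ≤ i → i ≤ hi → p i ∈ A) (h0 : lo ≤ hi → p lo ∈ compOf G A r) :
    ∀ i, lo ≤ i → i ≤ hi → p i ∈ compOf G A r := by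
  intro i hlo
  induction i, hlo using Nat.le_induction with
  | base => exact h0
  | succ i hi' ih =>
    intro h
    exact compOf_closed (ih (by omega)) (hA _ (by omega) h) (hadj i hi' (by omega))

theorem IndPath.conn {p : ℕ → V} {lo hi s e : ℕ} (hp : IndPath G p lo hi) (h1 : lo ≤ s)
    (h2 : s ≤ e) (h3 : e ≤ hi) : Conn G (p '' Set.Icc s e) := by
  refine conn_of_reach (r := p s) ⟨s, ⟨le_rfl, h2⟩, rfl⟩ ?_
  rintro _ ⟨i, hi, rfl⟩
  refine reach_interval (p := p) (lo := s) (hi := e) ?_ ?_ (fun _ => mem_compOf_self _ _) i hi.1 hi.2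
  · intro i h4 h5
    exact (hp.2 i (i + 1) (by omega) (by omega) (by omega) (by omega)).2 (Or.inl rfl)
  · intro i h4 h5
    exact ⟨i, ⟨h4, h5⟩, rfl⟩

theorem seg_lt {s e : ℕ → ℕ} {k : ℕ} (hse : ∀ i < k, s i ≤ e i)
    (hnext : ∀ i, i + 1 < k → e i + 1 = s (i + 1)) {i j : ℕ} (hij : i < j) (hj : j < k) :
    e i < s j := by
  induction j, hij using Nat.le_induction with
  | base => have := hnext i hj; change e i < s (i + 1); omega
  | succ j h ih =>
    have h1 := ih (by omega)
    have h2 := hnext j hj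
    have h3 := hse j (by omega)
    omega

/-- One side of a ladder. -/
structure LSide (G : SimpleGraph V) (p : ℕ → V) (lo hi k : ℕ) (c : ℕ → V) (s e : ℕ → ℕ) : Prop where
  path : IndPath G p lo hi
  lo_le : ∀ i < k, lo ≤ s i
  le_hi : ∀ i < k, e i ≤ hi
  se : ∀ i < k, s i ≤ e i
  next : ∀ i, i + 1 < k → e i + 1 = s (i + 1)
  occ : ∀ i < k, ∃ j, s i ≤ j ∧ j ≤ e i ∧ G.Adj (c i) (p j)
  only : ∀ i < k, ∀ j, lo ≤ j → j ≤ hi → G.Adj (c i) (p j) → s i ≤ j ∧ j ≤ e i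
  ne : ∀ i < k, ∀ j, lo ≤ j → j ≤ hi → c i ≠ p j

theorem LSide.disj {p : ℕ → V} {lo hi k : ℕ} {c : ℕ → V} {s e : ℕ → ℕ}
    (h : LSide G p lo hi k c s e) {i j : ℕ} (hi' : i < k) (hj : j < k) (hij : i ≠ j) :
    Disjoint (p '' Set.Icc (s i) (e i)) (p '' Set.Icc (s j) (e j)) := by
  rw [Set.disjoint_left]
  rintro _ ⟨a, ⟨ha1, ha2⟩, rfl⟩ ⟨b, ⟨hb1, hb2⟩, hab⟩
  have h1 := h.lo_le i hi'
  have h2 := h.lo_le j hj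
  have h3 := h.le_hi i hi'
  have h4 := h.le_hi j hj
  have := h.path.1 b a (by omega) (by omega) (by omega) (by omega) hab
  rcases Nat.lt_or_gt_of_ne hij with h5 | h5
  · have := seg_lt h.se h.next h5 hj; omega
  · have := seg_lt h.se h.next h5 hi'; omega

theorem LSide.adj {p : ℕ → V} {lo hi k : ℕ} {c : ℕ → V} {s e : ℕ → ℕ}
    (h : LSide G p lo hi k c s e) {i j : ℕ} (hi' : i < k) (hj : j < k) (hij : i ≠ j) :
    (∃ a ∈ p '' Set.Icc (s i) (e i), ∃ b ∈ p '' Set.Icc (s j) (e j), G.Adj a b) ↔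
      (i + 1 = j ∨ j + 1 = i) := by
  have h1 := h.lo_le i hi'
  have h2 := h.lo_le j hj
  have h3 := h.le_hi i hi'
  have h4 := h.le_hi j hj
  have h5 := h.se i hi'
  have h6 := h.se j hj
  constructor
  · rintro ⟨_, ⟨a, ⟨ha1, ha2⟩, rfl⟩, _, ⟨b, ⟨hb1, hb2⟩, rfl⟩, hab⟩
    have hab' := (h.path.2 a b (by omega) (by omega) (by omega) (by omega)).1 hab
    by_contra hcon
    push Not at hcon
    rcases Nat.lt_or_gt_of_ne hij with h5 | h5
    · have h6 := seg_lt h.se h.next (i := i + 1) (j := j) (by omega) hj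
      have h7 := h.next i (by omega)
      have h8 := h.se (i + 1) (by omega)
      omega
    · have h6 := seg_lt h.se h.next (i := j + 1) (j := i) (by omega) hi'
      have h7 := h.next j (by omega)
      have h8 := h.se (j + 1) (by omega)
      omega
  · rintro (rfl | rfl)
    · have h7 := h.next i hj
      exact ⟨_, ⟨e i, ⟨h5, le_rfl⟩, rfl⟩, _, ⟨s (i + 1), ⟨le_rfl, h6⟩, rfl⟩,
        (h.path.2 _ _ (by omega) (by omega) (by omega) (by omega)).2 (Or.inl h7)⟩
    · have h7 := h.next j hi'
      exact ⟨_, ⟨s (j + 1), ⟨le_rfl, h5⟩, rfl⟩, _, ⟨e j, ⟨h6, le_rfl⟩, rfl⟩,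
        (h.path.2 _ _ (by omega) (by omega) (by omega) (by omega)).2 (Or.inr h7)⟩

theorem LSide.adjc {p : ℕ → V} {lo hi k : ℕ} {c : ℕ → V} {s e : ℕ → ℕ}
    (h : LSide G p lo hi k c s e) {i j : ℕ} (hi' : i < k) (hj : j < k) :
    (∃ a ∈ p '' Set.Icc (s i) (e i), G.Adj a (c j)) ↔ i = j := by
  have h1 := h.lo_le i hi'
  have h3 := h.le_hi i hi'
  constructor
  · rintro ⟨_, ⟨a, ⟨ha1, ha2⟩, rfl⟩, hab⟩
    have h2 := h.only j hj a (by omega) (by omega) hab.symm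
    by_contra hij
    rcases Nat.lt_or_gt_of_ne hij with h5 | h5
    · have := seg_lt h.se h.next h5 hj; omega
    · have := seg_lt h.se h.next h5 hi'; omega
  · rintro rfl
    obtain ⟨j, hj1, hj2, hj3⟩ := h.occ i hi'
    exact ⟨_, ⟨j, ⟨hj1, hj2⟩, rfl⟩, hj3.symm⟩

theorem ladder_of {p q : ℕ → V} {lo hi lo' hi' k : ℕ} {c : ℕ → V} {s e s' e' : ℕ → ℕ}
    (hp : LSide G p lo hi k c s e) (hq : LSide G q lo' hi' k c s' e')
    (hcross : ∀ i j, lo ≤ i → i ≤ hi → lo' ≤ j → j ≤ hi' → p i ≠ q j ∧ ¬ G.Adj (p i) (q j))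
    (hind : ∀ i < k, ∀ j < k, i ≠ j → c i ≠ c j ∧ ¬ G.Adj (c i) (c j)) :
    IsInducedMinor (skinnyLadder k) G := by
  let P : Fin k → Set V := fun i => p '' Set.Icc (s i) (e i)
  let Q : Fin k → Set V := fun i => q '' Set.Icc (s' i) (e' i)
  have hPw : ∀ i, ∀ a ∈ P i, ∃ j, lo ≤ j ∧ j ≤ hi ∧ a = p j := by
    rintro i _ ⟨j, ⟨h1, h2⟩, rfl⟩
    exact ⟨j, (hp.lo_le i i.2).trans h1, h2.trans (hp.le_hi i i.2), rfl⟩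
  have hQw : ∀ i, ∀ a ∈ Q i, ∃ j, lo' ≤ j ∧ j ≤ hi' ∧ a = q j := by
    rintro i _ ⟨j, ⟨h1, h2⟩, rfl⟩
    exact ⟨j, (hq.lo_le i i.2).trans h1, h2.trans (hq.le_hi i i.2), rfl⟩
  have hPQ : ∀ i j, ∀ a ∈ P i, ∀ b ∈ Q j, a ≠ b ∧ ¬ G.Adj a b := by
    intro i j a ha b hb
    obtain ⟨x, hx1, hx2, rfl⟩ := hPw i a ha
    obtain ⟨y, hy1, hy2, rfl⟩ := hQw j b hb
    exact hcross x y hx1 hx2 hy1 hy2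
  have hPc : ∀ i (j : Fin k), ∀ a ∈ P i, a ≠ c j := by
    intro i j a ha
    obtain ⟨x, hx1, hx2, rfl⟩ := hPw i a ha
    exact (hp.ne j j.2 x hx1 hx2).symm
  have hQc : ∀ i (j : Fin k), ∀ a ∈ Q i, a ≠ c j := by
    intro i j a ha
    obtain ⟨x, hx1, hx2, rfl⟩ := hQw i a ha
    exact (hq.ne j j.2 x hx1 hx2).symm
  let B : Fin 3 × Fin k → Set V := fun x =>
    if x.1 = 0 then P x.2 else if x.1 = 1 then Q x.2 else {c x.2}
  have hB0 : ∀ i, B (0, i) = P i := fun i => by simp [B]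
  have hB1 : ∀ i, B (1, i) = Q i := fun i => by simp [B]
  have hB2 : ∀ i, B (2, i) = {c i} := fun i => by simp [B]
  have hconn : ∀ x, Conn G (B x) := by
    rintro ⟨t, i⟩
    fin_cases t
    · change Conn G (B (0, i)); rw [hB0]
      exact hp.path.conn (hp.lo_le i i.2) (hp.se i i.2) (hp.le_hi i i.2)
    · change Conn G (B (1, i)); rw [hB1]
      exact hq.path.conn (hq.lo_le i i.2) (hq.se i i.2) (hq.le_hi i i.2)
    · change Conn G (B (2, i)); rw [hB2]
      exact conn_singleton _
  have hlad : ∀ x y : Fin 3 × Fin k, (skinnyLadder k).Adj x y ↔ x ≠ y ∧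
    (((x.1 = y.1 ∧ x.1 ≠ 2 ∧ (x.2 : ℕ) + 1 = (y.2 : ℕ)) ∨ (x.1 ≠ 2 ∧ y.1 = 2 ∧ x.2 = y.2)) ∨
    ((y.1 = x.1 ∧ y.1 ≠ 2 ∧ (y.2 : ℕ) + 1 = (x.2 : ℕ)) ∨ (y.1 ≠ 2 ∧ x.1 = 2 ∧ y.2 = x.2))) := by
    intro x y; rfl
  -- symmetric reduction
  have main : ∀ t t' : Fin 3, t ≤ t' → ∀ i j : Fin k, (t, i) ≠ (t', j) →
      Disjoint (B (t, i)) (B (t', j)) ∧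
      ((∃ a ∈ B (t, i), ∃ b ∈ B (t', j), G.Adj a b) ↔ (skinnyLadder k).Adj (t, i) (t', j)) := by
    intro t t' htt i j hne
    rw [hlad]
    fin_cases t <;> fin_cases t'
    · change Disjoint (B (0, i)) (B (0, j)) ∧ ((∃ a ∈ B (0, i), ∃ b ∈ B (0, j), G.Adj a b) ↔ _)
      rw [hB0, hB0]
      have hij : (i : ℕ) ≠ j := fun h => hne (by rw [Fin.ext h])
      refine ⟨hp.disj i.2 j.2 hij, (hp.adj i.2 j.2 hij).trans ?_⟩
      have hij' : i ≠ j := fun h => hij (by rw [h])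
      simp [hij']
    · change Disjoint (B (0, i)) (B (1, j)) ∧ ((∃ a ∈ B (0, i), ∃ b ∈ B (1, j), G.Adj a b) ↔ _)
      rw [hB0, hB1]
      refine ⟨Set.disjoint_left.2 fun a ha hb => (hPQ i j a ha a hb).1 rfl, ?_⟩
      simp only [Fin.zero_eta, Fin.mk_one]
      refine iff_of_false ?_ (by simp)
      rintro ⟨a, ha, b, hb, hab⟩
      exact (hPQ i j a ha b hb).2 hab
    · change Disjoint (B (0, i)) (B (2, j)) ∧ ((∃ a ∈ B (0, i), ∃ b ∈ B (2, j), G.Adj a b) ↔ _)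
      rw [hB0, hB2]
      refine ⟨Set.disjoint_left.2 fun a ha hb => hPc i j a ha hb, ?_⟩
      have := hp.adjc i.2 j.2
      simp only [Set.mem_singleton_iff, exists_eq_left]
      refine this.trans ?_
      simp [Fin.ext_iff]
    · exact absurd htt (by decide)
    · change Disjoint (B (1, i)) (B (1, j)) ∧ ((∃ a ∈ B (1, i), ∃ b ∈ B (1, j), G.Adj a b) ↔ _)
      rw [hB1, hB1]
      have hij : (i : ℕ) ≠ j := fun h => hne (by rw [Fin.ext h])
      refine ⟨hq.disj i.2 j.2 hij, (hq.adj i.2 j.2 hij).trans ?_⟩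
      have hij' : i ≠ j := fun h => hij (by rw [h])
      simp [hij']
    · change Disjoint (B (1, i)) (B (2, j)) ∧ ((∃ a ∈ B (1, i), ∃ b ∈ B (2, j), G.Adj a b) ↔ _)
      rw [hB1, hB2]
      refine ⟨Set.disjoint_left.2 fun a ha hb => hQc i j a ha hb, ?_⟩
      have := hq.adjc i.2 j.2
      simp only [Set.mem_singleton_iff, exists_eq_left]
      refine this.trans ?_
      simp [Fin.ext_iff]
    · exact absurd htt (by decide)
    · exact absurd htt (by decide)
    · change Disjoint (B (2, i)) (B (2, j)) ∧ ((∃ a ∈ B (2, i), ∃ b ∈ B (2, j), G.Adj a b) ↔ _)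
      rw [hB2, hB2]
      have hij : (i : ℕ) ≠ j := fun h => hne (by rw [Fin.ext h])
      have := hind i i.2 j j.2 hij
      refine ⟨by simpa using this.1, ?_⟩
      simp [this.2]
  have main' : ∀ x y, x ≠ y → Disjoint (B x) (B y) ∧
      ((∃ a ∈ B x, ∃ b ∈ B y, G.Adj a b) ↔ (skinnyLadder k).Adj x y) := by
    rintro ⟨t, i⟩ ⟨t', j⟩ hne
    rcases le_total t t' with h | h
    · exact main t t' h i j hne
    · obtain ⟨h1, h2⟩ := main t' t h j i hne.symm
      refine ⟨h1.symm, ?_⟩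
      rw [(skinnyLadder k).adj_comm, ← h2]
      constructor
      · rintro ⟨a, ha, b, hb, hab⟩; exact ⟨b, hb, a, ha, hab.symm⟩
      · rintro ⟨a, ha, b, hb, hab⟩; exact ⟨b, hb, a, ha, hab.symm⟩
  exact ⟨B, fun h => (hconn h).1, fun h => (hconn h).toInduce, fun x y h => (main' x y h).1,
    fun x y h => (main' x y h).2⟩

end Ladder

end Part4

section Part5

section Links
variable {V : Type*} {G : SimpleGraph V}

/-- A window of an induced path on which all letters of `J` occur. -/
structure Side (G : SimpleGraph V) (p : ℕ → V) (lo hi : ℕ) (J : Finset V) : Prop where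
  path : IndPath G p lo hi
  occ : ∀ c ∈ J, ∃ i, lo ≤ i ∧ i ≤ hi ∧ G.Adj c (p i)
  uniq : ∀ i, lo ≤ i → i ≤ hi → ∀ c ∈ J, ∀ c' ∈ J, G.Adj c (p i) → G.Adj c' (p i) → c = c'
  ne : ∀ c ∈ J, ∀ i, lo ≤ i → i ≤ hi → c ≠ p i

theorem IndPath.rev {p : ℕ → V} {lo hi : ℕ} (h : IndPath G p lo hi) :
    IndPath G (fun j => p (lo + hi - j)) lo hi := by
  refine ⟨fun i j h1 h2 h3 h4 hij => ?_, fun i j h1 h2 h3 h4 => ?_⟩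
  · have := h.1 _ _ (by omega) (by omega) (by omega) (by omega) hij
    omega
  · simp only
    rw [h.2 _ _ (by omega) (by omega) (by omega) (by omega)]
    omega

theorem IndPath.sub {p : ℕ → V} {lo hi lo2 hi2 : ℕ} (h : IndPath G p lo hi) (h1 : lo ≤ lo2)
    (h2 : hi2 ≤ hi) : IndPath G p lo2 hi2 :=
  ⟨fun i j a b c d => h.1 i j (by omega) (by omega) (by omega) (by omega),
   fun i j a b c d => h.2 i j (by omega) (by omega) (by omega) (by omega)⟩

theorem Side.mono {p : ℕ → V} {lo hi lo2 hi2 : ℕ} {J J2 : Finset V} (h : Side G p lo hi J)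
    (h1 : lo ≤ lo2) (h2 : hi2 ≤ hi) (hJ : J2 ⊆ J)
    (hocc : ∀ c ∈ J2, ∃ i, lo2 ≤ i ∧ i ≤ hi2 ∧ G.Adj c (p i)) : Side G p lo2 hi2 J2 where
  path := h.path.sub h1 h2
  occ := hocc
  uniq := fun i a b c hc c' hc' => h.uniq i (by omega) (by omega) c (hJ hc) c' (hJ hc')
  ne := fun c hc i a b => h.ne c (hJ hc) i (by omega) (by omega)

theorem Side.fl {p : ℕ → V} {lo hi : ℕ} {J : Finset V} (h : Side G p lo hi J) :
    ∃ f l : V → ℕ, ∀ c ∈ J, lo ≤ f c ∧ f c ≤ l c ∧ l c ≤ hi ∧ G.Adj c (p (f c)) ∧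
      G.Adj c (p (l c)) ∧ ∀ i, lo ≤ i → i ≤ hi → G.Adj c (p i) → f c ≤ i ∧ i ≤ l c := by
  classical
  have key : ∀ c ∈ J, ∃ a b, lo ≤ a ∧ a ≤ b ∧ b ≤ hi ∧ G.Adj c (p a) ∧
      G.Adj c (p b) ∧ ∀ i, lo ≤ i → i ≤ hi → G.Adj c (p i) → a ≤ i ∧ i ≤ b := by
    intro c hc
    obtain ⟨i, h1, h2, h3⟩ := h.occ c hc
    let F := (Finset.Icc lo hi).filter fun i => G.Adj c (p i)
    have hF : ∀ i, i ∈ F ↔ (lo ≤ i ∧ i ≤ hi) ∧ G.Adj c (p i) := by intro i; simp [F]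
    have hne : F.Nonempty := ⟨i, (hF i).2 ⟨⟨h1, h2⟩, h3⟩⟩
    obtain ⟨a, ha, ha'⟩ := F.exists_min_image id hne
    obtain ⟨b, hb, hb'⟩ := F.exists_max_image id hne
    have ha2 := (hF a).1 ha
    have hb2 := (hF b).1 hb
    refine ⟨a, b, ha2.1.1, ha' b hb, hb2.1.2, ha2.2, hb2.2, fun i h1 h2 h3 => ?_⟩
    have := (hF i).2 ⟨⟨h1, h2⟩, h3⟩
    exact ⟨ha' i this, hb' i this⟩
  choose! f l hfl using key
  exact ⟨f, l, hfl⟩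

/-- `W` links `a` to `b`. -/
def Link (G : SimpleGraph V) (W : Set V) (a b : V) : Prop :=
  ∃ Z ⊆ W, ∃ x ∈ W, ∃ y ∈ W, Conn G (insert a Z) ∧ (∃ z ∈ insert a Z, G.Adj x z) ∧ G.Adj y b ∧
    (∀ z ∈ Z, ¬ G.Adj z b) ∧ ¬ G.Adj x b ∧ ¬ G.Adj y a ∧ (∀ z ∈ Z, ¬ G.Adj y z) ∧ G.Adj x y

theorem link_forward {p : ℕ → V} {lo hi i j : ℕ} {a b : V} (hp : IndPath G p lo hi)
    (hlo : lo ≤ i) (hij : i < j) (hj : j ≤ hi) (ha : G.Adj a (p i)) (hb : G.Adj b (p j))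
    (hna : ¬ G.Adj a (p j)) (hnb : ∀ t, i ≤ t → t < j → ¬ G.Adj b (p t)) :
    Link G (p '' Set.Icc lo hi) a b := by
  have hsub : ∀ t, i ≤ t → t ≤ j → p t ∈ p '' Set.Icc lo hi := fun t h1 h2 =>
    ⟨t, ⟨by omega, by omega⟩, rfl⟩
  refine ⟨{z | ∃ t, i ≤ t ∧ t + 1 < j ∧ z = p t}, ?_, p (j - 1), hsub _ (by omega) (by omega),
    p j, hsub _ (by omega) le_rfl, ?_, ?_, hb.symm, ?_, ?_, fun h => hna h.symm, ?_, ?_⟩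
  · rintro _ ⟨t, h1, h2, rfl⟩
    exact hsub t h1 (by omega)
  · refine conn_of_reach (r := a) (Set.mem_insert _ _) ?_
    intro z hz
    rcases hz with rfl | ⟨t, h1, h2, rfl⟩
    · exact mem_compOf_self _ _
    · refine reach_interval (p := p) (lo := i) (hi := j - 2) ?_ ?_ ?_ t h1 (by omega)
      · intro s h3 h4
        exact (hp.2 _ _ (by omega) (by omega) (by omega) (by omega)).2 (Or.inl rfl)
      · intro s h3 h4
        exact Or.inr ⟨s, h3, by omega, rfl⟩
      · intro _
        exact compOf_closed (mem_compOf_self _ _) (Or.inr ⟨i, le_rfl, by omega, rfl⟩) ha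
  · by_cases h : j = i + 1
    · subst h
      exact ⟨a, Set.mem_insert _ _, ha.symm⟩
    · refine ⟨p (j - 2), Or.inr ⟨j - 2, by omega, by omega, rfl⟩, ?_⟩
      exact (hp.2 _ _ (by omega) (by omega) (by omega) (by omega)).2 (Or.inr (by omega))
  · rintro _ ⟨t, h1, h2, rfl⟩ h
    exact hnb t h1 (by omega) h.symm
  · intro h
    exact hnb (j - 1) (by omega) (by omega) h.symm
  · rintro _ ⟨t, h1, h2, rfl⟩ h
    have := (hp.2 _ _ (by omega) (by omega) (by omega) (by omega)).1 h
    omega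
  · exact (hp.2 _ _ (by omega) (by omega) (by omega) (by omega)).2 (Or.inl (by omega))

theorem link_forward' {p : ℕ → V} {lo hi i j : ℕ} {a b : V} (hp : IndPath G p lo hi)
    (hlo : lo ≤ i) (hij : i < j) (hj : j ≤ hi) (ha : G.Adj a (p i)) (hb : G.Adj b (p j))
    (hn : ∀ t, lo ≤ t → t ≤ hi → ¬ (G.Adj a (p t) ∧ G.Adj b (p t))) :
    Link G (p '' Set.Icc lo hi) a b := by
  classical
  have hex : ∃ t, i ≤ t ∧ G.Adj b (p t) := ⟨j, by omega, hb⟩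
  have h1 := Nat.find_spec hex
  have h2 : Nat.find hex ≤ j := Nat.find_min' hex ⟨by omega, hb⟩
  have h3 : Nat.find hex ≠ i := fun h => hn i hlo (by omega) ⟨ha, h ▸ h1.2⟩
  refine link_forward hp hlo (j := Nat.find hex) (by omega) (by omega) ha h1.2
    (fun h => hn _ (by omega) (by omega) ⟨h, h1.2⟩) ?_
  intro t h4 h5 h6
  exact Nat.find_min hex h5 ⟨h4, h6⟩

theorem Side.link {p : ℕ → V} {lo hi : ℕ} {J : Finset V} (h : Side G p lo hi J) {a b : V}
    (ha : a ∈ J) (hb : b ∈ J) (hab : a ≠ b) : Link G (p '' Set.Icc lo hi) a b := by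
  obtain ⟨i, hi1, hi2, hi3⟩ := h.occ a ha
  obtain ⟨j, hj1, hj2, hj3⟩ := h.occ b hb
  have hn : ∀ t, lo ≤ t → t ≤ hi → ¬ (G.Adj a (p t) ∧ G.Adj b (p t)) :=
    fun t h1 h2 h3 => hab (h.uniq t h1 h2 a ha b hb h3.1 h3.2)
  have hij : i ≠ j := fun hh => hn i hi1 hi2 ⟨hi3, hh ▸ hj3⟩
  rcases Nat.lt_or_gt_of_ne hij with hlt | hlt
  · exact link_forward' h.path hi1 hlt hj2 hi3 hj3 hn
  · have := link_forward' (i := lo + hi - i) (j := lo + hi - j) (a := a) (b := b)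
      h.path.rev (by omega) (by omega) (by omega)
      (by rwa [show lo + hi - (lo + hi - i) = i by omega])
      (by rwa [show lo + hi - (lo + hi - j) = j by omega])
      (fun t h1 h2 => hn _ (by omega) (by omega))
    convert this using 1
    ext v
    constructor
    · rintro ⟨t, ⟨h1, h2⟩, rfl⟩
      exact ⟨lo + hi - t, ⟨by omega, by omega⟩, by
        simp only; rw [show lo + hi - (lo + hi - t) = t by omega]⟩
    · rintro ⟨t, ⟨h1, h2⟩, rfl⟩
      exact ⟨lo + hi - t, ⟨by omega, by omega⟩, rfl⟩

/-- Two windows plus letters. -/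
structure Cfg (G : SimpleGraph V) (p : ℕ → V) (lo hi : ℕ) (q : ℕ → V) (lo' hi' : ℕ)
    (J : Finset V) : Prop where
  P : Side G p lo hi J
  Q : Side G q lo' hi' J
  cross : ∀ i j, lo ≤ i → i ≤ hi → lo' ≤ j → j ≤ hi' → p i ≠ q j ∧ ¬ G.Adj (p i) (q j)
  ind : ∀ c ∈ J, ∀ c' ∈ J, ¬ G.Adj c c'

theorem Cfg.swap {p q : ℕ → V} {lo hi lo' hi' : ℕ} {J : Finset V}
    (h : Cfg G p lo hi q lo' hi' J) : Cfg G q lo' hi' p lo hi J where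
  P := h.Q
  Q := h.P
  cross := fun i j h1 h2 h3 h4 => ⟨(h.cross j i h3 h4 h1 h2).1.symm,
    fun hh => (h.cross j i h3 h4 h1 h2).2 hh.symm⟩
  ind := h.ind

/-- The conclusion of the link induction. -/
def HasLinks (G : SimpleGraph V) (m : ℕ) (U : Set V) (J : Finset V) : Prop :=
  ∃ J' ⊆ J, 2 ≤ J'.card ∧ ∃ W : ℕ → Set V, (∀ i < m, W i ⊆ U) ∧
    (∀ i < m, ∀ j < m, i ≠ j → ∀ u ∈ W i, ∀ v ∈ W j, u ≠ v ∧ ¬ G.Adj u v) ∧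
    ∀ i < m, ∀ a ∈ J', ∀ b ∈ J', a ≠ b → Link G (W i) a b

theorem links_split {p q : ℕ → V} {lo hi lo' hi' m d : ℕ} {J : Finset V}
    (h : Cfg G p lo hi q lo' hi' J)
    (ih : ∀ (lo hi : ℕ) (J : Finset V), Cfg G p lo hi q lo' hi' J → d ≤ J.card →
      HasLinks G m (p '' Set.Icc lo hi ∪ q '' Set.Icc lo' hi') J)
    (J1 : Finset V) (hJ1 : J1 ⊆ J) (hd : d ≤ J1.card) (t : ℕ) (hlo : lo ≤ t) (ht : t ≤ hi)
    (h1 : ∀ c ∈ J1, ∃ i, lo ≤ i ∧ i < t ∧ G.Adj c (p i))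
    (h2 : ∀ c ∈ J1, ∃ i, t < i ∧ i ≤ hi ∧ G.Adj c (p i)) :
    HasLinks G (m + 1) (p '' Set.Icc lo hi ∪ q '' Set.Icc lo' hi') J := by
  have hC : Cfg G p (t + 1) hi q lo' hi' J1 :=
    { P := h.P.mono (by omega) le_rfl hJ1 h2
      Q := h.Q.mono le_rfl le_rfl hJ1 (fun c hc => h.Q.occ c (hJ1 hc))
      cross := fun i j h1 h2 => h.cross i j (by omega) (by omega)
      ind := fun c hc c' hc' => h.ind c (hJ1 hc) c' (hJ1 hc') }
  have hL : J1.Nonempty → Side G p lo (t - 1) J1 := by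
    intro _
    refine h.P.mono le_rfl (by omega) hJ1 ?_
    intro c hc
    obtain ⟨i, ha, hb, hc⟩ := h1 c hc
    exact ⟨i, ha, by omega, hc⟩
  obtain ⟨J', hJ', hJ'c, W, hWU, hW, hWL⟩ := ih _ _ _ hC hd
  have hne : J1.Nonempty := by
    obtain ⟨x, hx⟩ := Finset.card_pos.1 (show 0 < J'.card by omega)
    exact ⟨x, hJ' hx⟩
  have htlo : lo < t := by
    obtain ⟨x, hx⟩ := hne
    obtain ⟨i, ha, hb, hc⟩ := h1 x hx
    omega
  have hnew : ∀ i < m, ∀ u ∈ W i, ∀ v ∈ p '' Set.Icc lo (t - 1), u ≠ v ∧ ¬ G.Adj u v := by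
    rintro i hi0 u hu _ ⟨j, ⟨hj1, hj2⟩, rfl⟩
    rcases hWU i hi0 hu with ⟨s, ⟨hs1, hs2⟩, rfl⟩ | ⟨s, ⟨hs1, hs2⟩, rfl⟩
    · refine ⟨fun hh => ?_, fun hh => ?_⟩
      · have := h.P.path.1 _ _ (by omega) (by omega) (by omega) (by omega) hh
        omega
      · have := (h.P.path.2 _ _ (by omega) (by omega) (by omega) (by omega)).1 hh
        omega
    · have := h.cross j s (by omega) (by omega) hs1 hs2
      exact ⟨this.1.symm, fun hh => this.2 hh.symm⟩
  refine ⟨J', hJ'.trans hJ1, hJ'c, fun i => if i < m then W i else p '' Set.Icc lo (t - 1),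
    ?_, ?_, ?_⟩
  · intro i hi0
    by_cases him : i < m
    · simp only [him, if_true]
      refine (hWU i him).trans (Set.union_subset_union_left _ (Set.image_mono ?_))
      exact Set.Icc_subset_Icc (by omega) le_rfl
    · simp only [him, if_false]
      refine Set.Subset.trans (Set.image_mono ?_) Set.subset_union_left
      exact Set.Icc_subset_Icc le_rfl (by omega)
  · intro i hi0 j hj0 hij u hu v hv
    by_cases him : i < m <;> by_cases hjm : j < m
    · simp only [him, hjm, if_true] at hu hv
      exact hW i him j hjm hij u hu v hv
    · simp only [him, hjm, if_true, if_false] at hu hv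
      exact hnew i him u hu v hv
    · simp only [him, hjm, if_true, if_false] at hu hv
      have := hnew j hjm v hv u hu
      exact ⟨this.1.symm, fun hh => this.2 hh.symm⟩
    · omega
  · intro i hi0 a ha b hb hab
    by_cases him : i < m
    · simp only [him, if_true]
      exact hWL i him a ha b hb hab
    · simp only [him, if_false]
      exact (hL hne).link (hJ' ha) (hJ' hb) hab

/-- Build a ladder side from letters with disjoint consecutive spans. -/
theorem lside_of {p : ℕ → V} {lo hi k : ℕ} {c : ℕ → V} {f l : ℕ → ℕ} (hp : IndPath G p lo hi)
    (hne : ∀ i < k, ∀ j, lo ≤ j → j ≤ hi → c i ≠ p j)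
    (hfl : ∀ i < k, lo ≤ f i ∧ f i ≤ l i ∧ l i ≤ hi ∧ G.Adj (c i) (p (f i)) ∧
      ∀ j, lo ≤ j → j ≤ hi → G.Adj (c i) (p j) → f i ≤ j ∧ j ≤ l i)
    (hlt : ∀ i j, i < j → j < k → l i < f j) :
    ∃ e, LSide G p lo hi k c f e := by
  have hle : ∀ i < k, l i ≤ (if i + 1 < k then f (i + 1) - 1 else l i) := by
    intro i hi
    split_ifs with h
    · have := hlt i (i + 1) (by omega) h; omega
    · exact le_rfl
  refine ⟨fun i => if i + 1 < k then f (i + 1) - 1 else l i, hp, fun i hi => (hfl i hi).1, ?_, ?_,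
    ?_, ?_, ?_, hne⟩
  · intro i hi
    split_ifs with h
    · have := hfl (i + 1) h; omega
    · exact (hfl i hi).2.2.1
  · intro i hi
    exact (hfl i hi).2.1.trans (hle i hi)
  · intro i hi
    simp only [hi, if_true]
    have := hlt i (i + 1) (by omega) hi
    omega
  · intro i hi
    exact ⟨f i, le_rfl, (hfl i hi).2.1.trans (hle i hi), (hfl i hi).2.2.2.1⟩
  · intro i hi j h1 h2 h3
    have := (hfl i hi).2.2.2.2 j h1 h2 h3
    exact ⟨this.1, this.2.trans (hle i hi)⟩

end Links

end Part5

section Part5b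

section Links2
variable {V : Type*} {G : SimpleGraph V}

theorem links_ladder {p q : ℕ → V} {lo hi lo' hi' k : ℕ} (hk : 1 ≤ k) {J T : Finset V}
    (h : Cfg G p lo hi q lo' hi' J) (hTJ : T ⊆ J) (hT : k ^ 2 ≤ T.card) {f l f' l' : V → ℕ}
    (hfl : ∀ c ∈ J, lo ≤ f c ∧ f c ≤ l c ∧ l c ≤ hi ∧ G.Adj c (p (f c)) ∧
      G.Adj c (p (l c)) ∧ ∀ i, lo ≤ i → i ≤ hi → G.Adj c (p i) → f c ≤ i ∧ i ≤ l c)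
    (hfl' : ∀ c ∈ J, lo' ≤ f' c ∧ f' c ≤ l' c ∧ l' c ≤ hi' ∧ G.Adj c (q (f' c)) ∧
      G.Adj c (q (l' c)) ∧ ∀ i, lo' ≤ i → i ≤ hi' → G.Adj c (q i) → f' c ≤ i ∧ i ≤ l' c)
    (hs : ∀ c ∈ T, ∀ c' ∈ T, c ≠ c' → f c ≤ f c' → l c < f c')
    (hs' : ∀ c ∈ T, ∀ c' ∈ T, c ≠ c' → f' c ≤ f' c' → l' c < f' c') :
    IsInducedMinor (skinnyLadder k) G := by
  have hinj : ∀ a ∈ T, ∀ b ∈ T, f a = f b → a = b := by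
    intro a ha b hb hab
    by_contra hne
    have h1 := hs a ha b hb hne hab.le
    have h2 := hfl a (hTJ ha)
    omega
  have hinj' : ∀ a ∈ T, ∀ b ∈ T, f' a = f' b → a = b := by
    intro a ha b hb hab
    by_contra hne
    have h1 := hs' a ha b hb hne hab.le
    have h2 := hfl' a (hTJ ha)
    omega
  have hES := erdos_szekeres f f' (k - 1) (k - 1) T hinj hinj' (by
    refine lt_of_lt_of_le ?_ hT
    obtain ⟨j, rfl⟩ := Nat.exists_eq_add_of_le hk
    simp only [Nat.add_sub_cancel_left]
    nlinarith)
  have common : ∀ S ⊆ T, k ≤ S.card → ∃ c : ℕ → V, (∀ i < k, c i ∈ S) ∧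
      (∀ i j, i < j → j < k → f (c i) < f (c j)) := by
    intro S hST hSk
    obtain ⟨c, hc1, hc2⟩ := enum_finset S f (fun a ha b hb => hinj a (hST ha) b (hST hb))
      (Finset.card_pos.1 (by omega))
    exact ⟨c, fun i hi => hc1 i (by omega), fun i j hij hj => hc2 i j hij (by omega)⟩
  have fin : ∀ (q : ℕ → V) (f' l' : V → ℕ) (c : ℕ → V),
      IndPath G q lo' hi' →
      (∀ i j, lo ≤ i → i ≤ hi → lo' ≤ j → j ≤ hi' → p i ≠ q j ∧ ¬ G.Adj (p i) (q j)) →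
      (∀ c ∈ J, ∀ i, lo' ≤ i → i ≤ hi' → c ≠ q i) →
      (∀ c ∈ J, lo' ≤ f' c ∧ f' c ≤ l' c ∧ l' c ≤ hi' ∧ G.Adj c (q (f' c)) ∧
        ∀ i, lo' ≤ i → i ≤ hi' → G.Adj c (q i) → f' c ≤ i ∧ i ≤ l' c) →
      (∀ i < k, c i ∈ T) → (∀ i j, i < j → j < k → f (c i) < f (c j)) →
      (∀ i j, i < j → j < k → l' (c i) < f' (c j)) → IsInducedMinor (skinnyLadder k) G := by
    intro q f' l' c hq hcr hne hfl' hcT hcf hcl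
    obtain ⟨e, he⟩ := lside_of (k := k) (c := c) (f := fun i => f (c i)) (l := fun i => l (c i))
      h.P.path (fun i hi => h.P.ne _ (hTJ (hcT i hi))) (fun i hi => by
        have := hfl _ (hTJ (hcT i hi))
        exact ⟨this.1, this.2.1, this.2.2.1, this.2.2.2.1, this.2.2.2.2.2⟩)
      (fun i j hij hj => by
        have h1 := hcf i j hij hj
        exact hs _ (hcT i (by omega)) _ (hcT j hj) (fun hh => by rw [hh] at h1; omega) h1.le)
    obtain ⟨e', he'⟩ := lside_of (k := k) (c := c) (f := fun i => f' (c i))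
      (l := fun i => l' (c i)) hq (fun i hi => hne _ (hTJ (hcT i hi))) (fun i hi =>
        hfl' _ (hTJ (hcT i hi))) hcl
    refine ladder_of he he' hcr ?_
    intro i hi j hj hij
    refine ⟨fun hh => ?_, h.ind _ (hTJ (hcT i hi)) _ (hTJ (hcT j hj))⟩
    rcases Nat.lt_or_gt_of_ne hij with h5 | h5
    · have := hcf i j h5 hj; rw [hh] at this; omega
    · have := hcf j i h5 hi; rw [hh] at this; omega
  rcases hES with ⟨S, hST, hSc, hSp⟩ | ⟨S, hST, hSc, hSp⟩
  · obtain ⟨c, hc1, hc2⟩ := common S hST (by omega)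
    refine fin q f' l' c h.Q.path h.cross h.Q.ne (fun c hc => by
      have := hfl' c hc
      exact ⟨this.1, this.2.1, this.2.2.1, this.2.2.2.1, this.2.2.2.2.2⟩)
      (fun i hi => hST (hc1 i hi)) hc2 ?_
    intro i j hij hj
    have h1 := hc2 i j hij hj
    have h2 := hSp _ (hc1 i (by omega)) _ (hc1 j hj) h1
    exact hs' _ (hST (hc1 i (by omega))) _ (hST (hc1 j hj)) (fun hh => by rw [hh] at h1; omega)
      h2.le
  · obtain ⟨c, hc1, hc2⟩ := common S hST (by omega)
    refine fin (fun j => q (lo' + hi' - j)) (fun c => lo' + hi' - l' c)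
      (fun c => lo' + hi' - f' c) c h.Q.path.rev
      (fun i j h1 h2 h3 h4 => h.cross i _ h1 h2 (by omega) (by omega))
      (fun c hc i h1 h2 => h.Q.ne c hc _ (by omega) (by omega)) (fun c hc => by
        obtain ⟨h1, h2, h3, h4, h5, h6⟩ := hfl' c hc
        refine ⟨by omega, by omega, by omega, ?_, ?_⟩
        · rwa [show lo' + hi' - (lo' + hi' - l' c) = l' c by omega]
        · intro i h7 h8 h9
          have := h6 _ (by omega) (by omega) h9
          omega)
      (fun i hi => hST (hc1 i hi)) hc2 ?_
    intro i j hij hj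
    have h1 := hc2 i j hij hj
    have h2 := hSp _ (hc1 i (by omega)) _ (hc1 j hj) h1
    have h3 := hs' _ (hST (hc1 j hj)) _ (hST (hc1 i (by omega)))
      (fun hh => by rw [hh] at h1; omega) h2.le
    have h4 := hfl' _ (hTJ (hST (hc1 i (by omega))))
    have h5 := hfl' _ (hTJ (hST (hc1 j hj)))
    omega

theorem links_ind {k : ℕ} (hk : 1 ≤ k) (hlad : ¬ IsInducedMinor (skinnyLadder k) G) (m : ℕ) :
    ∀ (p : ℕ → V) (lo hi : ℕ) (q : ℕ → V) (lo' hi' : ℕ) (J : Finset V),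
      Cfg G p lo hi q lo' hi' J → 2 * (4 * k ^ 2) ^ m ≤ J.card →
      HasLinks G m (p '' Set.Icc lo hi ∪ q '' Set.Icc lo' hi') J := by
  classical
  induction m with
  | zero =>
    intro p lo hi q lo' hi' J h hJ
    refine ⟨J, subset_rfl, by simpa using hJ, fun _ => ∅, ?_, ?_, ?_⟩ <;>
    · intro i hi; omega
  | succ m ih =>
    intro p lo hi q lo' hi' J h hJ
    obtain ⟨f, l, hfl⟩ := h.P.fl
    obtain ⟨f', l', hfl'⟩ := h.Q.fl
    have hdpos : 0 < 2 * (4 * k ^ 2) ^ m := by positivity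
    have hJ2 : (4 * k ^ 2) * (2 * (4 * k ^ 2) ^ m) ≤ J.card := by
      refine le_trans (le_of_eq ?_) hJ
      ring
    generalize 2 * (4 * k ^ 2) ^ m = d at *
    by_cases h1 : ∃ c ∈ J, d ≤ (J.filter fun c' => c' ≠ c ∧ (f c' ≤ f c ∧ f c ≤ l c')).card
    · obtain ⟨c, hc, hcd⟩ := h1
      have hfc := hfl c hc
      refine links_split h (fun lo hi J => ih p lo hi q lo' hi' J) _ (Finset.filter_subset _ _)
        hcd (f c) (by omega) (by omega) ?_ ?_
      · intro c' hc'
        obtain ⟨hc'J, hne, h2, h3⟩ := Finset.mem_filter.1 hc'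
        have h4 := hfl c' hc'J
        refine ⟨f c', by omega, lt_of_le_of_ne h2 ?_, h4.2.2.2.1⟩
        intro hh
        exact hne (h.P.uniq (f c') (by omega) (by omega) c' hc'J c hc h4.2.2.2.1
          (hh ▸ hfc.2.2.2.1))
      · intro c' hc'
        obtain ⟨hc'J, hne, h2, h3⟩ := Finset.mem_filter.1 hc'
        have h4 := hfl c' hc'J
        refine ⟨l c', lt_of_le_of_ne h3 ?_, by omega, h4.2.2.2.2.1⟩
        intro hh
        exact hne (h.P.uniq (l c') (by omega) (by omega) c' hc'J c hc h4.2.2.2.2.1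
          (hh ▸ hfc.2.2.2.1))
    by_cases h2 : ∃ c ∈ J, d ≤ (J.filter fun c' => c' ≠ c ∧ (f' c' ≤ f' c ∧ f' c ≤ l' c')).card
    · obtain ⟨c, hc, hcd⟩ := h2
      have hfc := hfl' c hc
      rw [Set.union_comm]
      refine links_split h.swap (fun lo' hi' J hC hd => ih q lo' hi' p lo hi J hC hd) _
        (Finset.filter_subset _ _) hcd (f' c) (by omega) (by omega) ?_ ?_
      · intro c' hc'
        obtain ⟨hc'J, hne, h2, h3⟩ := Finset.mem_filter.1 hc'
        have h4 := hfl' c' hc'J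
        refine ⟨f' c', by omega, lt_of_le_of_ne h2 ?_, h4.2.2.2.1⟩
        intro hh
        exact hne (h.Q.uniq (f' c') (by omega) (by omega) c' hc'J c hc h4.2.2.2.1
          (hh ▸ hfc.2.2.2.1))
      · intro c' hc'
        obtain ⟨hc'J, hne, h2, h3⟩ := Finset.mem_filter.1 hc'
        have h4 := hfl' c' hc'J
        refine ⟨l' c', lt_of_le_of_ne h3 ?_, by omega, h4.2.2.2.2.1⟩
        intro hh
        exact hne (h.Q.uniq (l' c') (by omega) (by omega) c' hc'J c hc h4.2.2.2.2.1
          (hh ▸ hfc.2.2.2.1))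
    exfalso
    push Not at h1 h2
    obtain ⟨T, hTJ, hTc, hT⟩ := digraph_indep
      (fun c c' => (f c' ≤ f c ∧ f c ≤ l c') ∨ (f' c' ≤ f' c ∧ f' c ≤ l' c')) (2 * (d - 1)) J (by
        intro c hc
        have h3 := h1 c hc
        have h4 := h2 c hc
        refine le_trans (Finset.card_le_card (t := (J.filter fun c' => c' ≠ c ∧
          (f c' ≤ f c ∧ f c ≤ l c')) ∪ (J.filter fun c' => c' ≠ c ∧
          (f' c' ≤ f' c ∧ f' c ≤ l' c'))) ?_) ((Finset.card_union_le _ _).trans (by omega))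
        intro x hx
        simp only [Finset.mem_filter, Finset.mem_union] at hx ⊢
        tauto)
    have hTk : k ^ 2 ≤ T.card := by
      have h3 : (4 * d) * k ^ 2 ≤ (4 * d) * T.card := by
        calc (4 * d) * k ^ 2 = 4 * k ^ 2 * d := by ring
          _ ≤ _ := hJ2
          _ ≤ _ := hTc
          _ ≤ _ := Nat.mul_le_mul_right _ (by omega)
      exact Nat.le_of_mul_le_mul_left h3 (by omega)
    refine hlad (links_ladder hk h hTJ hTk hfl hfl' ?_ ?_)
    · intro c hc c' hc' hne hle
      have := hT c' hc' c hc hne.symm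
      push Not at this
      exact this.1 hle
    · intro c hc c' hc' hne hle
      have := hT c' hc' c hc hne.symm
      push Not at this
      exact this.2 hle

theorem z_bound [Finite V] {k : ℕ} (hk : 1 ≤ k) (hfree : CreatureFree G k)
    (hlad : ¬ IsInducedMinor (skinnyLadder k) G) {A B : Set V}
    (hA : Conn G A) (hB : Conn G B) (hdis : Disjoint A B)
    (hAB : ∀ a ∈ A, ∀ b ∈ B, ¬ G.Adj a b) (I : Finset V)
    (hIA : ∀ i ∈ I, ∃ a ∈ A, G.Adj i a) (hIB : ∀ i ∈ I, ∃ b ∈ B, G.Adj i b)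
    (hnA : ∀ i ∈ I, i ∉ A) (hnB : ∀ i ∈ I, i ∉ B) (hind : ∀ i ∈ I, ∀ j ∈ I, ¬ G.Adj i j)
    (huniq : ∀ v, v ∈ A ∨ v ∈ B → ∀ i ∈ I, ∀ j ∈ I, G.Adj i v → G.Adj j v → i = j) :
    I.card < k * (k * (2 * (4 * k ^ 2) ^ k)) := by
  classical
  by_contra hcon
  push Not at hcon
  obtain ⟨I1, hI1, hI1c, p, L, hpA, hp, hpo⟩ := path_extract hk hfree hA hB hdis hAB I hIA hIB
  obtain ⟨I2, hI2, hI2c, q, L', hqB, hq, hqo⟩ := path_extract hk hfree hB hA hdis.symm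
    (fun b hb a ha h => hAB a ha b hb h.symm) I1 (fun i hi => hIB i (hI1 hi))
    (fun i hi => hIA i (hI1 hi))
  have hI2I := hI2.trans hI1
  have hcard : 2 * (4 * k ^ 2) ^ k ≤ I2.card := by
    have h1 := Nat.le_of_mul_le_mul_left (hcon.trans hI1c) hk
    exact Nat.le_of_mul_le_mul_left (h1.trans hI2c) hk
  have hC : Cfg G p 0 L q 0 L' I2 :=
    { P := ⟨hp, fun c hc => by
          obtain ⟨j, h1, h2⟩ := hpo c (hI2 hc)
          exact ⟨j, Nat.zero_le _, h1, h2⟩,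
        fun i _ h2 c hc c' hc' => huniq _ (Or.inl (hpA i h2)) c (hI2I hc) c' (hI2I hc'),
        fun c hc i _ h2 hh => hnA c (hI2I hc) (hh ▸ hpA i h2)⟩
      Q := ⟨hq, fun c hc => by
          obtain ⟨j, h1, h2⟩ := hqo c hc
          exact ⟨j, Nat.zero_le _, h1, h2⟩,
        fun i _ h2 c hc c' hc' => huniq _ (Or.inr (hqB i h2)) c (hI2I hc) c' (hI2I hc'),
        fun c hc i _ h2 hh => hnB c (hI2I hc) (hh ▸ hqB i h2)⟩
      cross := fun i j _ h2 _ h4 => ⟨fun hh => Set.disjoint_left.1 hdis (hpA i h2)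
        (hh ▸ hqB j h4), hAB _ (hpA i h2) _ (hqB j h4)⟩
      ind := fun c hc c' hc' => hind c (hI2I hc) c' (hI2I hc') }
  obtain ⟨J, hJ, hJc, W, hWU, hWd, hWL⟩ := links_ind hk hlad k p 0 L q 0 L' I2 hC hcard
  obtain ⟨a, ha, b, hb, hab⟩ := Finset.one_lt_card.1 (show 1 < J.card by omega)
  have hWAB : ∀ i < k, ∀ w ∈ W i, w ∈ A ∨ w ∈ B := by
    intro i hi w hw
    rcases hWU i hi hw with ⟨j, hj, rfl⟩ | ⟨j, hj, rfl⟩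
    · exact Or.inl (hpA j hj.2)
    · exact Or.inr (hqB j hj.2)
  have hlink : ∀ i, ∃ Z x y, i < k → (Z ⊆ W i ∧ x ∈ W i ∧ y ∈ W i ∧
    Conn G (insert a Z) ∧ (∃ z ∈ insert a Z, G.Adj x z) ∧ G.Adj y b ∧
    (∀ z ∈ Z, ¬ G.Adj z b) ∧ ¬ G.Adj x b ∧ ¬ G.Adj y a ∧ (∀ z ∈ Z, ¬ G.Adj y z) ∧ G.Adj x y) := by
    intro i
    by_cases hi : i < k
    · obtain ⟨Z, hZ, x, hx, y, hy, h⟩ := hWL i hi a ha b hb hab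
      exact ⟨Z, x, y, fun _ => ⟨hZ, hx, hy, h⟩⟩
    · exact ⟨∅, a, a, fun h => absurd h hi⟩
  choose Z x y hZ using hlink
  have haI := hI2I (hJ ha)
  have hbI := hI2I (hJ hb)
  let A0 : Set V := insert a {z | ∃ i < k, z ∈ Z i}
  refine creature_of hk hfree (Finset.range k) (by simp) A0 {b} x y ?_ (conn_singleton b)
    ?_ ?_ ?_ ?_ ?_ ?_ ?_
  · refine conn_of_reach (r := a) (Set.mem_insert _ _) ?_
    intro z hz
    rcases hz with rfl | ⟨i, hi, hz⟩
    · exact mem_compOf_self _ _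
    · have h1 := (hZ i hi).2.2.2.1.2 a (Set.mem_insert _ _) z (Set.mem_insert_of_mem _ hz)
      refine compOf_mono ?_ a h1
      intro w hw
      rcases hw with rfl | hw
      · exact Set.mem_insert _ _
      · exact Or.inr ⟨i, hi, hw⟩
  · rw [Set.disjoint_singleton_right]
    rintro (h | ⟨i, hi, hz⟩)
    · exact hab h.symm
    · rcases hWAB i hi b ((hZ i hi).1 hz) with h | h
      · exact hnA b hbI h
      · exact hnB b hbI h
  · rintro z hz _ rfl
    rcases hz with rfl | ⟨i, hi, hz⟩
    · exact hind _ haI _ hbI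
    · exact (hZ i hi).2.2.2.2.2.2.1 z hz
  · rintro z hz i hi
    have hi := Finset.mem_range.1 hi
    obtain ⟨h1, h2, h3, h4, h5, h6, h7, h8, h9, h10, h11⟩ := hZ i hi
    rcases hz with rfl | ⟨j, hj, hz⟩
    · exact fun h => h9 h.symm
    · by_cases hij : j = i
      · subst hij
        exact fun h => h10 z hz h.symm
      · exact (hWd j hj i hi hij z ((hZ j hj).1 hz) _ h3).2
  · rintro _ rfl i hi h
    have hi := Finset.mem_range.1 hi
    exact (hZ i hi).2.2.2.2.2.2.2.1 h.symm
  · intro i hi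
    have hi := Finset.mem_range.1 hi
    obtain ⟨z, hz, hxz⟩ := (hZ i hi).2.2.2.2.1
    refine ⟨z, ?_, hxz⟩
    rcases hz with rfl | hz
    · exact Set.mem_insert _ _
    · exact Or.inr ⟨i, hi, hz⟩
  · intro i hi
    have hi := Finset.mem_range.1 hi
    exact ⟨b, rfl, (hZ i hi).2.2.2.2.2.1⟩
  · intro i hi j hj
    have hi := Finset.mem_range.1 hi
    have hj := Finset.mem_range.1 hj
    constructor
    · intro h
      by_contra hij
      exact (hWd i hi j hj hij _ (hZ i hi).2.1 _ (hZ j hj).2.2.1).2 h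
    · rintro rfl
      exact (hZ i hi).2.2.2.2.2.2.2.2.2.2

end Links2

end Part5b

section Part6

section Sep
variable {V : Type*} {G : SimpleGraph V}

/-- `S` separates `A` from `B` fully inside `U`. -/
structure FSep (G : SimpleGraph V) (U S A B : Set V) : Prop where
  AU : A ⊆ U
  BU : B ⊆ U
  SU : S ⊆ U
  connA : Conn G A
  connB : Conn G B
  AB : ∀ a ∈ A, a ∉ B
  nAB : ∀ a ∈ A, ∀ b ∈ B, ¬ G.Adj a b
  SA : ∀ s ∈ S, s ∉ A
  SB : ∀ s ∈ S, s ∉ B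
  domA : ∀ s ∈ S, ∃ a ∈ A, G.Adj s a
  domB : ∀ s ∈ S, ∃ b ∈ B, G.Adj s b
  clA : ∀ u ∈ U, u ∉ A → ∀ a ∈ A, G.Adj u a → u ∈ S
  clB : ∀ u ∈ U, u ∉ B → ∀ b ∈ B, G.Adj u b → u ∈ S

/-- `I` is an admissible independent set for `S` in `U`. -/
def Adm (G : SimpleGraph V) (U S : Set V) (I : Finset V) : Prop :=
  (∀ i ∈ I, i ∈ S) ∧ (∀ i ∈ I, ∀ j ∈ I, ¬ G.Adj i j) ∧
    ∀ v ∈ U, v ∉ S → ∀ i ∈ I, ∀ j ∈ I, G.Adj i v → G.Adj j v → i = j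

theorem exists_noncut [Finite V] {A : Set V} (hA : Conn G A) {r x : V} (hr : r ∈ A) (hx : x ∈ A)
    (hxr : x ≠ r) : ∃ a ∈ A, Conn G (A \ {a}) := by
  obtain ⟨d, π, hd, hπ, -⟩ := exists_bfs hA hr
  obtain ⟨a, ha, hmax⟩ := Set.exists_max_image A d (Set.toFinite A) ⟨r, hr⟩
  have har : r ≠ a := by
    rintro rfl
    have h1 := hπ x hx hxr
    have h2 := hmax x hx
    omega
  refine ⟨a, ha, conn_of_parent (r := r) ⟨hr, har⟩ d π ?_⟩
  rintro v ⟨hv, hva⟩ hvr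
  obtain ⟨h1, h2, h3⟩ := hπ v hv hvr
  refine ⟨⟨h1, ?_⟩, h2, h3⟩
  intro h
  have h4 := hmax v hv
  rw [Set.mem_singleton_iff] at h
  rw [h] at h3
  omega

theorem DB_bound [Finite V] {k : ℕ} (hk : 1 ≤ k) (hfree : CreatureFree G k) {U S A B A0 : Set V}
    (h : FSep G U S A B) (hA0A : A0 ⊆ A) (hA0 : Conn G A0) {s : V} (hs : s ∈ S)
    (hsA0 : ∀ a ∈ A0, ¬ G.Adj s a) (T : Set V) (hTS : T ⊆ S) (hTs : ∀ t ∈ T, ¬ G.Adj s t)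
    (hTA0 : ∀ t ∈ T, ∃ a ∈ A0, G.Adj t a)
    (hTB : ∀ t ∈ T, ∃ d ∈ B, G.Adj d s ∧ G.Adj d t) :
    ∃ D : Finset V, D.card < k ∧ (∀ d ∈ D, d ∈ B) ∧ ∀ t ∈ T, ∃ d ∈ D, G.Adj d t := by
  classical
  have : Fintype V := Fintype.ofFinite V
  obtain ⟨D, hD0, hcov, hpriv⟩ := exists_min_cover (fun d t => G.Adj d t) T
    (Finset.univ.filter fun d => d ∈ B ∧ G.Adj d s) (by
      intro t ht
      obtain ⟨d, h1, h2, h3⟩ := hTB t ht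
      exact ⟨d, by simp [h1, h2], h3⟩)
  have hD : ∀ d ∈ D, d ∈ B ∧ G.Adj d s := fun d hd => by simpa using hD0 hd
  refine ⟨D, ?_, fun d hd => (hD d hd).1, hcov⟩
  by_contra hcon
  push Not at hcon
  choose! t ht1 ht2 ht3 using hpriv
  refine creature_of hk hfree D hcon {s} A0 id t (conn_singleton s) hA0 ?_ ?_ ?_ ?_ ?_ ?_ ?_
  · rw [Set.disjoint_singleton_left]
    exact fun hh => h.SA s hs (hA0A hh)
  · rintro _ rfl b hb
    exact hsA0 b hb
  · rintro _ rfl i hi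
    exact hTs _ (ht1 i hi)
  · intro b hb i hi
    exact h.nAB b (hA0A hb) i (hD i hi).1
  · intro i hi
    exact ⟨s, rfl, (hD i hi).2⟩
  · intro i hi
    exact hTA0 _ (ht1 i hi)
  · intro i hi j hj
    exact ⟨fun hh => ht3 j hj i hi hh, fun hh => hh ▸ ht2 i hi⟩

theorem comp_cover_bound [Finite V] {k : ℕ} (hk : 1 ≤ k) (hfree : CreatureFree G k)
    {U S A B A0 : Set V}
    (h : FSep G U S A B) (hA0A : A0 ⊆ A) (hA0 : Conn G A0) {s : V} (hs : s ∈ S)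
    (hsA0 : ∀ a ∈ A0, ¬ G.Adj s a) (T : Set V) (hTS : T ⊆ S) (hTs : ∀ t ∈ T, ¬ G.Adj s t)
    (hTA0 : ∀ t ∈ T, ∃ a ∈ A0, G.Adj t a)
    (hTB : ∀ t ∈ T, ∀ d ∈ B, G.Adj d s → ¬ G.Adj d t) :
    ∃ D : Finset V, D.card < k ∧ (∀ c ∈ D, c ∈ B ∧ ¬ G.Adj c s) ∧
      ∀ t ∈ T, ∃ c ∈ D, ∃ w ∈ compOf G (B \ {x | G.Adj x s}) c, G.Adj w t := by
  classical
  have : Fintype V := Fintype.ofFinite V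
  obtain ⟨D, hD0, hcov, hpriv⟩ := exists_min_cover
    (fun c t => ∃ w ∈ compOf G (B \ {x | G.Adj x s}) c, G.Adj w t) T
    (Finset.univ.filter fun d => d ∈ B ∧ ¬ G.Adj d s) (by
      intro t ht
      obtain ⟨b, hb, htb⟩ := h.domB t (hTS ht)
      refine ⟨b, ?_, b, mem_compOf_self _ _, htb.symm⟩
      simp only [Finset.mem_filter, Finset.mem_univ, true_and]
      exact ⟨hb, fun hh => hTB t ht b hb hh htb.symm⟩)
  have hD : ∀ d ∈ D, d ∈ B ∧ ¬ G.Adj d s := fun d hd => by simpa using hD0 hd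
  refine ⟨D, ?_, hD, hcov⟩
  by_contra hcon
  push Not at hcon
  choose! t ht1 ht2 ht3 using hpriv
  let C : V → Set V := fun c => compOf G (B \ {x | G.Adj x s}) c
  have hCB : ∀ c ∈ D, C c ⊆ B \ {x | G.Adj x s} := fun c hc => compOf_subset (hD c hc)
  let NT : Set V := {x | ∃ c ∈ D, G.Adj x (t c)}
  let W : Set V := insert s (B \ NT)
  let K := compOf G W s
  have hKW : K ⊆ W := compOf_subset (Set.mem_insert _ _)
  have hsK : s ∈ K := mem_compOf_self _ _
  -- crossing vertices
  have hx : ∀ c ∈ D, ∃ x, x ∈ C c ∧ (∃ u ∈ K, G.Adj x u) ∧ x ∈ NT := by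
    intro c hc
    let E : Set V := {x | x = s ∨ (x ∈ B ∧ G.Adj x s) ∨ x ∈ C c}
    have hE : Conn G E := by
      refine conn_of_reach (r := s) (Or.inl rfl) ?_
      have hN : ∀ x ∈ B, G.Adj x s → x ∈ compOf G E s := fun x hx hxs =>
        compOf_closed (mem_compOf_self _ _) (Or.inr (Or.inl ⟨hx, hxs⟩)) hxs.symm
      obtain ⟨b, hb, hsb⟩ := h.domB s hs
      obtain ⟨x, hxB, y, hyB, hxC, hyC, hxy⟩ := h.connB.cross (K := C c) (hD c hc).1
        (mem_compOf_self _ _) hb (fun hh => (hCB c hc hh).2 hsb.symm)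
      have hys : G.Adj y s := by
        by_contra hn
        exact hyC (compOf_closed hxC ⟨hyB, hn⟩ hxy)
      have hxE : x ∈ compOf G E s :=
        compOf_closed (hN y hyB hys) (Or.inr (Or.inr hxC)) hxy.symm
      rintro w (rfl | hw | hw)
      · exact mem_compOf_self _ _
      · exact hN w hw.1 hw.2
      · have h1 := (conn_compOf (G := G) (B \ {x | G.Adj x s}) c).2 x hxC w hw
        have h2 : w ∈ compOf G E x := compOf_mono (fun z hz => Or.inr (Or.inr hz)) x h1
        exact Relation.ReflTransGen.trans hxE h2
    obtain ⟨w, hwC, hwt⟩ := ht2 c hc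
    have hwNT : w ∈ NT := ⟨c, hc, hwt⟩
    have hwK : w ∉ K := by
      intro hh
      rcases hKW hh with rfl | hh
      · exact h.SB w hs (hCB c hc hwC).1
      · exact hh.2 hwNT
    obtain ⟨u, huE, x, hxE, huK, hxK, hux⟩ := hE.cross (K := K) (Or.inl rfl) hsK
      (Or.inr (Or.inr hwC)) hwK
    have hxNT : x ∈ B → x ∈ NT := by
      intro hxB
      by_contra hn
      exact hxK (compOf_closed huK (Or.inr ⟨hxB, hn⟩) hux)
    rcases hxE with rfl | hx | hx
    · exact absurd hsK hxK
    · obtain ⟨c', hc', hxc'⟩ := hxNT hx.1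
      exact absurd hxc' (hTB _ (ht1 c' hc') x hx.1 hx.2)
    · exact ⟨x, hx, ⟨u, huK, hux.symm⟩, hxNT (hCB c hc hx).1⟩
  choose! x hxC hxK hxN using hx
  refine creature_of hk hfree D hcon K A0 x t (conn_compOf _ _) hA0 ?_ ?_ ?_ ?_ ?_ ?_ ?_
  · rw [Set.disjoint_left]
    intro a ha ha0
    rcases hKW ha with rfl | ha
    · exact h.SA a hs (hA0A ha0)
    · exact h.AB a (hA0A ha0) ha.1
  · intro a ha b hb hab
    rcases hKW ha with rfl | ha
    · exact hsA0 b hb hab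
    · exact h.nAB b (hA0A hb) a ha.1 hab.symm
  · intro a ha i hi hai
    rcases hKW ha with rfl | ha
    · exact hTs _ (ht1 i hi) hai
    · exact ha.2 ⟨i, hi, hai⟩
  · intro b hb i hi
    exact h.nAB b (hA0A hb) _ (hCB i hi (hxC i hi)).1
  · exact hxK
  · intro i hi
    exact hTA0 _ (ht1 i hi)
  · intro i hi j hj
    have key : ∀ j ∈ D, G.Adj (x i) (t j) → i = j := fun j hj hh =>
      ht3 j hj i hi ⟨x i, hxC i hi, hh⟩
    refine ⟨key j hj, ?_⟩
    rintro rfl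
    obtain ⟨c, hc, hcx⟩ := hxN i hi
    have := key c hc hcx
    subst this
    exact hcx

theorem DA_bound [Finite V] {k : ℕ} (hk : 1 ≤ k) (hfree : CreatureFree G k)
    {U S A B A0 : Set V}
    (h : FSep G U S A B) (hA0A : A0 ⊆ A) (hA0 : Conn G A0) {s : V} (hs : s ∈ S)
    (hsA0 : ∀ a ∈ A0, ¬ G.Adj s a) (T : Set V) (hTS : T ⊆ S) (hTs : ∀ t ∈ T, ¬ G.Adj s t)
    (hTA0 : ∀ t ∈ T, ∃ a ∈ A0, G.Adj t a)
    (hTB : ∀ t ∈ T, ∀ d ∈ B, G.Adj d s → ¬ G.Adj d t)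
    (hTX : ∀ t ∈ T, ∃ d ∈ U, d ∉ S ∧ d ∉ B ∧ G.Adj d s ∧ G.Adj d t) :
    ∃ D : Finset V, D.card ≤ (k - 1) * (k - 1) ∧ (∀ d ∈ D, d ∈ U ∧ d ∉ S) ∧
      ∀ t ∈ T, ∃ d ∈ D, G.Adj d t := by
  classical
  have : Fintype V := Fintype.ofFinite V
  obtain ⟨D, hD0, hcov, hpriv⟩ := exists_min_cover (fun d t => G.Adj d t) T
    (Finset.univ.filter fun d => d ∈ U ∧ d ∉ S ∧ d ∉ B ∧ G.Adj d s) (by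
      intro t ht
      obtain ⟨d, h1, h2, h3, h4, h5⟩ := hTX t ht
      exact ⟨d, by simp [h1, h2, h3, h4], h5⟩)
  have hD : ∀ d ∈ D, d ∈ U ∧ d ∉ S ∧ d ∉ B ∧ G.Adj d s := fun d hd => by simpa using hD0 hd
  refine ⟨D, ?_, fun d hd => ⟨(hD d hd).1, (hD d hd).2.1⟩, hcov⟩
  choose! t ht1 ht2 ht3 using hpriv
  obtain ⟨DC, hDCk, hDC, hDCcov⟩ := comp_cover_bound hk hfree h hA0A hA0 hs hsA0 T hTS hTs hTA0 hTB
  let F : V → Finset V := fun c =>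
    D.filter fun d => ∃ w ∈ compOf G (B \ {x | G.Adj x s}) c, G.Adj w (t d)
  have hDF : D ⊆ DC.biUnion F := by
    intro d hd
    obtain ⟨c, hc, hw⟩ := hDCcov _ (ht1 d hd)
    exact Finset.mem_biUnion.2 ⟨c, hc, Finset.mem_filter.2 ⟨hd, hw⟩⟩
  have hFc : ∀ c ∈ DC, (F c).card ≤ k - 1 := by
    intro c hc
    by_contra hcon
    have hcon : k ≤ (F c).card := by omega
    have hCB : compOf G (B \ {x | G.Adj x s}) c ⊆ B \ {x | G.Adj x s} := compOf_subset (hDC c hc)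
    have hF : ∀ i ∈ F c, i ∈ D ∧ ∃ w ∈ compOf G (B \ {x | G.Adj x s}) c, G.Adj w (t i) :=
      fun i hi => Finset.mem_filter.1 hi
    refine creature_of hk hfree (F c) hcon {s} (compOf G (B \ {x | G.Adj x s}) c) id t
      (conn_singleton s) (conn_compOf _ _) ?_ ?_ ?_ ?_ ?_ ?_ ?_
    · rw [Set.disjoint_singleton_left]
      exact fun hh => h.SB s hs (hCB hh).1
    · rintro _ rfl b hb hh
      exact (hCB hb).2 hh.symm
    · rintro _ rfl i hi
      exact hTs _ (ht1 i (hF i hi).1)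
    · intro b hb i hi hh
      have hi' := hD i (hF i hi).1
      exact hi'.2.1 (h.clB i hi'.1 hi'.2.2.1 b (hCB hb).1 hh.symm)
    · intro i hi
      exact ⟨s, rfl, (hD i (hF i hi).1).2.2.2⟩
    · intro i hi
      obtain ⟨w, hw, hwt⟩ := (hF i hi).2
      exact ⟨w, hw, hwt.symm⟩
    · intro i hi j hj
      have hi' := (hF i hi).1
      have hj' := (hF j hj).1
      exact ⟨fun hh => ht3 j hj' i hi' hh, fun hh => hh ▸ ht2 i hi'⟩
  calc D.card ≤ (DC.biUnion F).card := Finset.card_le_card hDF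
    _ ≤ DC.card * (k - 1) := Finset.card_biUnion_le_card_mul _ _ _ hFc
    _ ≤ _ := Nat.mul_le_mul_right _ (by omega)

/-- The traces of single vertices. -/
def vTraces (G : SimpleGraph V) : Set (Set V) := {T | ∃ d b, T ∈ traceFam G {d} b}

theorem vtrace_of {U S A B : Set V} (h : FSep G U S A B) {d : V} (hdU : d ∈ U) (hdS : d ∉ S) :
    ∃ T ∈ vTraces G, ∀ u, (u ∈ U ∧ u ∈ T) ↔ (u ∈ S ∧ G.Adj d u) := by
  by_cases hdB : d ∈ B
  · obtain ⟨a, ha⟩ := h.connA.1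
    refine ⟨nbhd G {d} ∩ nbhd G A, ⟨d, a, A, h.connA, ha, ?_, rfl⟩, ?_⟩
    · intro x hx
      refine ⟨fun hh => h.AB x hx (by rw [hh]; exact hdB), ?_⟩
      rintro _ rfl hh
      exact h.nAB x hx _ hdB hh.symm
    · intro u
      constructor
      · rintro ⟨hu, ⟨h1, _, rfl, h2⟩, h3, a', ha', h4⟩
        exact ⟨h.clA u hu h3 a' ha' h4, h2.symm⟩
      · rintro ⟨hu, hdu⟩
        obtain ⟨a', ha', h4⟩ := h.domA u hu
        exact ⟨h.SU hu, ⟨fun hh => hdS (hh ▸ hu), d, rfl, hdu.symm⟩, h.SA u hu, a', ha', h4⟩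
  · obtain ⟨b, hb⟩ := h.connB.1
    refine ⟨nbhd G {d} ∩ nbhd G B, ⟨d, b, B, h.connB, hb, ?_, rfl⟩, ?_⟩
    · intro x hx
      refine ⟨fun hh => hdB (by rw [← (show x = d from hh)]; exact hx), ?_⟩
      rintro _ rfl hh
      exact hdS (h.clB _ hdU hdB x hx hh)
    · intro u
      constructor
      · rintro ⟨hu, ⟨h1, _, rfl, h2⟩, h3, a', ha', h4⟩
        exact ⟨h.clB u hu h3 a' ha' h4, h2.symm⟩
      · rintro ⟨hu, hdu⟩
        obtain ⟨a', ha', h4⟩ := h.domB u hu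
        exact ⟨h.SU hu, ⟨fun hh => hdS (hh ▸ hu), d, rfl, hdu.symm⟩, h.SB u hu, a', ha', h4⟩

end Sep

end Part6

section Part7

section Step
variable {V : Type*} {G : SimpleGraph V}

/-- Full separators in `U` with measure at most `z`. -/
def Fam (G : SimpleGraph V) (z : ℕ) (U : Set V) : Set (Set V) :=
  {S | ∃ A B, FSep G U S A B ∧ ∀ I, Adm G U S I → I.card ≤ z}

theorem enum_le {α : Type*} (D : Finset α) (hne : D.Nonempty) {m : ℕ} (hm : D.card ≤ m) :
    ∃ g : Fin m → α, (∀ j, g j ∈ D) ∧ ∀ d ∈ D, ∃ j, g j = d := by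
  classical
  obtain ⟨d0, hd0⟩ := hne
  refine ⟨fun j => if h : (j : ℕ) < D.card then (D.equivFin.symm ⟨j, h⟩ : D) else d0, ?_, ?_⟩
  · intro j
    simp only
    split_ifs with h
    · exact Subtype.mem _
    · exact hd0
  · intro d hd
    have h1 := (D.equivFin ⟨d, hd⟩).2
    refine ⟨⟨D.equivFin ⟨d, hd⟩, by omega⟩, ?_⟩
    simp

/-- The dominating set used in the recursion. -/
theorem exists_dom [Finite V] {k : ℕ} (hk : 1 ≤ k) (hfree : CreatureFree G k)
    {U S A B A0 : Set V}
    (h : FSep G U S A B) (hA0A : A0 ⊆ A) (hA0 : Conn G A0) {s a1 : V} (hs : s ∈ S) (ha1 : a1 ∈ A)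
    (hsA0 : ∀ a ∈ A0, ¬ G.Adj s a)
    (hdom : ∀ t ∈ S, ¬ G.Adj a1 t → ∃ a ∈ A0, G.Adj t a) :
    ∃ D : Finset V, D.card ≤ k ^ 2 ∧ a1 ∈ D ∧ (∀ d ∈ D, d ∈ U ∧ d ∉ S) ∧
      ∀ t ∈ S, ¬ G.Adj s t → (∃ v ∈ U, v ∉ S ∧ G.Adj v s ∧ G.Adj v t) → ∃ d ∈ D, G.Adj d t := by
  classical
  obtain ⟨DB, hDBc, hDB, hDBcov⟩ := DB_bound hk hfree h hA0A hA0 hs hsA0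
    {t | t ∈ S ∧ ¬ G.Adj s t ∧ ¬ G.Adj a1 t ∧ ∃ d ∈ B, G.Adj d s ∧ G.Adj d t}
    (fun t ht => ht.1) (fun t ht => ht.2.1) (fun t ht => hdom t ht.1 ht.2.2.1)
    (fun t ht => ht.2.2.2)
  obtain ⟨DA, hDAc, hDA, hDAcov⟩ := DA_bound hk hfree h hA0A hA0 hs hsA0
    {t | t ∈ S ∧ ¬ G.Adj s t ∧ ¬ G.Adj a1 t ∧ (∀ d ∈ B, G.Adj d s → ¬ G.Adj d t) ∧
      ∃ d ∈ U, d ∉ S ∧ d ∉ B ∧ G.Adj d s ∧ G.Adj d t}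
    (fun t ht => ht.1) (fun t ht => ht.2.1) (fun t ht => hdom t ht.1 ht.2.2.1)
    (fun t ht => ht.2.2.2.1) (fun t ht => ht.2.2.2.2)
  refine ⟨insert a1 (DB ∪ DA), ?_, Finset.mem_insert_self _ _, ?_, ?_⟩
  · have h1 := Finset.card_insert_le a1 (DB ∪ DA)
    have h2 := Finset.card_union_le DB DA
    have h3 : (k - 1) * (k - 1) + (k - 1) + 1 ≤ k ^ 2 := by
      obtain ⟨j, rfl⟩ := Nat.exists_eq_add_of_le hk
      simp only [Nat.add_sub_cancel_left]
      nlinarith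
    omega
  · intro d hd
    simp only [Finset.mem_insert, Finset.mem_union] at hd
    rcases hd with rfl | hd | hd
    · exact ⟨h.AU ha1, fun hh => h.SA _ hh ha1⟩
    · exact ⟨h.BU (hDB d hd), fun hh => h.SB _ hh (hDB d hd)⟩
    · exact hDA d hd
  · rintro t ht hst ⟨v, hvU, hvS, hvs, hvt⟩
    by_cases hat : G.Adj a1 t
    · exact ⟨a1, Finset.mem_insert_self _ _, hat⟩
    by_cases hB : ∃ d ∈ B, G.Adj d s ∧ G.Adj d t
    · obtain ⟨d, hd, hdt⟩ := hDBcov t ⟨ht, hst, hat, hB⟩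
      exact ⟨d, by simp [hd], hdt⟩
    · push Not at hB
      obtain ⟨d, hd, hdt⟩ := hDAcov t ⟨ht, hst, hat, hB, v, hvU, hvS,
        fun hh => hB v hh hvs hvt, hvs, hvt⟩
      exact ⟨d, by simp [hd], hdt⟩

theorem step_core [Finite V] {k z : ℕ} (hk : 1 ≤ k) (hfree : CreatureFree G k)
    {U S : Set V} (hS : S ∈ Fam G (z + 1) U) :
    (∃ T ∈ vTraces G, S = U ∩ T) ∨
    ∃ t : Fin (k ^ 2) → Set V, (∀ j, t j ∈ vTraces G) ∧ ∃ T ∈ vTraces G,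
      ∃ S3 ∈ Fam G z ((U \ (U ∩ ⋃ j, t j)) \ T), ∃ a b : V,
      ∃ T2 ∈ traceFam G (compOf G (((U \ (U ∩ ⋃ j, t j)) \ T) \ S3) a) b,
      S = (U ∩ ⋃ j, t j) ∪ ((U \ (U ∩ ⋃ j, t j)) ∩ T2) := by
  classical
  obtain ⟨A, B, h, hz⟩ := hS
  obtain ⟨A'', ⟨hA''A, hA''c, hA''d⟩, hmin⟩ :=
    (Set.toFinite {A' : Set V | A' ⊆ A ∧ Conn G A' ∧
    ∀ i ∈ S, ∃ a ∈ A', G.Adj i a}).exists_minimal ⟨A, subset_rfl, h.connA, h.domA⟩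
  obtain ⟨b, hb⟩ := h.connB.1
  obtain ⟨r, hr⟩ := hA''c.1
  by_cases hsub : ∃ x ∈ A'', x ≠ r
  swap
  · left
    push Not at hsub
    obtain ⟨T, hT, hTU⟩ := vtrace_of h (h.AU (hA''A hr)) (fun hh => h.SA r hh (hA''A hr))
    refine ⟨T, hT, ?_⟩
    ext u
    constructor
    · intro hu
      obtain ⟨a, ha, hua⟩ := hA''d u hu
      rw [hsub a ha] at hua
      exact (hTU u).2 ⟨hu, hua.symm⟩
    · intro hu
      exact ((hTU u).1 hu).1
  right
  obtain ⟨x, hx, hxr⟩ := hsub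
  obtain ⟨a1, ha1, hA0⟩ := exists_noncut hA''c hr hx hxr
  set A0 := A'' \ {a1} with hA0def
  have hA0A'' : A0 ⊆ A'' := Set.sdiff_subset
  have hA0A : A0 ⊆ A := hA0A''.trans hA''A
  have hex : ∃ s ∈ S, ∀ a ∈ A0, ¬ G.Adj s a := by
    by_contra hcon
    push Not at hcon
    have h1 := hmin (y := A0) ⟨hA0A, hA0, hcon⟩ hA0A''
    exact (h1 ha1).2 rfl
  obtain ⟨s, hs, hsA0⟩ := hex
  have hsa1 : G.Adj s a1 := by
    obtain ⟨a, ha, hsa⟩ := hA''d s hs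
    by_cases haa : a = a1
    · exact haa ▸ hsa
    · exact absurd hsa (hsA0 a ⟨ha, haa⟩)
  have hdom : ∀ t ∈ S, ¬ G.Adj a1 t → ∃ a ∈ A0, G.Adj t a := by
    intro t ht hat
    obtain ⟨a, ha, hta⟩ := hA''d t ht
    exact ⟨a, ⟨ha, fun hh => hat (by rw [← (show a = a1 from hh)]; exact hta.symm)⟩, hta⟩
  have ha1A := hA''A ha1
  obtain ⟨D, hDc, ha1D, hDU, hDcov⟩ := exists_dom hk hfree h hA0A hA0 hs ha1A hsA0 hdom
  obtain ⟨g, hgD, hgs⟩ := enum_le D ⟨a1, ha1D⟩ hDc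
  have hvt := fun j => vtrace_of h (hDU _ (hgD j)).1 (hDU _ (hgD j)).2
  choose t ht htU using hvt
  refine ⟨t, ht, ?_⟩
  -- description of the dominated part
  have hDset : ∀ u, u ∈ (U ∩ ⋃ j, t j) ↔ (u ∈ S ∧ ∃ d ∈ D, G.Adj d u) := by
    intro u
    constructor
    · rintro ⟨hu, hu2⟩
      obtain ⟨j, hj⟩ := Set.mem_iUnion.1 hu2
      have := (htU j u).1 ⟨hu, hj⟩
      exact ⟨this.1, g j, hgD j, this.2⟩
    · rintro ⟨hu, d, hd, hdu⟩
      obtain ⟨j, rfl⟩ := hgs d hd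
      have := (htU j u).2 ⟨hu, hdu⟩
      exact ⟨this.1, Set.mem_iUnion.2 ⟨j, this.2⟩⟩
  generalize (U ∩ ⋃ j, t j) = Ds at hDset ⊢
  obtain ⟨a', ha'⟩ := hA0.1
  set A1 := compOf G (A \ {x | G.Adj s x}) a' with hA1def
  have hA0sub : A0 ⊆ A \ {x | G.Adj s x} := fun x hx => ⟨hA0A hx, hsA0 x hx⟩
  have hA0A1 : A0 ⊆ A1 := fun x hx => compOf_mono hA0sub a' (hA0.2 a' ha' x hx)
  have hA1A : A1 ⊆ A \ {x | G.Adj s x} := compOf_subset (hA0sub ha')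
  have hA1c : Conn G A1 := conn_compOf _ _
  have hsA1 : s ∉ A1 := fun hh => h.SA s hs (hA1A hh).1
  set T : Set V := nbhd G {s} ∩ nbhd G A1 with hTdef
  have hTv : T ∈ vTraces G := by
    refine ⟨s, a', A1, hA1c, mem_compOf_self _ _, ?_, rfl⟩
    intro x hx
    refine ⟨fun hh => hsA1 (by rw [← (show x = s from hh)]; exact hx), ?_⟩
    rintro _ rfl
    exact (hA1A hx).2
  have hTmem : ∀ u, u ∈ T ↔ (u ≠ s ∧ G.Adj u s) ∧ u ∉ A1 ∧ ∃ a ∈ A1, G.Adj u a := by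
    intro u
    simp [hTdef, nbhd]
  have hsDs : s ∈ Ds := (hDset s).2 ⟨hs, a1, ha1D, hsa1.symm⟩
  -- vertices of S outside Ds
  have hS2 : ∀ u ∈ S, u ∉ Ds → (∃ a ∈ A0, G.Adj u a) ∧ ∀ d ∈ D, ¬ G.Adj d u := by
    intro u hu huD
    have h1 : ∀ d ∈ D, ¬ G.Adj d u := fun d hd hdu => huD ((hDset u).2 ⟨hu, d, hd, hdu⟩)
    exact ⟨hdom u hu (h1 a1 ha1D), h1⟩
  set U3 := (U \ Ds) \ T with hU3
  set S3 : Set V := {u | u ∈ S ∧ u ∉ Ds ∧ ¬ G.Adj u s} with hS3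
  have hDsS : ∀ u ∈ Ds, u ∈ S := fun u hu => ((hDset u).1 hu).1
  have hsep : FSep G U3 S3 A1 B :=
    { AU := fun x hx => ⟨⟨h.AU (hA1A hx).1, fun hh => h.SA x (hDsS x hh) (hA1A hx).1⟩,
        fun hh => ((hTmem x).1 hh).2.1 hx⟩
      BU := fun x hx => ⟨⟨h.BU hx, fun hh => h.SB x (hDsS x hh) hx⟩, fun hh => by
        obtain ⟨a, ha, hxa⟩ := ((hTmem x).1 hh).2.2
        exact h.nAB a (hA1A ha).1 x hx hxa.symm⟩
      SU := fun x hx => ⟨⟨h.SU hx.1, hx.2.1⟩, fun hh => hx.2.2 ((hTmem x).1 hh).1.2⟩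
      connA := hA1c
      connB := h.connB
      AB := fun a ha => h.AB a (hA1A ha).1
      nAB := fun a ha => h.nAB a (hA1A ha).1
      SA := fun x hx hh => h.SA x hx.1 (hA1A hh).1
      SB := fun x hx => h.SB x hx.1
      domA := fun x hx => by
        obtain ⟨a, ha, hxa⟩ := (hS2 x hx.1 hx.2.1).1
        exact ⟨a, hA0A1 ha, hxa⟩
      domB := fun x hx => h.domB x hx.1
      clA := fun u hu huA a ha hua => by
        have hus : u ≠ s := fun hh => hu.1.2 (hh ▸ hsDs)
        have huns : ¬ G.Adj u s := fun hh => hu.2 ((hTmem u).2 ⟨⟨hus, hh⟩, huA, a, ha, hua⟩)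
        have huA' : u ∉ A := fun hh =>
          huA (compOf_closed ha ⟨hh, fun h2 => huns (show G.Adj s u from h2).symm⟩ hua.symm)
        exact ⟨h.clA u hu.1.1 huA' a (hA1A ha).1 hua, hu.1.2, huns⟩
      clB := fun u hu huB b hb hub => by
        have huS := h.clB u hu.1.1 huB b hb hub
        have hus : u ≠ s := fun hh => hu.1.2 (hh ▸ hsDs)
        obtain ⟨a, ha, hua⟩ := (hS2 u huS hu.1.2).1
        exact ⟨huS, hu.1.2, fun hh => hu.2 ((hTmem u).2 ⟨⟨hus, hh⟩,
          fun h2 => h.SA u huS (hA1A h2).1, a, hA0A1 ha, hua⟩)⟩ }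
  have hnocommon : ∀ v ∈ U, v ∉ S → ∀ i ∈ S3, G.Adj s v → ¬ G.Adj i v := by
    intro v hvU hvS i hi hsv hiv
    obtain ⟨d, hd, hdi⟩ := hDcov i hi.1 (fun hh => hi.2.2 hh.symm) ⟨v, hvU, hvS, hsv.symm, hiv.symm⟩
    exact (hS2 i hi.1 hi.2.1).2 d hd hdi
  have hadm : ∀ I, Adm G U3 S3 I → I.card ≤ z := by
    rintro I ⟨hI1, hI2, hI3⟩
    have hsI : s ∉ I := fun hh => (hI1 s hh).2.1 hsDs
    have := hz (insert s I) ⟨?_, ?_, ?_⟩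
    · rw [Finset.card_insert_of_notMem hsI] at this
      omega
    · intro i hi
      rcases Finset.mem_insert.1 hi with rfl | hi1
      · exact hs
      · exact (hI1 i hi1).1
    · intro i hi j hj
      rcases Finset.mem_insert.1 hi with rfl | hi1 <;> rcases Finset.mem_insert.1 hj with rfl | hj1
      · exact G.loopless.irrefl _
      · exact fun hh => (hI1 j hj1).2.2 hh.symm
      · exact (hI1 i hi1).2.2
      · exact hI2 i hi1 j hj1
    · intro v hvU hvS i hi j hj hiv hjv
      rcases Finset.mem_insert.1 hi with rfl | hi1 <;> rcases Finset.mem_insert.1 hj with rfl | hj1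
      · rfl
      · exact absurd hjv (hnocommon v hvU hvS j (hI1 j hj1) hiv)
      · exact absurd hiv (hnocommon v hvU hvS i (hI1 i hi1) hjv)
      · refine hI3 v ⟨⟨hvU, fun hh => hvS (hDsS v hh)⟩, fun hh => ?_⟩ (fun hh => hvS hh.1)
          i hi1 j hj1 hiv hjv
        exact hnocommon v hvU hvS i (hI1 i hi1) ((hTmem v).1 hh).1.2.symm hiv
  refine ⟨T, hTv, S3, ⟨A1, B, hsep, hadm⟩, a', b, nbhd G A1 ∩ nbhd G B, ?_, ?_⟩
  · have hcomp : compOf G (U3 \ S3) a' = A1 := by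
      refine hA1c.eq_compOf (W := U3 \ S3) (fun x hx => ⟨hsep.AU hx, fun hh => hsep.SA x hh hx⟩) ?_
        (mem_compOf_self _ _)
      intro x hx y hy hxy
      by_contra hn
      exact hy.2 (hsep.clA y hy.1 hn x hx hxy.symm)
    rw [hcomp]
    exact ⟨B, h.connB, hb, fun x hx => ⟨fun hh => h.AB x (hA1A hh).1 hx,
      fun c hc => h.nAB c (hA1A hc).1 x hx⟩, rfl⟩
  · ext u
    constructor
    · intro hu
      by_cases huD : u ∈ Ds
      · exact Or.inl huD
      · right
        obtain ⟨a, ha, hua⟩ := (hS2 u hu huD).1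
        obtain ⟨b', hb', hub⟩ := h.domB u hu
        exact ⟨⟨h.SU hu, huD⟩, ⟨fun hh => h.SA u hu (hA1A hh).1, a, hA0A1 ha, hua⟩,
          h.SB u hu, b', hb', hub⟩
    · rintro (hu | ⟨⟨huU, huD⟩, -, huB, b', hb', hub⟩)
      · exact hDsS u hu
      · exact h.clB u huU huB b' hb' hub

end Step

end Part7

section Part8

section Count
variable {V : Type*} {G : SimpleGraph V}

theorem ncard_biUnion_le_mul {α ι : Type*} [Finite α] [Finite ι] (s : Set ι) (f : ι → Set α) (m : ℕ)
    (h : ∀ i ∈ s, (f i).ncard ≤ m) : (⋃ i ∈ s, f i).ncard ≤ s.ncard * m := by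
  classical
  induction s, Set.toFinite s using Set.Finite.induction_on with
  | empty => simp
  | @insert a s ha hs ih =>
    rw [Set.biUnion_insert, Set.ncard_insert_of_notMem ha hs]
    have h1 := Set.ncard_union_le (f a) (⋃ i ∈ s, f i)
    have h2 := h a (Set.mem_insert _ _)
    have h3 := ih (fun i hi => h i (Set.mem_insert_of_mem _ hi))
    rw [Nat.add_mul]
    omega

theorem ncard_exists_le {α ι : Type*} [Finite α] [Finite ι] (s : Set ι) (P : ι → α → Prop) (m : ℕ)
    (h : ∀ i ∈ s, {x | P i x}.ncard ≤ m) : {x | ∃ i ∈ s, P i x}.ncard ≤ s.ncard * m := by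
  refine le_trans (le_of_eq ?_) (ncard_biUnion_le_mul s (fun i => {x | P i x}) m h)
  congr 1
  ext x
  simp

theorem ncard_exists_univ_le {α ι : Type*} [Finite α] [Fintype ι] (P : ι → α → Prop) (m : ℕ)
    (h : ∀ i, {x | P i x}.ncard ≤ m) : {x | ∃ i, P i x}.ncard ≤ Fintype.card ι * m := by
  have := ncard_exists_le Set.univ P m (fun i _ => h i)
  simpa [Set.ncard_univ] using this

theorem vTraces_ncard [Fintype V] {k : ℕ} (hk : 1 ≤ k) (hfree : CreatureFree G k)
    (hn : 2 ≤ Fintype.card V) : (vTraces G).ncard ≤ Fintype.card V ^ (k + 2) := by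
  have h1 : (vTraces G).ncard ≤ Fintype.card V * (Fintype.card V * Fintype.card V ^ k) :=
    ncard_exists_univ_le (fun d T => ∃ b, T ∈ traceFam G {d} b) _ fun d =>
      ncard_exists_univ_le (fun b T => T ∈ traceFam G {d} b) _ fun b =>
        traceFam_ncard hk hfree (conn_singleton d) b hn
  refine h1.trans (le_of_eq ?_)
  ring

theorem pi_ncard {α : Type*} [Finite α] (m : ℕ) (F : Set α) :
    {t : Fin m → α | ∀ j, t j ∈ F}.ncard = F.ncard ^ m := by
  have e : {t : Fin m → α | ∀ j, t j ∈ F} ≃ (Fin m → F) :=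
    { toFun := fun t j => ⟨t.1 j, t.2 j⟩
      invFun := fun t => ⟨fun j => t j, fun j => (t j).2⟩
      left_inv := fun t => rfl
      right_inv := fun t => rfl }
  rw [← Nat.card_coe_set_eq, Nat.card_congr e, Nat.card_fun, Nat.card_coe_set_eq]
  simp

theorem fam_count [Fintype V] {k : ℕ} (hk : 1 ≤ k) (hfree : CreatureFree G k)
    (hn : 2 ≤ Fintype.card V) (z : ℕ) : ∀ U : Set V,
    (Fam G z U).ncard ≤ Fintype.card V ^ ((4 + (k ^ 2 + 2) * (k + 2)) * z) := by
  classical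
  induction z with
  | zero =>
    intro U
    have : Fam G 0 U ⊆ {∅} := by
      rintro S ⟨A, B, h, hz⟩
      rw [Set.mem_singleton_iff, Set.eq_empty_iff_forall_notMem]
      intro s hs
      have := hz {s} ⟨by simpa using hs, by simp, by
        intro v _ _ i hi j hj _ _
        rw [Finset.mem_singleton] at hi hj
        rw [hi, hj]⟩
      simp at this
    have h1 := Set.ncard_le_ncard this
    simpa using h1
  | succ z ih =>
    intro U
    set n := Fintype.card V with hndef
    set F := n ^ ((4 + (k ^ 2 + 2) * (k + 2)) * z) with hF
    have hVT := vTraces_ncard (G := G) hk hfree hn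
    let X1 : Set (Set V) := {S | ∃ T ∈ vTraces G, S = U ∩ T}
    let X2 : Set (Set V) := {S | ∃ t ∈ {t : Fin (k ^ 2) → Set V | ∀ j, t j ∈ vTraces G},
      ∃ T ∈ vTraces G,
      ∃ S3 ∈ Fam G z ((U \ (U ∩ ⋃ j, t j)) \ T), ∃ a b : V,
      ∃ T2 ∈ traceFam G (compOf G (((U \ (U ∩ ⋃ j, t j)) \ T) \ S3) a) b,
      S = (U ∩ ⋃ j, t j) ∪ ((U \ (U ∩ ⋃ j, t j)) ∩ T2)}
    have hsub : Fam G (z + 1) U ⊆ X1 ∪ X2 := by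
      intro S hS
      exact step_core hk hfree hS
    have hone : ∀ (s : Set (Set V)) (f : Set V → Set V),
        {S | ∃ T ∈ s, S = f T}.ncard ≤ s.ncard := by
      intro s f
      refine le_trans (le_of_eq ?_) (Set.ncard_image_le (f := f) (Set.toFinite s))
      congr 1
      ext S
      simp [eq_comm]
    have h1 : X1.ncard ≤ n ^ (k + 2) := (hone _ _).trans hVT
    have h2 : X2.ncard ≤ (n ^ (k + 2)) ^ (k ^ 2) *
        (n ^ (k + 2) * (F * (n * (n * n ^ k)))) := by
      refine (ncard_exists_le _ _ (n ^ (k + 2) * (F * (n * (n * n ^ k)))) ?_).trans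
        (Nat.mul_le_mul_right _ ?_)
      · intro t _
        refine (ncard_exists_le _ _ (F * (n * (n * n ^ k))) ?_).trans
          (Nat.mul_le_mul_right _ hVT)
        intro T _
        refine (ncard_exists_le _ _ (n * (n * n ^ k)) ?_).trans
          (Nat.mul_le_mul_right _ (ih _))
        intro S3 _
        refine ncard_exists_univ_le _ _ fun a => ncard_exists_univ_le _ _ fun b => ?_
        exact (hone _ _).trans (traceFam_ncard hk hfree (conn_compOf _ _) b hn)
      · rw [pi_ncard]
        exact Nat.pow_le_pow_left hVT _
    have h3 := (Set.ncard_le_ncard hsub).trans (Set.ncard_union_le _ _)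
    have hFpos : 1 ≤ F := Nat.one_le_pow _ _ (by omega)
    have h4 : (n ^ (k + 2)) ^ (k ^ 2) * (n ^ (k + 2) * (F * (n * (n * n ^ k))))
        = n ^ ((k ^ 2 + 2) * (k + 2)) * F := by
      rw [← pow_mul]
      ring
    have h5 : n ^ (k + 2) ≤ n ^ ((k ^ 2 + 2) * (k + 2)) * F := by
      calc n ^ (k + 2) ≤ n ^ ((k ^ 2 + 2) * (k + 2)) :=
            Nat.pow_le_pow_right (by omega) (Nat.le_mul_of_pos_left _ (by positivity))
        _ = n ^ ((k ^ 2 + 2) * (k + 2)) * 1 := (mul_one _).symm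
        _ ≤ _ := Nat.mul_le_mul_left _ hFpos
    calc (Fam G (z + 1) U).ncard ≤ X1.ncard + X2.ncard := h3
      _ ≤ 2 * (n ^ ((k ^ 2 + 2) * (k + 2)) * F) := by rw [h4] at h2; omega
      _ ≤ n ^ 4 * (n ^ ((k ^ 2 + 2) * (k + 2)) * F) := by
          refine Nat.mul_le_mul_right _ (hn.trans ?_)
          calc n = n ^ 1 := (pow_one n).symm
            _ ≤ n ^ 4 := Nat.pow_le_pow_right (by omega) (by omega)
      _ = n ^ ((4 + (k ^ 2 + 2) * (k + 2)) * (z + 1)) := by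
          rw [hF, ← pow_add, ← pow_add]
          congr 1
          ring

theorem walk_of_compOf {W : Set V} {u w : V} (hu : u ∈ W) (hw : w ∈ compOf G W u) :
    ∃ p : G.Walk u w, ∀ x ∈ p.support, x ∈ W := by
  induction hw with
  | refl => exact ⟨Walk.nil, by simpa using hu⟩
  | tail _ h2 ih =>
    obtain ⟨p, hp⟩ := ih
    refine ⟨p.concat h2.1, fun x hx => ?_⟩
    rw [Walk.support_concat] at hx
    simp only [List.concat_eq_append, List.mem_append, List.mem_singleton] at hx
    rcases hx with hx | rfl
    · exact hp x hx
    · exact h2.2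

theorem IsUVSeparator.swap {S : Set V} {u v : V} (h : IsUVSeparator G S u v) :
    IsUVSeparator G S v u := by
  refine ⟨h.2.1, h.1, fun p => ?_⟩
  obtain ⟨w, hw, hwS⟩ := h.2.2 p.reverse
  exact ⟨w, by simpa using hw, hwS⟩

theorem IsUVSeparator.notMem {S : Set V} {u v : V} (h : IsUVSeparator G S u v) :
    v ∉ compOf G Sᶜ u := by
  intro hv
  obtain ⟨p, hp⟩ := walk_of_compOf (show u ∈ Sᶜ from h.1) hv
  obtain ⟨w, hw, hwS⟩ := h.2.2 p
  exact hp w hw hwS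

theorem dom_side {S : Set V} {u v : V} (h : IsUVSeparator G S u v)
    (hmin : ∀ S' ⊂ S, ¬ IsUVSeparator G S' u v) :
    ∀ s ∈ S, ∃ a ∈ compOf G Sᶜ u, G.Adj s a := by
  intro s hs
  have h1 := hmin (S \ {s}) ⟨Set.sdiff_subset, fun hh => (hh hs).2 rfl⟩
  have h2 : ∃ p : G.Walk u v, ∀ w ∈ p.support, w ∉ S \ {s} := by
    by_contra hcon
    push Not at hcon
    exact h1 ⟨fun hh => h.1 hh.1, fun hh => h.2.1 hh.1, hcon⟩
  obtain ⟨p, hp⟩ := h2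
  obtain ⟨d, hd, hd1, hd2⟩ := p.exists_boundary_dart (compOf G Sᶜ u) (mem_compOf_self _ _) h.notMem
  have hS : d.snd ∈ S := by
    by_contra hn
    exact hd2 (compOf_closed hd1 hn d.adj)
  have hds : d.snd = s := by
    by_contra hn
    exact hp _ (p.dart_snd_mem_support_of_mem_darts hd) ⟨hS, hn⟩
  exact ⟨d.fst, hd1, hds ▸ d.adj.symm⟩

theorem minsep_mem_fam [Fintype V] {k : ℕ} (hk : 1 ≤ k) (hfree : CreatureFree G k)
    (hlad : ¬ IsInducedMinor (skinnyLadder k) G) {S : Set V} (hS : IsMinimalSeparator G S) :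
    S ∈ Fam G (k * (k * (2 * (4 * k ^ 2) ^ k))) Set.univ := by
  obtain ⟨u, v, h, hmin⟩ := hS
  have huS : u ∈ Sᶜ := h.1
  have hvS : v ∈ Sᶜ := h.2.1
  have hAS : compOf G Sᶜ u ⊆ Sᶜ := compOf_subset huS
  have hBS : compOf G Sᶜ v ⊆ Sᶜ := compOf_subset hvS
  have hAB : ∀ a ∈ compOf G Sᶜ u, a ∉ compOf G Sᶜ v := by
    intro a ha hb
    have h1 := (conn_compOf (G := G) Sᶜ v).2 a hb v (mem_compOf_self _ _)
    exact h.notMem (Relation.ReflTransGen.trans ha (compOf_mono hBS a h1))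
  have hnAB : ∀ a ∈ compOf G Sᶜ u, ∀ b ∈ compOf G Sᶜ v, ¬ G.Adj a b := by
    intro a ha b hb hab
    exact hAB b (compOf_closed ha (hBS hb) hab) hb
  have hsep : FSep G Set.univ S (compOf G Sᶜ u) (compOf G Sᶜ v) :=
    { AU := Set.subset_univ _
      BU := Set.subset_univ _
      SU := Set.subset_univ _
      connA := conn_compOf _ _
      connB := conn_compOf _ _
      AB := hAB
      nAB := hnAB
      SA := fun s hs hh => hAS hh hs
      SB := fun s hs hh => hBS hh hs
      domA := dom_side h hmin
      domB := dom_side h.swap (fun S' hS' hh => hmin S' hS' hh.swap)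
      clA := fun x _ hx a ha hxa => by
        by_contra hn
        exact hx (compOf_closed ha hn hxa.symm)
      clB := fun x _ hx a ha hxa => by
        by_contra hn
        exact hx (compOf_closed ha hn hxa.symm) }
  refine ⟨_, _, hsep, ?_⟩
  rintro I ⟨hI1, hI2, hI3⟩
  refine le_of_lt (z_bound hk hfree hlad hsep.connA hsep.connB (Set.disjoint_left.2 hAB) hnAB I
    (fun i hi => hsep.domA i (hI1 i hi)) (fun i hi => hsep.domB i (hI1 i hi))
    (fun i hi => hsep.SA i (hI1 i hi)) (fun i hi => hsep.SB i (hI1 i hi)) hI2 ?_)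
  intro w hw
  refine hI3 w (Set.mem_univ _) ?_
  rcases hw with hw | hw
  · exact hAS hw
  · exact hBS hw

theorem main_bound [Fintype V] {k : ℕ} (hk : 1 ≤ k) (hfree : CreatureFree G k)
    (hlad : ¬ IsInducedMinor (skinnyLadder k) G) :
    {S : Set V | IsMinimalSeparator G S}.ncard ≤
      Fintype.card V ^ ((8 * k ^ 2) ^ (k + 2) * (4 + (k ^ 2 + 2) * (k + 2))) := by
  by_cases hn : 2 ≤ Fintype.card V
  · have hsub : {S : Set V | IsMinimalSeparator G S} ⊆
        Fam G (k * (k * (2 * (4 * k ^ 2) ^ k))) Set.univ :=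
      fun S hS => minsep_mem_fam hk hfree hlad hS
    refine (Set.ncard_le_ncard hsub).trans ((fam_count hk hfree hn _ _).trans ?_)
    refine Nat.pow_le_pow_right (by omega) ?_
    rw [Nat.mul_comm]
    refine Nat.mul_le_mul_right _ ?_
    have hk2 : 1 ≤ k ^ 2 := Nat.one_le_pow _ _ hk
    calc k * (k * (2 * (4 * k ^ 2) ^ k)) = (2 * k ^ 2) * (4 * k ^ 2) ^ k := by ring
      _ ≤ (8 * k ^ 2) ^ 2 * (8 * k ^ 2) ^ k := by
          refine Nat.mul_le_mul ?_ (Nat.pow_le_pow_left (by omega) _)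
          nlinarith
      _ = (8 * k ^ 2) ^ (k + 2) := by ring
  · have : {S : Set V | IsMinimalSeparator G S} = ∅ := by
      rw [Set.eq_empty_iff_forall_notMem]
      rintro S ⟨u, v, h, -⟩
      have : Subsingleton V := Fintype.card_le_one_iff_subsingleton.1 (by omega)
      have huv : u = v := Subsingleton.elim _ _
      subst huv
      exact h.notMem (mem_compOf_self _ _)
    rw [this]
    simp

end Count

end Part8

/-- Theorem 2: every `k`-creature-free graph with no `k`-skinny-ladder induced
minor has at most `n ^ ((8k²)^(k+2) · (4 + (k²+2)(k+2)))` minimal separators. -/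
theorem creatureFree_skinnyLadderFree_minimalSeparators_le
    (k : ℕ) (hk : 1 ≤ k) {V : Type*} [Fintype V] (G : SimpleGraph V)
    (hfree : CreatureFree G k)
    (hladder : ¬ IsInducedMinor (skinnyLadder k) G) :
    {S : Set V | IsMinimalSeparator G S}.ncard ≤
      Fintype.card V ^ ((8 * k ^ 2) ^ (k + 2) * (4 + (k ^ 2 + 2) * (k + 2))) := by
  exact main_bound hk hfree hladder
end

section
/- For all natural numbers k ≥ 1 and L ≥ 0 the following holds. Let G be a finite simple k-creature-free graph on n vertices. Then the number of minimal separators S of G satisfying ζ_G(S) ≤ L is at most n^{L·(4 + (k²+2)(k+2))}. -/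
open SimpleGraph

section helpers

variable {V : Type*}

/-- The vertex `v` has a neighbour in `A`. -/
def Sees (G : SimpleGraph V) (v : V) (A : Set V) : Prop := ∃ a ∈ A, G.Adj v a

/-- The component of `x` in the graph induced on `U` (empty if `x` is not in `U`). -/
def rcomp (G : SimpleGraph V) (U : Set V) (x : V) : Set V :=
  {y | x ∈ U ∧ Relation.ReflTransGen (fun y z => G.Adj y z ∧ z ∈ U) x y}

variable {G : SimpleGraph V} {U U' : Set V} {x y z : V}

lemma rcomp_self (h : x ∈ U) : x ∈ rcomp G U x := ⟨h, .refl⟩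

lemma rcomp_step (h : y ∈ rcomp G U x) (hz : z ∈ U) (ha : G.Adj y z) : z ∈ rcomp G U x :=
  ⟨h.1, h.2.tail ⟨ha, hz⟩⟩

lemma rcomp_ind {P : V → Prop} (hx : x ∈ U → P x)
    (hs : ∀ y z, y ∈ rcomp G U x → P y → z ∈ U → G.Adj y z → P z)
    (hy : y ∈ rcomp G U x) : P y := by
  obtain ⟨hxU, h⟩ := hy
  induction h with
  | refl => exact hx hxU
  | tail h1 h2 ih => exact hs _ _ ⟨hxU, h1⟩ ih h2.2 h2.1

lemma rcomp_sub (hy : y ∈ rcomp G U x) : y ∈ U :=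
  rcomp_ind (P := fun y => y ∈ U) id (fun _ _ _ _ h _ => h) hy

lemma rcomp_base (hy : y ∈ rcomp G U x) : x ∈ rcomp G U x := rcomp_self hy.1

lemma rcomp_subset_of (hx : x ∈ U → x ∈ U')
    (hs : ∀ y z, y ∈ rcomp G U x → y ∈ U' → z ∈ U → G.Adj y z → z ∈ U') :
    rcomp G U x ⊆ rcomp G U' x := by
  intro y hy
  refine rcomp_ind (P := fun y => y ∈ rcomp G U' x) (fun h => rcomp_self (hx h)) ?_ hy
  intro y z hy hy' hz ha
  exact rcomp_step hy' (hs y z hy (rcomp_sub hy') hz ha) ha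

lemma rcomp_mono (h : U ⊆ U') : rcomp G U x ⊆ rcomp G U' x :=
  rcomp_subset_of (fun h' => h h') (fun _ _ _ _ hz _ => h hz)

lemma rcomp_symm (hy : y ∈ rcomp G U x) : x ∈ rcomp G U y := by
  have : ∀ w ∈ rcomp G U x, w ∈ rcomp G U y → x ∈ rcomp G U y := by
    intro w hw
    refine rcomp_ind (P := fun w => w ∈ rcomp G U y → x ∈ rcomp G U y) (fun _ h => h) ?_ hw
    intro u z hu ih hz ha h
    exact ih (rcomp_step h (rcomp_sub hu) ha.symm)
  exact this y hy (rcomp_self (rcomp_sub hy))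

lemma rcomp_trans (hy : y ∈ rcomp G U x) (hz : z ∈ rcomp G U y) : z ∈ rcomp G U x :=
  rcomp_ind (P := fun z => z ∈ rcomp G U x) (fun _ => hy)
    (fun _ _ _ h hz ha => rcomp_step h hz ha) hz

lemma rcomp_eq (hy : y ∈ rcomp G U x) : rcomp G U y = rcomp G U x :=
  Set.Subset.antisymm (fun _ h => rcomp_trans hy h) (fun _ h => rcomp_trans (rcomp_symm hy) h)

lemma rcomp_boundary (P : V → Prop) (hy : y ∈ rcomp G U x) (hPy : P y)
    (hz : z ∈ rcomp G U x) (hPz : ¬ P z) :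
    ∃ g h, g ∈ rcomp G U x ∧ h ∈ rcomp G U x ∧ P g ∧ ¬ P h ∧ G.Adj g h := by
  by_contra hcon
  push Not at hcon
  apply hPz
  rw [← rcomp_eq hy] at hz
  refine rcomp_ind (P := P) (fun _ => hPy) ?_ hz
  intro u w hu hPu hw ha
  rw [rcomp_eq hy] at hu
  by_contra hPw
  exact hcon u w hu (rcomp_step hu hw ha) hPu hPw ha

lemma rcomp_of_walk {x y : V} (p : G.Walk x y) (h : ∀ w ∈ p.support, w ∈ U) :
    y ∈ rcomp G U x := by
  induction p with
  | nil => exact rcomp_self (h _ (by simp))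
  | cons ha p ih =>
    have h1 := ih (fun w hw => h w (by simp [hw]))
    have h2 := rcomp_symm h1
    exact rcomp_symm (rcomp_step h2 (h _ (by simp)) ha.symm)

lemma walk_of_rcomp (h : y ∈ rcomp G U x) : ∃ p : G.Walk x y, ∀ w ∈ p.support, w ∈ U := by
  refine rcomp_ind (P := fun y => ∃ p : G.Walk x y, ∀ w ∈ p.support, w ∈ U)
    (fun h => ⟨.nil, by simpa using h⟩) ?_ h
  rintro y z hy ⟨p, hp⟩ hz ha
  refine ⟨p.concat ha, ?_⟩
  intro w hw
  rw [Walk.support_concat] at hw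
  simp only [List.mem_append, List.mem_singleton] at hw
  rcases hw with hw | rfl
  · exact hp w hw
  · exact hz

lemma rcomp_connected (hx : x ∈ U) : (G.induce (rcomp G U x)).Connected := by
  rw [connected_iff_exists_forall_reachable]
  refine ⟨⟨x, rcomp_self hx⟩, ?_⟩
  rintro ⟨y, hy⟩
  have : ∀ y (hy : y ∈ rcomp G U x), ∀ hy' : y ∈ rcomp G U x,
      (G.induce (rcomp G U x)).Reachable ⟨x, rcomp_self hx⟩ ⟨y, hy'⟩ := by
    intro y hy
    refine rcomp_ind (P := fun y => ∀ hy' : y ∈ rcomp G U x,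
      (G.induce (rcomp G U x)).Reachable ⟨x, rcomp_self hx⟩ ⟨y, hy'⟩) (fun _ _ => .rfl) ?_ hy
    intro u z hu ih hz ha hz'
    refine (ih hu).trans (Adj.reachable ?_)
    simpa using ha
  exact this y hy hy

lemma singleton_connected (x : V) : (G.induce ({x} : Set V)).Connected := by
  rw [connected_iff_exists_forall_reachable]
  refine ⟨⟨x, rfl⟩, ?_⟩
  rintro ⟨y, hy⟩
  obtain rfl : y = x := hy
  exact .rfl

/-- Lemma 0: bounding induced matchings between two sides. -/
lemma card_lt {k : ℕ} (hk : 1 ≤ k) (hfree : CreatureFree G k) {A B : Set V}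
    (hA : (G.induce A).Connected) (hB : (G.induce B).Connected)
    (hAB : Disjoint A B) (hnAB : ∀ a ∈ A, ∀ b ∈ B, ¬ G.Adj a b)
    {ι : Type*} (I : Finset ι) (x y : ι → V)
    (hxA : ∀ i ∈ I, Sees G (x i) A) (hxB : ∀ i ∈ I, ¬ Sees G (x i) B)
    (hyB : ∀ i ∈ I, Sees G (y i) B) (hyA : ∀ i ∈ I, ¬ Sees G (y i) A)
    (hxy : ∀ i ∈ I, ∀ j ∈ I, (G.Adj (x i) (y j) ↔ i = j)) : I.card < k := by
  by_contra hcon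
  push Not at hcon
  obtain ⟨e⟩ : Nonempty (Fin k ↪ I) := by
    apply Function.Embedding.nonempty_of_card_le
    simpa using hcon
  let X : Fin k → V := fun i => x (e i)
  let Y : Fin k → V := fun i => y (e i)
  have hXY : ∀ i j, G.Adj (X i) (Y j) ↔ i = j := by
    intro i j
    rw [hxy _ (e i).2 _ (e j).2]
    constructor
    · intro h; exact e.injective (Subtype.ext h)
    · rintro rfl; rfl
  obtain ⟨a0⟩ := hA.nonempty
  obtain ⟨b0⟩ := hB.nonempty
  have hXA : ∀ i, Sees G (X i) A := fun i => hxA _ (e i).2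
  have hXB : ∀ i, ¬ Sees G (X i) B := fun i => hxB _ (e i).2
  have hYB : ∀ i, Sees G (Y i) B := fun i => hyB _ (e i).2
  have hYA : ∀ i, ¬ Sees G (Y i) A := fun i => hyA _ (e i).2
  have i0 : Fin k := ⟨0, hk⟩
  refine hfree A B (Set.range X) (Set.range Y) ⟨⟨a0, a0.2⟩, ⟨b0, b0.2⟩, ⟨_, i0, rfl⟩, ⟨_, i0, rfl⟩,
    hAB, ?_, ?_, ?_, ?_, ?_, hA, hB, ?_, ?_, ?_, ?_, X, Y, ?_, ?_, rfl, rfl, hXY⟩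
  · rw [Set.disjoint_left]
    rintro _ h ⟨i, rfl⟩
    exact hYA i ⟨_, h, ((hXY i i).2 rfl).symm⟩
  · rw [Set.disjoint_left]
    rintro _ h ⟨i, rfl⟩
    obtain ⟨b, hb, hab⟩ := hYB i
    exact hnAB _ h _ hb hab
  · rw [Set.disjoint_left]
    rintro _ h ⟨i, rfl⟩
    obtain ⟨b, hb, hab⟩ := hXA i
    exact hnAB _ hb _ h hab.symm
  · rw [Set.disjoint_left]
    rintro _ h ⟨i, rfl⟩
    exact hXB i ⟨_, h, ((hXY i i).2 rfl)⟩
  · rw [Set.disjoint_left]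
    rintro _ ⟨j, rfl⟩ ⟨i, h⟩
    exact hXB j (h ▸ hYB i)
  · rintro a ha w (⟨i, rfl⟩ | hw) hadj
    · exact hYA i ⟨a, ha, hadj.symm⟩
    · exact hnAB a ha w hw hadj
  · rintro b hb w (hw | ⟨i, rfl⟩) hadj
    · exact hnAB w hw b hb hadj.symm
    · exact hXB i ⟨b, hb, hadj.symm⟩
  · rintro _ ⟨i, rfl⟩; exact hXA i
  · rintro _ ⟨i, rfl⟩; exact hYB i
  · intro i j hij
    exact (hXY i j).1 (hij ▸ (hXY j j).2 rfl)
  · intro i j hij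
    exact (hXY i j).1 (hij ▸ (hXY i i).2 rfl)

/-- Lemma 1: a minimal cover has private elements. -/
lemma min_cover {α β : Type*} (T : Finset α) (W : Set β) (r : α → β → Prop)
    (h : ∀ v ∈ W, ∃ t ∈ T, r t v) :
    ∃ Z ⊆ T, (∀ v ∈ W, ∃ t ∈ Z, r t v) ∧
      ∀ z ∈ Z, ∃ v ∈ W, r z v ∧ ∀ z' ∈ Z, r z' v → z' = z := by
  classical
  obtain ⟨Z, hZT, hZ⟩ := exists_minimal_le_of_wellFoundedLT
    (fun Z : Finset α => ∀ v ∈ W, ∃ t ∈ Z, r t v) T h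
  refine ⟨Z, hZT, hZ.1, ?_⟩
  intro z hz
  by_contra hcon
  push Not at hcon
  have h2 : ∀ v ∈ W, ∃ t ∈ Z.erase z, r t v := by
    intro v hv
    obtain ⟨t, ht, htv⟩ := hZ.1 v hv
    by_cases htz : t = z
    · subst htz
      obtain ⟨z', hz', h1, h2⟩ := hcon v hv htv
      exact ⟨z', Finset.mem_erase.2 ⟨h2, hz'⟩, h1⟩
    · exact ⟨t, Finset.mem_erase.2 ⟨htz, ht⟩, htv⟩
  have := hZ.2 h2 (Finset.erase_subset _ _) hz
  simp at this

/-- Lemma C. -/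
lemma cover [Fintype V] {k : ℕ} (hk : 1 ≤ k) (hfree : CreatureFree G k) {A B : Set V}
    (hA : (G.induce A).Connected) (hB : (G.induce B).Connected)
    (hAB : Disjoint A B) (hnAB : ∀ a ∈ A, ∀ b ∈ B, ¬ G.Adj a b)
    (T W : Set V) (hTA : ∀ t ∈ T, Sees G t A) (hTB : ∀ t ∈ T, ¬ Sees G t B)
    (hWB : ∀ t ∈ W, Sees G t B) (hWA : ∀ t ∈ W, ¬ Sees G t A)
    (hW : ∀ w ∈ W, ∃ t ∈ T, G.Adj t w) :
    ∃ Z : Finset V, Z.card < k ∧ (∀ z ∈ Z, z ∈ T) ∧ ∀ w ∈ W, ∃ t ∈ Z, G.Adj t w := by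
  classical
  obtain ⟨Z, hZT, hZ, hp⟩ := min_cover T.toFinset W G.Adj (by simpa using hW)
  choose! q hq using hp
  have hZT' : ∀ z ∈ Z, z ∈ T := fun z hz => by simpa using hZT hz
  refine ⟨Z, ?_, hZT', hZ⟩
  refine card_lt hk hfree hA hB hAB hnAB Z id q (fun i hi => hTA _ (hZT' i hi))
    (fun i hi => hTB _ (hZT' i hi)) (fun i hi => hWB _ (hq i hi).1) (fun i hi => hWA _ (hq i hi).1) ?_
  intro i hi j hj
  constructor
  · intro h
    exact (hq j hj).2.2 i hi h
  · rintro rfl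
    exact (hq i hi).2.1

def allowed (G : SimpleGraph V) (K Z : Set V) : Set V :=
  {x | x ∉ K ∧ ∀ y ∈ K ∪ Z, ¬ G.Adj x y}

def piece (G : SimpleGraph V) (K : Set V) (r : V) (Z : Set V) : Set V :=
  nbhd G K ∩ nbhd G (rcomp G (allowed G K Z) r)

lemma piece_exists [Fintype V] {k : ℕ} (hk : 1 ≤ k) (hfree : CreatureFree G k) {S K : Set V} {r : V}
    (hr : r ∉ S) (hE : ∀ s ∈ S, Sees G s (rcomp G Sᶜ r))
    (hKS : ∀ x ∈ K, x ∉ S) (hK : (G.induce K).Connected)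
    (hKE : ∀ x ∈ K, x ∉ rcomp G Sᶜ r) :
    ∃ Z : Finset V, Z.card < k ∧ piece G K r Z = nbhd G K ∩ S := by
  classical
  have hrE : r ∈ rcomp G Sᶜ r := rcomp_self hr
  have hEK : ∀ e ∈ rcomp G Sᶜ r, ∀ x ∈ K, ¬ G.Adj e x := fun e he x hx ha =>
    hKE x hx (rcomp_step he (hKS x hx) ha)
  let T : Finset V := (nbhd G K \ S).toFinset
  have hT : ∀ t, t ∈ T ↔ (t ∈ nbhd G K ∧ t ∉ S) := by intro t; simp [T]
  let good : Finset V → Prop := fun Z =>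
    ∀ x ∈ nbhd G K, x ∈ nbhd G (rcomp G (allowed G K Z) r) → x ∈ S
  have hgT : good T := by
    rintro x hx ⟨-, d, hd, hxd⟩
    by_contra hxS
    exact (rcomp_sub hd).2 x (Or.inr (by simpa using (hT x).2 ⟨hx, hxS⟩)) hxd.symm
  obtain ⟨Z, hZT, hZ⟩ := exists_minimal_le_of_wellFoundedLT good T hgT
  have hZT' : ∀ z ∈ Z, z ∈ nbhd G K ∧ z ∉ S := fun z hz => (hT z).1 (hZT hz)
  have hsub : ∀ Z' ⊆ Z, rcomp G Sᶜ r ⊆ rcomp G (allowed G K Z') r := by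
    intro Z' hZ'
    have key : ∀ e ∈ rcomp G Sᶜ r, e ∈ allowed G K Z' := by
      intro e he
      refine ⟨fun h => hKE e h he, ?_⟩
      rintro y (hy | hy) ha
      · exact hEK e he y hy ha
      · have h1 := hZT' y (hZ' (by simpa using hy))
        obtain ⟨⟨-, c, hc, hyc⟩, hyS⟩ := h1
        exact hEK y (rcomp_step he hyS ha) c hc hyc
    exact rcomp_subset_of (fun _ => key r hrE) (fun y z hy _ hz ha => key z (rcomp_step hy hz ha))
  have hnot : ∀ Z' : Set V, ∀ x ∈ nbhd G K, x ∉ rcomp G (allowed G K Z') r := by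
    rintro Z' x ⟨-, c, hc, hxc⟩ hx
    exact (rcomp_sub hx).2 c (Or.inl hc) hxc
  refine ⟨Z, ?_, ?_⟩
  · have hpriv : ∀ z ∈ Z, ∃ q, Sees G q (rcomp G (allowed G K Z) r) ∧ ¬ Sees G q K ∧ G.Adj z q ∧
        ∀ z' ∈ Z, G.Adj z' q → z' = z := by
      intro z hz
      have h1 : ¬ good (Z.erase z) := by
        intro hg
        have := hZ.2 hg (Finset.erase_subset _ _) hz
        simp at this
      simp only [good] at h1
      push Not at h1
      obtain ⟨x, hxK, ⟨hx1, d, hd, hxd⟩, hxS⟩ := h1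
      have hdD : d ∉ rcomp G (allowed G K Z) r := by
        intro hd'
        exact hxS (hZ.1 x hxK ⟨hnot _ x hxK, d, hd', hxd⟩)
      have hrD := hsub Z (Finset.Subset.refl _) hrE
      obtain ⟨g, q, hg, hq, hPg, hPq, hgq⟩ := rcomp_boundary
        (fun v => v ∈ rcomp G (allowed G K Z) r) (hsub _ (Finset.erase_subset z Z) hrE) hrD hd hdD
      have hqa := rcomp_sub hq
      have hqn : q ∉ allowed G K Z := fun h => hPq (rcomp_step hPg h hgq)
      have hoth : ∀ z' ∈ Z, G.Adj z' q → z' = z := by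
        intro z' hz' ha
        by_contra hne
        exact hqa.2 z' (Or.inr (by simp [hne, hz'])) ha.symm
      refine ⟨q, ⟨g, hPg, hgq.symm⟩, ?_, ?_, hoth⟩
      · rintro ⟨c, hc, hqc⟩
        exact hqa.2 c (Or.inl hc) hqc
      · by_contra hzq
        apply hqn
        refine ⟨hqa.1, ?_⟩
        rintro y (hy | hy) ha
        · exact hqa.2 y (Or.inl hy) ha
        · obtain rfl := hoth y (by simpa using hy) ha.symm
          exact hzq ha.symm
    choose! q hq1 hq2 hq3 hq4 using hpriv
    refine card_lt hk hfree hK (rcomp_connected (rcomp_sub (hsub Z (Finset.Subset.refl _) hrE)))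
      ?_ ?_ Z id q ?_ ?_ hq1 hq2 ?_
    · rw [Set.disjoint_left]
      intro x hx hx'
      exact (rcomp_sub hx').1 hx
    · intro x hx y hy ha
      exact (rcomp_sub hy).2 x (Or.inl hx) ha.symm
    · intro z hz
      exact (hZT' z hz).1.2
    · rintro z hz ⟨d, hd, hzd⟩
      exact (rcomp_sub hd).2 z (Or.inr (by simpa using hz)) hzd.symm
    · intro i hi j hj
      constructor
      · intro h; exact hq4 j hj i hi h
      · rintro rfl; exact hq3 i hi
  · apply Set.Subset.antisymm
    · rintro x ⟨hx1, hx2⟩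
      exact ⟨hx1, hZ.1 x hx1 hx2⟩
    · rintro x ⟨hx1, hx2⟩
      refine ⟨hx1, hnot _ x hx1, ?_⟩
      obtain ⟨e, he, hxe⟩ := hE x hx2
      exact ⟨e, hsub Z (Finset.Subset.refl _) he, hxe⟩

lemma exists_range {k : ℕ} (Z : Finset V) (hZ : Z.card ≤ k) (hk : 1 ≤ k) (hne : Z.Nonempty) :
    ∃ g : Fin k → V, Set.range g = Z := by
  have : Nonempty (Fin k) := ⟨⟨0, hk⟩⟩
  have : Nonempty Z := ⟨⟨_, hne.choose_spec⟩⟩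
  obtain ⟨e⟩ : Nonempty (Z ↪ Fin k) := by
    apply Function.Embedding.nonempty_of_card_le
    simpa using hZ
  refine ⟨fun i => (Function.invFun e i : Z), ?_⟩
  ext v
  constructor
  · rintro ⟨i, rfl⟩
    exact (Function.invFun e i).2
  · intro hv
    exact ⟨e ⟨v, hv⟩, by simp [Function.leftInverse_invFun e.injective _]⟩

/-- Piece lemma with an enumeration. -/
lemma piece_exists' [Fintype V] {k : ℕ} (hk : 1 ≤ k) (hfree : CreatureFree G k) {S K : Set V} {r : V}
    (hr : r ∉ S) (hE : ∀ s ∈ S, Sees G s (rcomp G Sᶜ r))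
    (hKS : ∀ x ∈ K, x ∉ S) (hK : K.Nonempty → (G.induce K).Connected)
    (hKE : ∀ x ∈ K, x ∉ rcomp G Sᶜ r) :
    ∃ g : Fin k → V, piece G K r (Set.range g) = nbhd G K ∩ S := by
  classical
  rcases K.eq_empty_or_nonempty with rfl | hne
  · refine ⟨fun _ => r, ?_⟩
    have : nbhd G (∅ : Set V) = ∅ := by ext; simp [nbhd]
    simp [piece, this]
  · obtain ⟨Z, hZ, h⟩ := piece_exists hk hfree hr hE hKS (hK hne) hKE
    obtain ⟨c, hc⟩ := hne
    obtain ⟨g, hg⟩ := exists_range (k := k) (insert c Z)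
      ((Finset.card_insert_le _ _).trans hZ) hk (by simp)
    refine ⟨g, ?_⟩
    rw [← h, hg]
    have : allowed G K ((insert c Z : Finset V) : Set V) = allowed G K Z := by
      have h2 : K ∪ ((insert c Z : Finset V) : Set V) = K ∪ Z := by
        ext v
        simp only [Finset.coe_insert, Set.mem_union, Set.mem_insert_iff]
        constructor
        · rintro (h | rfl | h)
          · exact Or.inl h
          · exact Or.inl hc
          · exact Or.inr h
        · rintro (h | h)
          · exact Or.inl h
          · exact Or.inr (Or.inr h)
      simp only [allowed, h2]
    simp only [piece, this]

/-- The two full components of a minimal separator. -/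
structure Ctx (G : SimpleGraph V) (S : Set V) (a b : V) : Prop where
  ha : a ∉ S
  hb : b ∉ S
  seeA : ∀ s ∈ S, Sees G s (rcomp G Sᶜ a)
  seeB : ∀ s ∈ S, Sees G s (rcomp G Sᶜ b)
  disj : b ∉ rcomp G Sᶜ a

lemma Ctx.not_both {S : Set V} {a b : V} (h : Ctx G S a b) {x : V}
    (hx : x ∈ rcomp G Sᶜ a) (hx' : x ∈ rcomp G Sᶜ b) : False :=
  h.disj (rcomp_trans hx (rcomp_symm hx'))

lemma Ctx.no_adj {S : Set V} {a b : V} (h : Ctx G S a b) {x y : V}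
    (hx : x ∈ rcomp G Sᶜ a) (hy : y ∈ rcomp G Sᶜ b) : ¬ G.Adj x y := fun hxy =>
  h.not_both (rcomp_step hx (rcomp_sub hy) hxy) hy

lemma exists_ctx {S : Set V} (h : IsMinimalSeparator G S) : ∃ a b, Ctx G S a b := by
  obtain ⟨u, v, ⟨⟨hu, hv, hsep⟩, hmin⟩⟩ := h
  have hd : v ∉ rcomp G Sᶜ u := by
    intro hx
    obtain ⟨p, hp⟩ := walk_of_rcomp hx
    obtain ⟨w, hw, hwS⟩ := hsep p
    exact hp w hw hwS
  have key : ∀ s ∈ S, v ∈ rcomp G (insert s Sᶜ) u := by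
    intro s hs
    have h1 := hmin (S \ {s}) ⟨Set.sdiff_subset, fun h => (h hs).2 rfl⟩
    simp only [IsUVSeparator] at h1
    push Not at h1
    obtain ⟨p, hp⟩ := h1 (fun h => hu h.1) (fun h => hv h.1)
    refine rcomp_of_walk p ?_
    intro w hw
    have := hp w hw
    simp only [Set.mem_sdiff, Set.mem_singleton_iff, not_and, not_not] at this
    by_cases hwS : w ∈ S
    · exact Or.inl (this hwS)
    · exact Or.inr hwS
  have see : ∀ (u v : V), u ∉ S → v ∉ rcomp G Sᶜ u →
      ∀ s ∈ S, v ∈ rcomp G (insert s Sᶜ) u → Sees G s (rcomp G Sᶜ u) := by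
    intro u v hu hd s hs hk
    obtain ⟨g, q, hg, hq, hPg, hPq, hgq⟩ := rcomp_boundary (fun x => x ∈ rcomp G Sᶜ u)
      (rcomp_base hk) (rcomp_self hu) hk hd
    rcases rcomp_sub hq with rfl | hqS
    · exact ⟨g, hPg, hgq.symm⟩
    · exact absurd (rcomp_step hPg hqS hgq) hPq
  exact ⟨u, v, hu, hv, fun s hs => see u v hu hd s hs (key s hs),
    fun s hs => see v u hv (fun h => hd (rcomp_symm h)) s hs (rcomp_symm (key s hs)), hd⟩

lemma cover_two [Fintype V] {k : ℕ} (hk : 1 ≤ k) (hfree : CreatureFree G k) {S K W : Set V}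
    {a b s : V} (hc : Ctx G S a b) (hs : s ∈ S) (hK : (G.induce K).Connected)
    (hKB : K ⊆ rcomp G Sᶜ b) (hKs : ∀ x ∈ K, ¬ G.Adj s x)
    (hWS : ∀ w ∈ W, w ∈ S) (hWs : ∀ w ∈ W, ¬ G.Adj w s) (hWK : ∀ w ∈ W, Sees G w K)
    (hW1 : ∀ w ∈ W, ∀ x, x ∉ S → x ∉ rcomp G Sᶜ b → G.Adj x s → ¬ G.Adj x w)
    (hW2 : ∀ w ∈ W, ∃ x ∈ rcomp G Sᶜ b, G.Adj x s ∧ G.Adj x w) :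
    ∃ F : Finset V, F.card ≤ (k - 1) * (k - 1) ∧ (∀ z ∈ F, z ∉ S) ∧
      ∀ w ∈ W, ∃ z ∈ F, G.Adj z w := by
  classical
  have hAS : ∀ x ∈ rcomp G Sᶜ a, x ∉ S := fun x hx => rcomp_sub hx
  have hBS : ∀ x ∈ rcomp G Sᶜ b, x ∉ S := fun x hx => rcomp_sub hx
  let U : Set V := {x | x ∈ rcomp G Sᶜ a ∧ ¬ G.Adj x s}
  have hUA : ∀ m, ∀ x ∈ rcomp G U m, x ∈ rcomp G Sᶜ a := fun m x hx => (rcomp_sub hx).1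
  obtain ⟨F0, hF0, hcov, hpriv⟩ := min_cover U.toFinset W (fun m v => Sees G v (rcomp G U m)) (by
    intro v hv
    obtain ⟨x, hx, hvx⟩ := hc.seeA v (hWS v hv)
    have hxU : x ∈ U := ⟨hx, fun h => hW1 v hv x (hAS x hx) (fun h' => hc.not_both hx h') h hvx.symm⟩
    exact ⟨x, by simpa using hxU, x, rcomp_self hxU, hvx⟩)
  have hF0U : ∀ m ∈ F0, m ∈ U := fun m hm => by simpa using hF0 hm
  choose! y hyW hy1 hy2 using hpriv
  have hF0card : F0.card < k := by
    let W' : Set V := {x | x = s ∨ (x ∈ rcomp G Sᶜ a ∧ ∀ m ∈ F0, ¬ G.Adj x (y m))}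
    have hsW' : s ∈ W' := Or.inl rfl
    have hx : ∀ m ∈ F0, ∃ x ∈ rcomp G U m, G.Adj x (y m) ∧ Sees G x (rcomp G W' s) := by
      intro m hm
      have hmU := hF0U m hm
      obtain ⟨d0, hd0, hsd0⟩ := hc.seeA s hs
      obtain ⟨c, d, hcA, hdA, hcM, hdM, hcd⟩ := rcomp_boundary (fun v => v ∈ rcomp G U m)
        hmU.1 (rcomp_self hmU) hd0 (fun h => (rcomp_sub h).2 hsd0.symm)
      have hds : G.Adj d s := by
        by_contra hds
        exact hdM (rcomp_step hcM ⟨hdA, hds⟩ hcd)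
      have hdW' : d ∈ W' := Or.inr ⟨hdA, fun m' hm' => hW1 _ (hyW m' hm') d (hAS d hdA)
        (fun h' => hc.not_both hdA h') hds⟩
      have hdA' : d ∈ rcomp G W' s := rcomp_step (rcomp_self hsW') hdW' hds.symm
      by_cases hcy : G.Adj c (y m)
      · exact ⟨c, hcM, hcy, d, hdA', hcd⟩
      have hM : ∀ x ∈ rcomp G U m, ∀ m' ∈ F0, G.Adj x (y m') → m = m' := by
        intro x hx m' hm' ha
        exact hy2 m' hm' m hm ⟨x, hx, ha.symm⟩
      have hcW' : c ∈ W' := by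
        refine Or.inr ⟨hcA, ?_⟩
        intro m' hm' ha
        obtain rfl := hM c hcM m' hm' ha
        exact hcy ha
      have hcA' : c ∈ rcomp G W' s := rcomp_step hdA' hcW' hcd.symm
      obtain ⟨e, heM, hye⟩ := hy1 m hm
      have heA' : e ∉ rcomp G W' s := by
        intro h
        rcases rcomp_sub h with rfl | h
        · exact hAS _ (hUA m _ heM) hs
        · exact h.2 m hm hye.symm
      obtain ⟨g, h, hg, hh, hg', hh', hgh⟩ := rcomp_boundary (fun v => v ∈ rcomp G W' s)
        hcM hcA' heM heA'
      refine ⟨h, hh, ?_, g, hg', hgh.symm⟩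
      by_contra hhy
      apply hh'
      refine rcomp_step hg' (Or.inr ⟨hUA m h hh, ?_⟩) hgh
      intro m' hm' ha
      obtain rfl := hM h hh m' hm' ha
      exact hhy ha
    choose! x hxM hxy hxA' using hx
    refine card_lt hk hfree (rcomp_connected hsW') hK ?_ ?_ F0 x y hxA' ?_
      (fun i hi => hWK _ (hyW i hi)) ?_ ?_
    · rw [Set.disjoint_left]
      intro v hv hvK
      rcases rcomp_sub hv with rfl | h
      · exact hBS _ (hKB hvK) hs
      · exact hc.not_both h.1 (hKB hvK)
    · intro v hv z hz
      rcases rcomp_sub hv with rfl | h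
      · exact hKs z hz
      · exact hc.no_adj h.1 (hKB hz)
    · rintro m hm ⟨z, hz, ha⟩
      exact hc.no_adj (hUA m _ (hxM m hm)) (hKB hz) ha
    · rintro m hm ⟨z, hz, ha⟩
      rcases rcomp_sub hz with rfl | h
      · exact hWs _ (hyW m hm) ha
      · exact h.2 m hm ha.symm
    · intro i hi j hj
      constructor
      · intro h
        exact hy2 j hj i hi ⟨_, hxM i hi, h.symm⟩
      · rintro rfl
        exact hxy i hi
  have hZ : ∀ m ∈ F0, ∃ Z : Finset V, Z.card < k ∧
      (∀ z ∈ Z, z ∈ {x | x ∈ rcomp G Sᶜ b ∧ G.Adj x s}) ∧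
      ∀ w ∈ {w | w ∈ W ∧ Sees G w (rcomp G U m)}, ∃ t ∈ Z, G.Adj t w := by
    intro m hm
    refine cover hk hfree (singleton_connected s) (rcomp_connected (hF0U m hm)) ?_ ?_ _ _ ?_ ?_ ?_ ?_ ?_
    · rw [Set.disjoint_left]
      rintro v rfl hv
      exact hAS _ (hUA m _ hv) hs
    · rintro v rfl z hz ha
      exact (rcomp_sub hz).2 ha.symm
    · rintro t ⟨_, h⟩
      exact ⟨s, rfl, h⟩
    · rintro t ⟨h, _⟩ ⟨z, hz, ha⟩
      exact hc.no_adj (hUA m z hz) h ha.symm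
    · rintro t ⟨_, h⟩; exact h
    · rintro t ⟨h, _⟩ ⟨z, rfl, ha⟩
      exact hWs _ h ha
    · rintro w ⟨h, _⟩
      obtain ⟨x, hx1, hx2, hx3⟩ := hW2 w h
      exact ⟨x, ⟨hx1, hx2⟩, hx3⟩
  choose! Z hZ1 hZ2 hZ3 using hZ
  refine ⟨F0.biUnion Z, ?_, ?_, ?_⟩
  · refine (Finset.card_biUnion_le_card_mul _ _ (k - 1) (fun m hm => Nat.le_sub_one_of_lt (hZ1 m hm))).trans ?_
    exact Nat.mul_le_mul_right _ (Nat.le_sub_one_of_lt hF0card)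
  · intro z hz
    obtain ⟨m, hm, hz⟩ := Finset.mem_biUnion.1 hz
    exact hBS z (hZ2 m hm z hz).1
  · intro w hw
    obtain ⟨m, hm, hwm⟩ := hcov w hw
    obtain ⟨t, ht, ha⟩ := hZ3 m hm w ⟨hw, hwm⟩
    exact ⟨t, Finset.mem_biUnion.2 ⟨m, hm, ht⟩, ha⟩

def KB (G : SimpleGraph V) (S : Set V) (b : V) (J : Set V) : Set V :=
  rcomp G {x | x ∉ S ∧ ∀ j ∈ J, ¬ G.Adj x j} b

lemma KB_sub {S : Set V} {b : V} {J : Set V} (h : x ∈ KB G S b J) :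
    x ∉ S ∧ ∀ j ∈ J, ¬ G.Adj x j :=
  rcomp_sub (U := {x | x ∉ S ∧ ∀ j ∈ J, ¬ G.Adj x j}) h

def Rem (G : SimpleGraph V) (S : Set V) (J : Set V) : Set V :=
  {t | t ∈ S ∧ ∀ j ∈ J, t ≠ j ∧ ¬ G.Adj t j ∧ ∀ w, w ∉ S → G.Adj w t → ¬ G.Adj w j}

lemma stage [Fintype V] {k : ℕ} (hk : 1 ≤ k) (hfree : CreatureFree G k) {S J : Set V}
    {a b : V} (hc : Ctx G S a b) (hsee : ∀ t ∈ Rem G S J, Sees G t (KB G S b J))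
    (hne : (Rem G S J).Nonempty) :
    ∃ s ∈ Rem G S J, ∃ F : Finset V, F.card ≤ k ^ 2 ∧ F.Nonempty ∧ (∀ z ∈ F, z ∉ S) ∧
      (∀ t ∈ Rem G S J, Sees G t (KB G S b (insert s J)) ∨ ∃ z ∈ F, G.Adj z t) ∧
      (∀ t ∈ Rem G S (insert s J), Sees G t (KB G S b (insert s J))) ∧
      (∀ t ∈ Rem G S J, G.Adj t s ∨ t ∈ Rem G S (insert s J) ∨ ∃ z ∈ F, G.Adj z t) := by
  classical
  obtain ⟨s, hs, hmax⟩ := Set.exists_max_image (Rem G S J)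
    (fun s => (KB G S b (insert s J)).ncard) (Set.toFinite _) hne
  set K := KB G S b (insert s J) with hKdef
  have hK0 : ∀ x ∈ KB G S b J, x ∉ S ∧ ∀ j ∈ J, ¬ G.Adj x j := fun x hx => KB_sub hx
  have hKU : ∀ x ∈ K, x ∉ S ∧ ∀ j ∈ insert s J, ¬ G.Adj x j := fun x hx => KB_sub hx
  have hKs : ∀ x ∈ K, ¬ G.Adj x s := fun x hx => (hKU x hx).2 s (Set.mem_insert _ _)
  have hKK0 : K ⊆ KB G S b J := rcomp_mono (fun x hx => ⟨hx.1, fun j hj => hx.2 j (Or.inr hj)⟩)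
  have hKB : K ⊆ rcomp G Sᶜ b := rcomp_mono (fun x hx => hx.1)
  have hf : ∃ f ∈ KB G S b J, G.Adj f s ∧ (K.Nonempty → Sees G f K) ∧ (K = ∅ → f = b) := by
    obtain ⟨c, hc0, hsc⟩ := hsee s hs
    rcases K.eq_empty_or_nonempty with he | ⟨x0, hx0⟩
    · have hb0 : b ∈ KB G S b J := rcomp_base hc0
      refine ⟨b, hb0, ?_, fun h => by simp [he] at h, fun _ => rfl⟩
      by_contra hbs
      have : b ∈ K := by
        refine rcomp_self ⟨(hK0 b hb0).1, ?_⟩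
        rintro j (rfl | hj)
        · exact hbs
        · exact (hK0 b hb0).2 j hj
      rw [he] at this
      exact this
    · have hbK : b ∈ K := rcomp_base hx0
      obtain ⟨g, f, hg, hf, hgK, hfK, hgf⟩ := rcomp_boundary (fun v => v ∈ K)
        (hKK0 hbK) hbK hc0 (fun h => hKs c h hsc.symm)
      refine ⟨f, hf, ?_, fun _ => ⟨g, hgK, hgf.symm⟩, fun he => by simp [he] at hx0⟩
      by_contra hfs
      apply hfK
      refine rcomp_step hgK ⟨(hK0 f hf).1, ?_⟩ hgf
      rintro j (rfl | hj)
      · exact hfs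
      · exact (hK0 f hf).2 j hj
  obtain ⟨f, hf0, hfs, hfK, hfb⟩ := hf
  have hfS : f ∉ S := (hK0 f hf0).1
  have claim : ∀ t ∈ Rem G S J, ¬ G.Adj f t → Sees G t K := by
    intro t ht hft
    by_contra hn
    have hft' : f ∈ {x | x ∉ S ∧ ∀ j ∈ insert t J, ¬ G.Adj x j} := by
      refine ⟨hfS, ?_⟩
      rintro j (rfl | hj)
      · exact hft
      · exact (hK0 f hf0).2 j hj
    have hKt : ∀ x ∈ K, x ∈ {x | x ∉ S ∧ ∀ j ∈ insert t J, ¬ G.Adj x j} := by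
      intro x hx
      refine ⟨(hKU x hx).1, ?_⟩
      rintro j (rfl | hj) ha
      · exact hn ⟨x, hx, ha.symm⟩
      · exact (hKU x hx).2 j (Or.inr hj) ha
    have hsub : K ⊆ KB G S b (insert t J) := by
      refine rcomp_subset_of (fun h => hKt b (rcomp_self h)) ?_
      intro y z hy _ hz ha
      exact hKt z (rcomp_step hy hz ha)
    have hfmem : f ∈ KB G S b (insert t J) := by
      rcases K.eq_empty_or_nonempty with he | hne
      · obtain rfl := hfb he
        exact rcomp_self hft'
      · obtain ⟨g, hg, hfg⟩ := hfK hne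
        exact rcomp_step (hsub hg) hft' hfg.symm
    have hlt : K.ncard < (KB G S b (insert t J)).ncard :=
      Set.ncard_lt_ncard ⟨hsub, fun h => hKs f (h hfmem) hfs⟩ (Set.toFinite _)
    exact absurd (hmax t ht) (not_le.2 hlt)
  have claim2 : ∀ t ∈ Rem G S (insert s J), Sees G t K := by
    intro t ht
    refine claim t ⟨ht.1, fun j hj => ht.2 j (Or.inr hj)⟩ ?_
    intro h
    exact (ht.2 s (Set.mem_insert _ _)).2.2 f hfS h hfs
  -- covering
  let W : Set V := {t | t ∈ Rem G S J ∧ ¬ G.Adj t s ∧ ¬ G.Adj f t}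
  have hWK : ∀ t ∈ W, Sees G t K := fun t ht => claim t ht.1 ht.2.2
  let T1 : Set V := {x | x ∉ S ∧ x ∉ rcomp G Sᶜ b ∧ G.Adj x s}
  have hcov : ∃ F : Finset V, F.card ≤ (k - 1) + (k - 1) * (k - 1) ∧ (∀ z ∈ F, z ∉ S) ∧
      ∀ w ∈ W, (∃ x, x ∉ S ∧ G.Adj x s ∧ G.Adj x w) → ∃ z ∈ F, G.Adj z w := by
    rcases W.eq_empty_or_nonempty with he | ⟨w0, hw0⟩
    · exact ⟨∅, by simp, by simp, by simp [he]⟩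
    obtain ⟨x0, hx0, _⟩ := hWK w0 hw0
    have hKc : (G.induce K).Connected := rcomp_connected (KB_sub (rcomp_base hx0))
    obtain ⟨F1, h1, h2, h3⟩ := cover hk hfree (singleton_connected s) hKc
      (by
        rw [Set.disjoint_left]
        rintro v rfl hv
        exact (hKU _ hv).1 hs.1)
      (by
        rintro v rfl z hz ha
        exact hKs z hz ha.symm)
      T1 {w | w ∈ W ∧ ∃ t ∈ T1, G.Adj t w}
      (fun t ht => ⟨s, rfl, ht.2.2⟩)
      (by
        rintro t ht ⟨z, hz, ha⟩
        exact ht.2.1 (rcomp_step (hKB hz) ht.1 ha.symm))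
      (fun t ht => hWK t ht.1)
      (by
        rintro t ht ⟨z, rfl, ha⟩
        exact ht.1.2.1 ha)
      (fun t ht => ht.2)
    obtain ⟨F2, h4, h5, h6⟩ := cover_two (W := {w | w ∈ W ∧ (¬ ∃ t ∈ T1, G.Adj t w) ∧
        ∃ x, x ∉ S ∧ G.Adj x s ∧ G.Adj x w}) hk hfree hc hs.1 hKc hKB
      (fun x hx ha => hKs x hx ha.symm) (fun w hw => hw.1.1.1) (fun w hw => hw.1.2.1)
      (fun w hw => hWK w hw.1)
      (fun w hw x hx1 hx2 hx3 hx4 => hw.2.1 ⟨x, ⟨hx1, hx2, hx3⟩, hx4⟩)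
      (by
        rintro w ⟨_, h, x, hx1, hx2, hx3⟩
        refine ⟨x, ?_, hx2, hx3⟩
        by_contra hxB
        exact h ⟨x, ⟨hx1, hxB, hx2⟩, hx3⟩)
    refine ⟨F1 ∪ F2, ?_, ?_, ?_⟩
    · exact (Finset.card_union_le _ _).trans (Nat.add_le_add (Nat.le_sub_one_of_lt h1) h4)
    · intro z hz
      rcases Finset.mem_union.1 hz with hz | hz
      · exact (h2 z hz).1
      · exact h5 z hz
    · intro w hw hx
      by_cases h : ∃ t ∈ T1, G.Adj t w
      · obtain ⟨z, hz, ha⟩ := h3 w ⟨hw, h⟩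
        exact ⟨z, Finset.mem_union_left _ hz, ha⟩
      · obtain ⟨z, hz, ha⟩ := h6 w ⟨hw, h, hx⟩
        exact ⟨z, Finset.mem_union_right _ hz, ha⟩
  obtain ⟨F, hF1, hF2, hF3⟩ := hcov
  refine ⟨s, hs, insert f F, ?_, by simp, ?_, ?_, claim2, ?_⟩
  · refine (Finset.card_insert_le _ _).trans ?_
    obtain ⟨m, rfl⟩ : ∃ m, k = m + 1 := ⟨k - 1, by omega⟩
    simp only [Nat.add_sub_cancel] at hF1
    nlinarith
  · intro z hz
    rcases Finset.mem_insert.1 hz with rfl | hz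
    · exact hfS
    · exact hF2 z hz
  · intro t ht
    by_cases h : G.Adj f t
    · exact Or.inr ⟨f, by simp, h⟩
    · exact Or.inl (claim t ht h)
  · intro t ht
    by_cases h1 : G.Adj t s
    · exact Or.inl h1
    by_cases h2 : G.Adj f t
    · exact Or.inr (Or.inr ⟨f, by simp, h2⟩)
    by_cases h3 : t ∈ Rem G S (insert s J)
    · exact Or.inr (Or.inl h3)
    refine Or.inr (Or.inr ?_)
    have hts : t ≠ s := by
      rintro rfl
      exact h2 hfs
    have : ∃ x, x ∉ S ∧ G.Adj x s ∧ G.Adj x t := by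
      by_contra hcon
      apply h3
      refine ⟨ht.1, ?_⟩
      rintro j (rfl | hj)
      · exact ⟨hts, h1, fun w hw h h' => hcon ⟨w, hw, h', h⟩⟩
      · exact ht.2 j hj
    obtain ⟨z, hz, ha⟩ := hF3 t ⟨ht, h1, h2⟩ this
    exact ⟨z, Finset.mem_insert_of_mem hz, ha⟩

abbrev PC (V : Type*) (k : ℕ) := V × V × (Fin k → V)

abbrev Lvl (V : Type*) (k : ℕ) := V × (Fin (k ^ 2) → PC V k) × PC V k

def pcSet {k : ℕ} (G : SimpleGraph V) (p : PC V k) : Set V :=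
  piece G {p.1} p.2.1 (Set.range p.2.2)

def lvlP {k : ℕ} (G : SimpleGraph V) (c : Lvl V k) : Set V := ⋃ i, pcSet G (c.2.1 i)

def dec {k : ℕ} (G : SimpleGraph V) : List (Lvl V k) → Set V → Set V → Set V
  | [], _, Kn => Kn
  | c :: cs, J, Kn =>
    dec G cs (insert c.1 J) (Kn ∪ lvlP G c) ∪
      piece G (rcomp G {x | x ∉ dec G cs (insert c.1 J) (Kn ∪ lvlP G c) ∧
        ∀ j ∈ insert c.1 J, ¬ G.Adj x j} c.2.2.1) c.2.2.2.1 (Set.range c.2.2.2.2)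

def triv (V : Type*) (k : ℕ) (v : V) : Lvl V k :=
  (v, fun _ => (v, v, fun _ => v), (v, v, fun _ => v))

lemma piece_empty_of_mem {K Z : Set V} {r : V} (h : r ∈ K) : piece G K r Z = ∅ := by
  ext t
  simp only [Set.mem_empty_iff_false, iff_false]
  rintro ⟨-, -, d, hd, -⟩
  exact (rcomp_sub (rcomp_base hd)).1 h

lemma piece_rcomp_empty {U Z : Set V} {r : V} : piece G (rcomp G U r) r Z = ∅ := by
  by_cases h : r ∈ U
  · exact piece_empty_of_mem (rcomp_self h)
  · ext t
    simp only [Set.mem_empty_iff_false, iff_false]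
    rintro ⟨⟨-, d, hd, -⟩, -⟩
    exact h hd.1

lemma dec_triv {k : ℕ} (v : V) (m : ℕ) : ∀ J Kn : Set V,
    dec G (List.replicate m (triv V k v)) J Kn = Kn := by
  induction m with
  | zero => intro J Kn; rfl
  | succ m ih =>
    intro J Kn
    have h1 : lvlP G (triv V k v) = ∅ := by
      simp only [lvlP, triv, pcSet]
      rw [Set.iUnion_eq_empty]
      intro i
      exact piece_empty_of_mem rfl
    simp only [List.replicate_succ, dec, ih, h1]
    simp [triv, piece_rcomp_empty]

def Pack (G : SimpleGraph V) (S J : Set V) : Prop :=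
  ∀ i ∈ J, ∀ j ∈ J, i ≠ j → ¬ G.Adj i j ∧ ∀ w, w ∉ S → G.Adj w i → ¬ G.Adj w j

lemma Pack.insert {S J : Set V} {t : V} (h : Pack G S J) (ht : t ∈ Rem G S J) :
    Pack G S (insert t J) := by
  rintro i (rfl | hi) j (rfl | hj) hij
  · exact absurd rfl hij
  · exact (ht.2 j hj).2
  · obtain ⟨_, h1, h2⟩ := ht.2 i hi
    exact ⟨fun h => h1 h.symm, fun w hw ha hb => h2 w hw hb ha⟩
  · exact h i hi j hj hij

lemma Pack.le_zeta [Fintype V] {S J : Set V} (h : Pack G S J) (hJ : J ⊆ S) :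
    J.ncard ≤ zeta G S := by
  refine le_csSup ⟨Fintype.card V, ?_⟩ ⟨J, hJ, ?_, ?_, rfl⟩
  · rintro n ⟨I, -, -, -, rfl⟩
    rw [← Nat.card_eq_fintype_card]
    exact Set.ncard_le_card I
  · intro i hi j hj ha
    exact (h i hi j hj ha.ne).1 ha
  · intro v hv
    rw [Set.ncard_le_one (Set.toFinite _)]
    rintro i ⟨hi, hvi⟩ j ⟨hj, hvj⟩
    by_contra hij
    exact (h i hi j hj hij).2 v hv hvi hvj

lemma dec_exists [Fintype V] {k L : ℕ} (hk : 1 ≤ k) (hfree : CreatureFree G k) {S : Set V}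
    {a b : V} (hc : Ctx G S a b) (hL : zeta G S ≤ L) (m : ℕ) :
    ∀ J Kn : Set V, L ≤ J.ncard + m → J ⊆ S → Pack G S J → Kn ⊆ S →
      (∀ t ∈ S, t ∉ Kn → t ∈ Rem G S J ∨ ∃ j ∈ J, G.Adj t j) →
      (∀ t ∈ Rem G S J, Sees G t (KB G S b J)) →
      ∃ cs : List (Lvl V k), cs.length = m ∧ Kn ⊆ dec G cs J Kn ∧ dec G cs J Kn ⊆ S ∧
        ∀ t ∈ S, t ∉ dec G cs J Kn → ∃ j ∈ J, G.Adj t j := by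
  classical
  induction m with
  | zero =>
    intro J Kn hm hJ hP hKn hrem hsee
    refine ⟨[], rfl, subset_rfl, hKn, ?_⟩
    intro t ht htn
    rcases hrem t ht htn with h | h
    · exfalso
      have h1 := (hP.insert h).le_zeta (Set.insert_subset ht hJ)
      rw [Set.ncard_insert_of_notMem (fun h' => (h.2 t h').1 rfl) (Set.toFinite _)] at h1
      omega
    · exact h
  | succ m ih =>
    intro J Kn hm hJ hP hKn hrem hsee
    rcases (Rem G S J).eq_empty_or_nonempty with he | hne
    · refine ⟨List.replicate (m + 1) (triv V k a), by simp, ?_⟩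
      rw [dec_triv]
      refine ⟨subset_rfl, hKn, ?_⟩
      intro t ht htn
      rcases hrem t ht htn with h | h
      · simp [he] at h
      · exact h
    obtain ⟨s, hs, F, hFc, hFne, hFS, hF1, hF2, hF3⟩ := stage hk hfree hc hsee hne
    obtain ⟨e, he⟩ := exists_range F hFc (Nat.one_le_pow _ _ hk) hFne
    have hpc : ∀ z, ∃ p : V × (Fin k → V), z ∉ S →
        piece G {z} p.1 (Set.range p.2) = nbhd G {z} ∩ S := by
      intro z
      by_cases hz : z ∈ S
      · exact ⟨(a, fun _ => a), fun h => absurd hz h⟩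
      by_cases hzB : z ∈ rcomp G Sᶜ b
      · obtain ⟨g, hg⟩ := piece_exists' (K := {z}) hk hfree hc.ha hc.seeA
          (by rintro x rfl; exact hz) (fun _ => singleton_connected z)
          (by rintro x rfl h; exact hc.not_both h hzB)
        exact ⟨(a, g), fun _ => hg⟩
      · obtain ⟨g, hg⟩ := piece_exists' (K := {z}) hk hfree hc.hb hc.seeB
          (by rintro x rfl; exact hz) (fun _ => singleton_connected z)
          (by rintro x rfl h; exact hzB h)
        exact ⟨(b, g), fun _ => hg⟩
    choose p hp using hpc
    have hKBB : KB G S b (insert s J) ⊆ rcomp G Sᶜ b := rcomp_mono (fun x hx => hx.1)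
    obtain ⟨g, hg⟩ := piece_exists' (K := KB G S b (insert s J)) hk hfree hc.ha hc.seeA
      (fun x hx => (KB_sub hx).1)
      (fun ⟨x, hx⟩ => rcomp_connected (KB_sub (rcomp_base hx)))
      (fun x hx h => hc.not_both h (hKBB hx))
    let c : Lvl V k := (s, fun i => (e i, p (e i)), (b, a, g))
    have hlvl : ∀ t, t ∈ lvlP G c ↔ t ∈ S ∧ ∃ z ∈ F, G.Adj z t := by
      intro t
      have hi : ∀ i, pcSet G (c.2.1 i) = nbhd G {e i} ∩ S := by
        intro i
        refine hp (e i) (hFS _ ?_)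
        have : e i ∈ (F : Set V) := he ▸ ⟨i, rfl⟩
        exact this
      simp only [lvlP, hi, Set.mem_iUnion]
      constructor
      · rintro ⟨i, ⟨-, z, rfl, ha⟩, htS⟩
        have : e i ∈ (F : Set V) := he ▸ ⟨i, rfl⟩
        exact ⟨htS, _, this, ha.symm⟩
      · rintro ⟨htS, z, hz, ha⟩
        have : z ∈ Set.range e := by rw [he]; exact hz
        obtain ⟨i, rfl⟩ := this
        exact ⟨i, ⟨fun h => ha.ne (Set.mem_singleton_iff.1 h).symm, _, rfl, ha.symm⟩, htS⟩
    obtain ⟨cs, hlen, hsub, hRS, hR⟩ := ih (insert s J) (Kn ∪ lvlP G c)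
      (by
        rw [Set.ncard_insert_of_notMem (fun h' => (hs.2 s h').1 rfl) (Set.toFinite _)]
        omega)
      (Set.insert_subset hs.1 hJ) (hP.insert hs)
      (Set.union_subset hKn (fun t ht => ((hlvl t).1 ht).1))
      (by
        intro t ht htn
        have h1 : t ∉ Kn := fun h => htn (Or.inl h)
        rcases hrem t ht h1 with h | ⟨j, hj, ha⟩
        · rcases hF3 t h with h | h | h
          · exact Or.inr ⟨s, Set.mem_insert _ _, h⟩
          · exact Or.inl h
          · exact absurd (Or.inr ((hlvl t).2 ⟨ht, h⟩)) htn
        · exact Or.inr ⟨j, Or.inr hj, ha⟩)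
      hF2
    set R := dec G cs (insert s J) (Kn ∪ lvlP G c) with hRdef
    have hdec : dec G (c :: cs) J Kn = R ∪ (nbhd G (KB G S b (insert s J)) ∩ S) := by
      have hset : {x | x ∉ R ∧ ∀ j ∈ insert s J, ¬ G.Adj x j} =
          {x | x ∉ S ∧ ∀ j ∈ insert s J, ¬ G.Adj x j} := by
        ext x
        constructor
        · rintro ⟨h1, h2⟩
          refine ⟨fun hxS => ?_, h2⟩
          obtain ⟨j, hj, ha⟩ := hR x hxS h1
          exact h2 j hj ha
        · rintro ⟨h1, h2⟩
          exact ⟨fun h => h1 (hRS h), h2⟩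
      rw [← hg]
      change R ∪ piece G (rcomp G {x | x ∉ R ∧ ∀ j ∈ insert s J, ¬ G.Adj x j} b) a (Set.range g) = _
      rw [hset]
      rfl
    refine ⟨c :: cs, by simp [hlen], ?_⟩
    rw [hdec]
    refine ⟨fun t ht => Or.inl (hsub (Or.inl ht)), ?_, ?_⟩
    · rintro t (h | h)
      · exact hRS h
      · exact h.2
    · intro t ht htn
      have h1 : t ∉ R := fun h => htn (Or.inl h)
      rcases hrem t ht (fun h => h1 (hsub (Or.inl h))) with h | h
      · exfalso
        rcases hF1 t h with h | h
        · exact htn (Or.inr ⟨⟨fun h' => (KB_sub h').1 ht, h⟩, ht⟩)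
        · exact h1 (hsub (Or.inr ((hlvl t).2 ⟨ht, h⟩)))
      · exact h

lemma dec_main [Fintype V] {k L : ℕ} (hk : 1 ≤ k) (hfree : CreatureFree G k) {S : Set V}
    (hS : IsMinimalSeparator G S) (hL : zeta G S ≤ L) :
    ∃ cs : List.Vector (Lvl V k) L, dec G cs.1 ∅ ∅ = S := by
  obtain ⟨a, b, hc⟩ := exists_ctx hS
  obtain ⟨cs, hlen, -, h1, h2⟩ := dec_exists hk hfree hc hL L ∅ ∅ (by simp) (by simp)
    (by intro i hi; simp at hi) (by simp) (fun t ht _ => Or.inl ⟨ht, by simp⟩)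
    (by
      intro t ht
      have : KB G S b ∅ = rcomp G Sᶜ b := by
        simp only [KB, Set.mem_empty_iff_false, false_imp_iff, implies_true, and_true]
        rfl
      rw [this]
      exact hc.seeB t ht.1)
  refine ⟨⟨cs, hlen⟩, Set.Subset.antisymm h1 ?_⟩
  intro t ht
  by_contra hn
  obtain ⟨j, hj, -⟩ := h2 t ht hn
  exact hj

lemma card_Lvl [Fintype V] (k : ℕ) :
    Fintype.card (Lvl V k) = Fintype.card V ^ (1 + (k ^ 2 + 1) * (k + 2)) := by
  simp only [Fintype.card_prod, Fintype.card_fun, Fintype.card_fin]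
  have h : Fintype.card V * (Fintype.card V * Fintype.card V ^ k) = Fintype.card V ^ (k + 2) := by
    ring
  rw [h, ← pow_mul, ← pow_add, ← pow_succ']
  congr 1
  ring

end helpers

/-- Theorem 4: in a `k`-creature-free graph, the number of minimal separators
`S` with `ζ_G(S) ≤ L` is at most `n ^ (L·(4 + (k²+2)(k+2)))`. -/
theorem creatureFree_minimalSeparators_zeta_le
    (k L : ℕ) (hk : 1 ≤ k) {V : Type*} [Fintype V] (G : SimpleGraph V)
    (hfree : CreatureFree G k) :
    {S : Set V | IsMinimalSeparator G S ∧ zeta G S ≤ L}.ncard ≤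
      Fintype.card V ^ (L * (4 + (k ^ 2 + 2) * (k + 2))) := by
  classical
  rcases isEmpty_or_nonempty V with hV | hV
  · have : {S : Set V | IsMinimalSeparator G S ∧ zeta G S ≤ L} = ∅ := by
      ext S
      simp only [Set.mem_ofPred_eq, Set.mem_empty_iff_false, iff_false]
      rintro ⟨⟨u, -⟩, -⟩
      exact hV.false u
    rw [this]
    simp
  have hsub : {S : Set V | IsMinimalSeparator G S ∧ zeta G S ≤ L} ⊆
      Set.range (fun cs : List.Vector (Lvl V k) L => dec G cs.1 ∅ ∅) := by
    rintro S ⟨h1, h2⟩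
    exact dec_main hk hfree h1 h2
  refine (Set.ncard_le_ncard hsub (Set.toFinite _)).trans ?_
  rw [← Set.image_univ]
  refine (Set.ncard_image_le (Set.toFinite _)).trans ?_
  rw [Set.ncard_univ, Nat.card_eq_fintype_card, card_vector, card_Lvl, ← pow_mul]
  refine Nat.pow_le_pow_right Fintype.card_pos ?_
  rw [mul_comm]
  refine Nat.mul_le_mul_left _ ?_
  nlinarith
end
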